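/- There exists γ*(d) > √(7d/4) such that for every γ ∈ (0, γ*(d)], the family of random measures {M^H_γ}_{H∈(0,H₀)} converges in probability, as H ↓ 0, to a random Borel measure M_γ on D, with respect to the topology of weak convergence of measures on D. -/

import Mathlib

open MeasureTheory ProbabilityTheory Filter Set

/-- Countably many `L¹`-Cauchy families have a common subsequence converging almost surely. -/
lemma exists_seq_ae_tendsto_of_cauchy {Ω α : Type*} [MeasurableSpace Ω] {P : Measure Ω}
    {l : Filter α} [l.NeBot] {I : ℕ → α → Ω → ℝ} {s : Set α} (hs : s ∈ l)
    (hmeas : ∀ i, ∀ a ∈ s, AEStronglyMeasurable (I i a) P)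
    (hI : ∀ i, ∀ ε : ENNReal, 0 < ε →
      ∀ᶠ p in l ×ˢ l, eLpNorm (I i p.1 - I i p.2) 1 P ≤ ε) :
    ∃ u : ℕ → α, (∀ n, u n ∈ s) ∧ ∃ c : ℕ → Ω → ℝ, (∀ i, AEStronglyMeasurable (c i) P) ∧
      (∀ i, ∀ᵐ ω ∂P, Tendsto (fun n => I i (u n) ω) atTop (nhds (c i ω))) ∧
      ∀ i, Tendsto (fun a => eLpNorm (I i a - c i) 1 P) l (nhds 0) := by
  have hpow : ∀ n : ℕ, (0 : ENNReal) < (1 / 2) ^ (n + 1) := fun n =>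
    ENNReal.pow_pos (by simp) _
  have hV : ∀ i n : ℕ, ∃ V ∈ l, ∀ a ∈ V, ∀ b ∈ V,
      eLpNorm (I i a - I i b) 1 P ≤ (1 / 2) ^ (n + 1) := by
    intro i n
    have h := hI i _ (hpow n)
    obtain ⟨V, hV, hV'⟩ := mem_prod_same_iff.1 h
    refine ⟨V, hV, fun a ha b hb => ?_⟩
    have hab : (a, b) ∈ V ×ˢ V := ⟨ha, hb⟩
    have := hV' hab
    simpa only [Set.mem_ofPred_eq] using this
  choose V hVl hV using hV
  have hU : ∀ n, ((⋂ i ∈ Iic n, ⋂ m ∈ Iic n, V i m) ∩ s) ∈ l := fun n =>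
    inter_mem ((biInter_mem (finite_Iic n)).2 fun i _ =>
      (biInter_mem (finite_Iic n)).2 fun m _ => hVl i m) hs
  choose u hu using fun n => (l.nonempty_of_mem (hU n))
  have huV : ∀ i n m, i ≤ n → m ≤ n → u n ∈ V i m := fun i n m hi hm => by
    have := (hu n).1
    simp only [mem_iInter, mem_Iic] at this
    exact this i hi m hm
  have hus : ∀ n, u n ∈ s := fun n => (hu n).2
  have hB : ∑' i : ℕ, ((fun n : ℕ => ((1 / 2 : NNReal) ^ n)) i : ENNReal) ≠ ⊤ := by
    rw [ENNReal.tsum_coe_ne_top_iff_summable]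
    exact NNReal.summable_geometric (by rw [div_lt_one] <;> norm_num)
  have hB' : ∀ n : ℕ, (((1 / 2 : NNReal) ^ n : NNReal) : ENNReal) = (1 / 2) ^ n := fun n => by
    rw [ENNReal.coe_pow]; congr 1; simp
  have hlt : ∀ n : ℕ, (1 / 2 : ENNReal) ^ (n + 1) < (1 / 2) ^ n := by
    intro n
    rw [pow_succ]
    calc (1 / 2 : ENNReal) ^ n * (1 / 2) < (1 / 2) ^ n * 1 := by
          rw [ENNReal.mul_lt_mul_iff_right (by simp) (ENNReal.pow_ne_top (by simp))]
          simp [ENNReal.inv_lt_one]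
      _ = _ := mul_one _
  have hcau : ∀ i N n m : ℕ, N ≤ n → N ≤ m →
      eLpNorm (I i (u (n + i)) - I i (u (m + i))) 1 P
        < ((fun n : ℕ => ((1 / 2 : NNReal) ^ n)) N : NNReal) := by
    intro i N n m hn hm
    refine (hV i N _ (huV i _ N ?_ ?_) _ (huV i _ N ?_ ?_)).trans_lt ?_
    · omega
    · omega
    · omega
    · omega
    · simp only
      rw [hB']; exact hlt N
  have hae : ∀ i, ∀ᵐ ω ∂P, ∃ c, Tendsto (fun n => I i (u (n + i)) ω) atTop (nhds c) := fun i =>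
    Lp.ae_tendsto_of_cauchy_eLpNorm (fun n => hmeas i _ (hus _)) le_rfl hB (hcau i)
  have hae' : ∀ i, ∃ c : Ω → ℝ, AEStronglyMeasurable c P ∧
      ∀ᵐ ω ∂P, Tendsto (fun n => I i (u (n + i)) ω) atTop (nhds (c ω)) := fun i => by
    obtain ⟨c, hc, hc'⟩ := exists_stronglyMeasurable_limit_of_tendsto_ae
      (f := fun n => I i (u (n + i))) (fun n => hmeas i _ (hus _)) (hae i)
    exact ⟨c, hc.aestronglyMeasurable, hc'⟩
  choose c hcm hc using hae'
  refine ⟨u, hus, c, hcm, fun i => ?_, fun i => ?_⟩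
  · filter_upwards [hc i] with ω hω
    exact (tendsto_add_atTop_iff_nat i).1 hω
  · have hlim := Lp.cauchy_tendsto_of_tendsto (p := 1)
      (fun n => hmeas i _ (hus (n + i))) (c i) hB (hcau i) (hc i)
    rw [ENNReal.tendsto_nhds_zero]
    intro ε hε
    obtain ⟨n, hn⟩ : ∃ n : ℕ, (1 / 2 : ENNReal) ^ n < ε :=
      ((ENNReal.tendsto_pow_atTop_nhds_zero_of_lt_one
        (by simp [ENNReal.inv_lt_one])).eventually_lt_const hε).exists
    filter_upwards [hVl i n, hs] with a ha has
    have h1 : ∀ᶠ m in atTop, eLpNorm (I i (u (m + i)) - c i) 1 P ≤ (1 / 2) ^ (n + 1) :=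
      (ENNReal.tendsto_nhds_zero.1 hlim) _ (hpow n)
    obtain ⟨m, hm, hmn⟩ := (h1.and (eventually_ge_atTop n)).exists
    have e : I i a - c i = (I i a - I i (u (m + i))) + (I i (u (m + i)) - c i) := by abel
    rw [e]
    calc _ ≤ eLpNorm (I i a - I i (u (m + i))) 1 P + eLpNorm (I i (u (m + i)) - c i) 1 P :=
          eLpNorm_add_le ((hmeas i _ has).sub (hmeas i _ (hus _)))
            ((hmeas i _ (hus _)).sub (hcm i)) le_rfl
      _ ≤ (1 / 2) ^ (n + 1) + (1 / 2) ^ (n + 1) :=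
          add_le_add (hV i n _ ha _ (huV i _ n (by omega) (by omega))) hm
      _ = (1 / 2) ^ n := by
          rw [pow_succ, ← mul_add, one_div, ENNReal.inv_two_add_inv_two, mul_one]
      _ ≤ ε := hn.le

open scoped NNReal BoundedContinuousFunction in
/-- Measures of bounded mass on a compact set have a cluster point. -/
lemma exists_finiteMeasure_lintegral_eq_of_tendsto {E : Type*} [TopologicalSpace E] [T2Space E]
    [MeasurableSpace E] [BorelSpace E]
    {K : Set E} (hK : IsCompact K) {M : ℕ → Measure E} {C : ℝ≥0}
    (hM : ∀ᶠ n in atTop, M n univ ≤ C) (hMK : ∀ n, M n Kᶜ = 0) :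
    ∃ μ : FiniteMeasure E, (μ : Measure E) Kᶜ = 0 ∧ ∀ (f : E →ᵇ ℝ≥0) (c : ENNReal),
      Tendsto (fun n => ∫⁻ x, f x ∂M n) atTop (nhds c) → ∫⁻ x, f x ∂(μ : Measure E) = c := by
  classical
  let N : ℕ → FiniteMeasure E := fun n => if h : M n univ ≤ C then
    ⟨M n, ⟨h.trans_lt ENNReal.coe_lt_top⟩⟩ else 0
  have hN : ∀ᶠ n in atTop, (N n : Measure E) = M n := by
    filter_upwards [hM] with n hn
    simp [N, hn]
  let T : Set (FiniteMeasure E) := {μ : FiniteMeasure E | μ.mass ≤ C ∧ μ Kᶜ = 0}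
  have hT : IsCompact T := isCompact_setOfPred_finiteMeasure_le_of_isCompact C hK
  have hmem : ∀ᶠ n in atTop, N n ∈ T := by
    filter_upwards [hM, hN] with n hn hn'
    refine ⟨?_, ?_⟩
    · rw [← ENNReal.coe_le_coe, FiniteMeasure.ennreal_mass, hn']
      exact hn
    · rw [← ENNReal.coe_eq_zero, FiniteMeasure.ennreal_coeFn_eq_coeFn_toMeasure, hn']
      exact hMK n
  have hle : (hyperfilter ℕ : Filter ℕ) ≤ atTop := Nat.hyperfilter_le_atTop
  obtain ⟨μ, hμT, hμ⟩ := hT.ultrafilter_le_nhds ((hyperfilter ℕ).map N)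
    (by rw [le_principal_iff]; exact hle hmem)
  refine ⟨μ, ?_, fun f c hf => ?_⟩
  · rw [← FiniteMeasure.ennreal_coeFn_eq_coeFn_toMeasure, ENNReal.coe_eq_zero]
    exact hμT.2
  · have h1 : Tendsto N (hyperfilter ℕ : Filter ℕ) (nhds μ) := hμ
    have h2 := (FiniteMeasure.tendsto_iff_forall_lintegral_tendsto.1 h1) f
    refine tendsto_nhds_unique h2 ((hf.mono_left hle).congr' ?_)
    filter_upwards [hle hN] with n hn
    rw [show (N n : Measure E) = M n from hn]

section

open scoped NNReal BoundedContinuousFunction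

/-- A bound on the Lévy–Prokhorov distance by finitely many test functions. -/
lemma levyProkhorovEDist_le_of_lintegral_thickenedIndicator {E : Type*} [PseudoMetricSpace E]
    [MeasurableSpace E] [BorelSpace E] {μ ν : Measure E} {K : Set E} (hμ : μ Kᶜ = 0)
    (hν : ν Kᶜ = 0) {e : ℕ → E} {r : ℝ} (hr : 0 < r) {m : ℕ}
    (hK : K ⊆ ⋃ i ∈ Finset.range m, Metric.ball (e i) r) {δ : ENNReal}
    (hδ : ENNReal.ofReal (3 * r) ≤ δ)
    (h : ∀ S ∈ (Finset.range m).powerset,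
      (∫⁻ x, thickenedIndicator hr (⋃ i ∈ S, Metric.ball (e i) r) x ∂μ
        ≤ ∫⁻ x, thickenedIndicator hr (⋃ i ∈ S, Metric.ball (e i) r) x ∂ν + δ) ∧
      (∫⁻ x, thickenedIndicator hr (⋃ i ∈ S, Metric.ball (e i) r) x ∂ν
        ≤ ∫⁻ x, thickenedIndicator hr (⋃ i ∈ S, Metric.ball (e i) r) x ∂μ + δ)) :
    levyProkhorovEDist μ ν ≤ δ := by
  classical
  refine levyProkhorovEDist_le_of_forall μ ν δ fun ε B hε hεtop hB => ?_
  set S := (Finset.range m).filter fun i => (Metric.ball (e i) r ∩ B).Nonempty with hS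
  set A := ⋃ i ∈ S, Metric.ball (e i) r with hA
  have hAo : MeasurableSet A :=
    (isOpen_biUnion fun i _ => Metric.isOpen_ball).measurableSet
  have hBA : B ∩ K ⊆ A := by
    rintro x ⟨hxB, hxK⟩
    obtain ⟨i, hi, hxi⟩ := mem_iUnion₂.1 (hK hxK)
    exact mem_iUnion₂.2 ⟨i, by simp only [hS, Finset.mem_filter]; exact ⟨hi, x, hxi, hxB⟩, hxi⟩
  have h3 : 3 * r ≤ ε.toReal := by
    rw [← ENNReal.ofReal_le_iff_le_toReal hεtop.ne]
    exact hδ.trans hε.le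
  have hAB : Metric.thickening r A ⊆ Metric.thickening ε.toReal B := by
    intro x hx
    rw [Metric.mem_thickening_iff] at hx ⊢
    obtain ⟨y, hy, hxy⟩ := hx
    obtain ⟨i, hi, hyi⟩ := mem_iUnion₂.1 hy
    simp only [hS, Finset.mem_filter] at hi
    obtain ⟨z, hzi, hzB⟩ := hi.2
    refine ⟨z, hzB, ?_⟩
    rw [Metric.mem_ball] at hyi hzi
    have h1 := dist_triangle x y z
    have h2 := dist_triangle y (e i) z
    rw [dist_comm (e i) z] at h2
    linarith
  have hlow : ∀ κ : Measure E, κ Kᶜ = 0 → κ B ≤ ∫⁻ x, thickenedIndicator hr A x ∂κ := by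
    intro κ hκ
    calc κ B ≤ κ (A ∪ Kᶜ) := measure_mono fun x hx => by
          by_cases hxK : x ∈ K
          · exact Or.inl (hBA ⟨hx, hxK⟩)
          · exact Or.inr hxK
      _ ≤ κ A + κ Kᶜ := measure_union_le _ _
      _ = ∫⁻ x, A.indicator 1 x ∂κ := by rw [hκ, add_zero, lintegral_indicator_one hAo]
      _ ≤ _ := by
          refine lintegral_mono fun x => ?_
          by_cases hx : x ∈ A
          · rw [indicator_of_mem hx, thickenedIndicator_one hr A hx]; simp
          · rw [indicator_of_notMem hx]; simp
  have hup : ∀ κ : Measure E, ∫⁻ x, thickenedIndicator hr A x ∂κ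
      ≤ κ (Metric.thickening ε.toReal B) := by
    intro κ
    calc ∫⁻ x, thickenedIndicator hr A x ∂κ
        ≤ ∫⁻ x, (Metric.thickening r A).indicator 1 x ∂κ := by
          refine lintegral_mono fun x => ?_
          by_cases hx : x ∈ Metric.thickening r A
          · rw [indicator_of_mem hx]
            exact ENNReal.coe_le_one_iff.2 (thickenedIndicator_le_one hr A x)
          · rw [thickenedIndicator_zero hr A hx]; simp
      _ = κ (Metric.thickening r A) :=
          lintegral_indicator_one Metric.isOpen_thickening.measurableSet
      _ ≤ _ := measure_mono hAB
  have hS' : S ∈ (Finset.range m).powerset := by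
    rw [Finset.mem_powerset]; exact Finset.filter_subset _ _
  obtain ⟨h1, h2⟩ := h S hS'
  exact ⟨(hlow μ hμ).trans (h1.trans (add_le_add (hup ν) hε.le)),
    (hlow ν hν).trans (h2.trans (add_le_add (hup μ) hε.le))⟩

lemma enorm_toReal_sub_toReal_le (x y : ENNReal) :
    ‖x.toReal - y.toReal‖ₑ ≤ (x - y) + (y - x) := by
  induction x with
  | top =>
    induction y with
    | top => simp
    | coe y => simp
  | coe x =>
    induction y with
    | top => simp
    | coe y =>
      rw [← ENNReal.coe_sub, ← ENNReal.coe_sub, ← ENNReal.coe_add]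
      simp only [ENNReal.coe_toReal]
      rw [enorm_eq_nnnorm, ENNReal.coe_le_coe, ← NNReal.coe_le_coe, coe_nnnorm, Real.norm_eq_abs]
      rcases le_total x y with h | h
      · rw [tsub_eq_zero_of_le h, zero_add, NNReal.coe_sub h, abs_sub_comm,
          abs_of_nonneg (sub_nonneg.2 (by exact_mod_cast h))]
      · rw [tsub_eq_zero_of_le h, add_zero, NNReal.coe_sub h,
          abs_of_nonneg (sub_nonneg.2 (by exact_mod_cast h))]

lemma le_add_of_enorm_toReal_sub_le {x δ : ENNReal} {c : ℝ} (hx : x ≠ ⊤)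
    (h : ‖x.toReal - c‖ₑ ≤ δ) : x ≤ ENNReal.ofReal c + δ ∧ ENNReal.ofReal c ≤ x + δ := by
  rw [← ofReal_norm, Real.norm_eq_abs] at h
  have hx' := ENNReal.ofReal_toReal hx
  constructor
  · calc x = ENNReal.ofReal x.toReal := hx'.symm
      _ ≤ ENNReal.ofReal (c + |x.toReal - c|) :=
        ENNReal.ofReal_le_ofReal (by linarith [le_abs_self (x.toReal - c)])
      _ ≤ _ := ENNReal.ofReal_add_le.trans (by gcongr)
  · calc ENNReal.ofReal c ≤ ENNReal.ofReal (x.toReal + |x.toReal - c|) :=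
        ENNReal.ofReal_le_ofReal (by linarith [neg_abs_le (x.toReal - c)])
      _ ≤ ENNReal.ofReal x.toReal + ENNReal.ofReal |x.toReal - c| := ENNReal.ofReal_add_le
      _ ≤ _ := by rw [hx']; gcongr

/-- Random measures on a bounded open set whose integrals of test functions are Cauchy in `L¹`
converge in probability for the Lévy–Prokhorov distance. -/
theorem exists_tendsto_levyProkhorovEDist {Ω α E : Type*} [MeasurableSpace Ω] {P : Measure Ω}
    [IsFiniteMeasure P] [MetricSpace E] [ProperSpace E] [Nonempty E] [MeasurableSpace E]
    [BorelSpace E] {l : Filter α} [l.NeBot] {M : α → Ω → Measure E} {D : Set E}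
    (hDo : IsOpen D) (hDb : Bornology.IsBounded D) {ν : Measure E} [IsFiniteMeasure ν]
    (hνD : ν Dᶜ = 0) {s : Set α} (hs : s ∈ l) (hMD : ∀ a ω, M a ω Dᶜ = 0)
    (hmeas : ∀ a ∈ s, ∀ f : E →ᵇ ℝ≥0, AEMeasurable (fun ω => ∫⁻ x, f x ∂M a ω) P)
    (hmean : ∀ a ∈ s, ∀ f : E →ᵇ ℝ≥0, ∫⁻ ω, ∫⁻ x, f x ∂M a ω ∂P = ∫⁻ x, f x ∂ν)
    (hcau : ∀ f : E →ᵇ ℝ≥0, (∀ x, f x ≤ 1) → ∀ ε : ENNReal, 0 < ε → ∀ᶠ p in l ×ˢ l,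
      ∫⁻ ω, (∫⁻ x, f x ∂M p.1 ω - ∫⁻ x, f x ∂M p.2 ω) ∂P ≤ ε) :
    ∃ Mlim : Ω → Measure E, (∀ ω, Mlim ω = (Mlim ω).restrict D) ∧
      ∀ ε : ENNReal, 0 < ε →
        Tendsto (fun a => P {ω | ε ≤ levyProkhorovEDist (M a ω) (Mlim ω)}) l (nhds 0) := by
  classical
  obtain ⟨e, he⟩ := TopologicalSpace.exists_dense_seq E
  have hr : ∀ n : ℕ, (0 : ℝ) < 1 / (n + 1) := fun n => by positivity
  let f₁ : ℕ × Finset ℕ → (E →ᵇ ℝ≥0) := fun q =>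
    thickenedIndicator (hr q.1) (⋃ i ∈ q.2, Metric.ball (e i) (1 / (q.1 + 1)))
  let f₂ : ℕ → (E →ᵇ ℝ≥0) := fun n => thickenedIndicator (hr n) Dᶜ
  obtain ⟨F, hF⟩ := (((countable_range f₁).union (countable_range f₂)).union
    (countable_singleton (1 : E →ᵇ ℝ≥0))).exists_eq_range ⟨1, by simp⟩
  have hF₁ : ∀ q, ∃ k, F k = f₁ q := fun q => by
    rw [← mem_range, ← hF]; exact Or.inl (Or.inl ⟨q, rfl⟩)
  have hF₂ : ∀ q, ∃ k, F k = f₂ q := fun q => by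
    rw [← mem_range, ← hF]; exact Or.inl (Or.inr ⟨q, rfl⟩)
  obtain ⟨k₁, hk₁⟩ : ∃ k, F k = 1 := by
    rw [← mem_range, ← hF]; exact Or.inr rfl
  have hF1 : ∀ k x, F k x ≤ 1 := by
    intro k x
    have : F k ∈ range F := ⟨k, rfl⟩
    rw [← hF] at this
    rcases this with (⟨q, hq⟩ | ⟨q, hq⟩) | h
    · rw [← hq]; exact thickenedIndicator_le_one _ _ x
    · rw [← hq]; exact thickenedIndicator_le_one _ _ x
    · rw [show F k = 1 from h]; simp
  let I : ℕ → α → Ω → ℝ := fun k a ω => (∫⁻ x, F k x ∂M a ω).toReal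
  obtain ⟨u, hus, c, hcm, hae, hlim⟩ := exists_seq_ae_tendsto_of_cauchy (P := P) (I := I) hs
    (fun k a ha => (hmeas a ha (F k)).ennreal_toReal.aestronglyMeasurable) (by
      intro k ε hε
      have hε2 : 0 < ε / 2 := ENNReal.half_pos hε.ne'
      have h1 := hcau (F k) (hF1 k) _ hε2
      have h2 : ∀ᶠ p in l ×ˢ l,
          ∫⁻ ω, (∫⁻ x, F k x ∂M p.2 ω - ∫⁻ x, F k x ∂M p.1 ω) ∂P ≤ ε / 2 :=
        tendsto_prod_swap.eventually h1
      have h3 : ∀ᶠ p : α × α in l ×ˢ l, p.1 ∈ s ∧ p.2 ∈ s :=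
        (tendsto_fst.eventually hs).and (tendsto_snd.eventually hs)
      filter_upwards [h1, h2, h3] with p h1 h2 h3
      rw [eLpNorm_one_eq_lintegral_enorm]
      calc _ ≤ ∫⁻ ω, ((∫⁻ x, F k x ∂M p.1 ω - ∫⁻ x, F k x ∂M p.2 ω)
            + (∫⁻ x, F k x ∂M p.2 ω - ∫⁻ x, F k x ∂M p.1 ω)) ∂P :=
            lintegral_mono fun ω => enorm_toReal_sub_toReal_le _ _
        _ = _ := lintegral_add_left' ((hmeas _ h3.1 _).sub (hmeas _ h3.2 _)) _
        _ ≤ ε / 2 + ε / 2 := add_le_add h1 h2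
        _ = ε := ENNReal.add_halves ε)
  have hfin : ∀ a ∈ s, ∀ᵐ ω ∂P, M a ω univ < ⊤ := by
    intro a ha
    have h := hmean a ha 1
    simp only [BoundedContinuousFunction.coe_one, Pi.one_apply, ENNReal.coe_one,
      lintegral_one] at h
    have h' := hmeas a ha 1
    simp only [BoundedContinuousFunction.coe_one, Pi.one_apply, ENNReal.coe_one,
      lintegral_one] at h'
    exact ae_lt_top' h' (by rw [h]; exact measure_ne_top _ _)
  have hIfin : ∀ k a ω, M a ω univ < ⊤ → ∫⁻ x, F k x ∂M a ω ≠ ⊤ := by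
    intro k a ω h
    refine ((lintegral_mono (g := fun _ => 1) fun x => ?_).trans_lt ?_).ne
    · exact ENNReal.coe_le_one_iff.2 (hF1 k x)
    · rw [lintegral_one]; exact h
  have hcl : IsCompact (closure D) := hDb.isCompact_closure
  have hbd : ∀ᵐ ω ∂P, ⨅ j, ENNReal.ofReal (c ((hF₂ j).choose) ω) = 0 := by
    have hmc : ∀ k, AEMeasurable (fun ω => ENNReal.ofReal (c k ω)) P := fun k =>
      (hcm k).aemeasurable.ennreal_ofReal
    have hle : ∀ j, ∫⁻ ω, ENNReal.ofReal (c ((hF₂ j).choose) ω) ∂P ≤ ∫⁻ x, f₂ j x ∂ν := by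
      intro j
      set k := (hF₂ j).choose with hk
      have hFk : F k = f₂ j := (hF₂ j).choose_spec
      calc ∫⁻ ω, ENNReal.ofReal (c k ω) ∂P
          ≤ ∫⁻ ω, liminf (fun n => ∫⁻ x, F k x ∂M (u n) ω) atTop ∂P := by
            refine lintegral_mono_ae ?_
            filter_upwards [hae k, ae_all_iff.2 fun n => hfin (u n) (hus n)] with ω h1 h2
            have : Tendsto (fun n => ENNReal.ofReal (I k (u n) ω)) atTop
                (nhds (ENNReal.ofReal (c k ω))) := ENNReal.tendsto_ofReal h1
            have h3 : (fun n => ENNReal.ofReal (I k (u n) ω))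
                = fun n => ∫⁻ x, F k x ∂M (u n) ω :=
              funext fun n => ENNReal.ofReal_toReal (hIfin k _ ω (h2 n))
            rw [h3] at this
            exact this.liminf_eq.ge
        _ ≤ liminf (fun n => ∫⁻ ω, ∫⁻ x, F k x ∂M (u n) ω ∂P) atTop :=
            lintegral_liminf_le' fun n => hmeas _ (hus n) _
        _ = ∫⁻ x, f₂ j x ∂ν := by
            simp_rw [fun n => hmean (u n) (hus n) (F k)]
            rw [liminf_const, hFk]
    have ht : Tendsto (fun j => ∫⁻ x, f₂ j x ∂ν) atTop (nhds (ν Dᶜ)) :=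
      tendsto_lintegral_thickenedIndicator_of_isClosed ν hDo.isClosed_compl hr
        tendsto_one_div_add_atTop_nhds_zero_nat
    rw [hνD] at ht
    have h0 : ∫⁻ ω, ⨅ j, ENNReal.ofReal (c ((hF₂ j).choose) ω) ∂P = 0 := by
      refine le_antisymm (ge_of_tendsto' ht fun j => ?_) zero_le
      exact (lintegral_mono fun ω => iInf_le _ j).trans (hle j)
    exact (lintegral_eq_zero_iff' (AEMeasurable.iInf fun j => hmc _)).1 h0
  have hgood : ∀ᵐ ω ∂P, ∃ μ : Measure E, μ Dᶜ = 0 ∧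
      ∀ k, ∫⁻ x, F k x ∂μ = ENNReal.ofReal (c k ω) := by
    filter_upwards [ae_all_iff.2 hae, ae_all_iff.2 fun n => hfin (u n) (hus n), hbd]
      with ω h1 h2 h3
    have ht : ∀ k, Tendsto (fun n => ∫⁻ x, F k x ∂M (u n) ω) atTop
        (nhds (ENNReal.ofReal (c k ω))) := by
      intro k
      have : Tendsto (fun n => ENNReal.ofReal (I k (u n) ω)) atTop
          (nhds (ENNReal.ofReal (c k ω))) := ENNReal.tendsto_ofReal (h1 k)
      have h3 : (fun n => ENNReal.ofReal (I k (u n) ω)) = fun n => ∫⁻ x, F k x ∂M (u n) ω :=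
        funext fun n => ENNReal.ofReal_toReal (hIfin k _ ω (h2 n))
      rwa [h3] at this
    have hmass : ∀ᶠ n in atTop, M (u n) ω univ ≤ ((c k₁ ω).toNNReal + 1 : ℝ≥0) := by
      have h := ht k₁
      simp only [hk₁, BoundedContinuousFunction.coe_one, Pi.one_apply, ENNReal.coe_one,
        lintegral_one] at h
      refine (h.eventually_lt_const ?_).mono fun n hn => hn.le
      rw [ENNReal.ofReal, ENNReal.coe_lt_coe]
      exact lt_add_one _
    obtain ⟨μ, -, hμ⟩ := exists_finiteMeasure_lintegral_eq_of_tendsto hcl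
      (M := fun n => M (u n) ω) hmass
      (fun n => measure_mono_null (compl_subset_compl.2 subset_closure) (hMD (u n) ω))
    refine ⟨μ, ?_, fun k => hμ _ _ (ht k)⟩
    refine le_antisymm ?_ zero_le
    rw [← h3]
    refine le_iInf fun j => ?_
    have hFk := (hF₂ j).choose_spec
    rw [← hμ _ _ (ht _), hFk, ← lintegral_indicator_one hDo.measurableSet.compl]
    refine lintegral_mono fun x => ?_
    by_cases hx : x ∈ Dᶜ
    · rw [indicator_of_mem hx]
      simp only [f₂]
      rw [thickenedIndicator_one _ _ hx]; simp
    · rw [indicator_of_notMem hx]; simp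
  let Mlim : Ω → Measure E := fun ω => if h : ∃ μ : Measure E, μ Dᶜ = 0 ∧
      ∀ k, ∫⁻ x, F k x ∂μ = ENNReal.ofReal (c k ω) then h.choose else 0
  have hMlim : ∀ ω, Mlim ω Dᶜ = 0 := by
    intro ω
    by_cases h : ∃ μ : Measure E, μ Dᶜ = 0 ∧ ∀ k, ∫⁻ x, F k x ∂μ = ENNReal.ofReal (c k ω)
    · simp only [Mlim, dif_pos h]; exact h.choose_spec.1
    · simp only [Mlim, dif_neg h]; simp
  have hMlim' : ∀ᵐ ω ∂P, ∀ k, ∫⁻ x, F k x ∂(Mlim ω) = ENNReal.ofReal (c k ω) := by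
    filter_upwards [hgood] with ω h
    simp only [Mlim, dif_pos h]; exact h.choose_spec.2
  refine ⟨Mlim, fun ω => ?_, fun ε hε => ?_⟩
  · rw [Measure.restrict_eq_self_of_ae_mem]
    exact hMlim ω
  · obtain ⟨δ, hδ0, hδ⟩ := exists_between hε
    have hδtop : δ ≠ ⊤ := hδ.ne_top
    have hδr : 0 < δ.toReal := ENNReal.toReal_pos hδ0.ne' hδtop
    obtain ⟨n, hn⟩ := exists_nat_one_div_lt (show 0 < δ.toReal / 3 by positivity)
    have hn' : ENNReal.ofReal (3 * (1 / ((n : ℝ) + 1))) ≤ δ := by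
      rw [ENNReal.ofReal_le_iff_le_toReal hδtop]; linarith
    obtain ⟨m, hm⟩ : ∃ m : ℕ, D ⊆ ⋃ i ∈ Finset.range m, Metric.ball (e i) (1 / ((n : ℝ) + 1)) := by
      have hcov : closure D ⊆ ⋃ i, Metric.ball (e i) (1 / ((n : ℝ) + 1)) := by
        intro x _
        obtain ⟨i, hi⟩ := he.exists_dist_lt x (hr n)
        exact mem_iUnion.2 ⟨i, hi⟩
      obtain ⟨t, ht⟩ := hcl.elim_finite_subcover _ (fun i => Metric.isOpen_ball) hcov
      refine ⟨t.sup id + 1, fun x hx => ?_⟩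
      obtain ⟨i, hi, hxi⟩ := mem_iUnion₂.1 (ht (subset_closure hx))
      exact mem_iUnion₂.2 ⟨i, Finset.mem_range.2 (Nat.lt_succ_of_le (Finset.le_sup (f := id) hi)),
        hxi⟩
    let κ : Finset ℕ → ℕ := fun S => (hF₁ (n, S)).choose
    have hκ : ∀ S, F (κ S) = f₁ (n, S) := fun S => (hF₁ (n, S)).choose_spec
    have hbound : ∀ a ∈ s, P {ω | ε ≤ levyProkhorovEDist (M a ω) (Mlim ω)}
        ≤ ∑ S ∈ (Finset.range m).powerset, eLpNorm (I (κ S) a - c (κ S)) 1 P / δ := by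
      intro a ha
      have hsub : ∀ᵐ ω ∂P, ε ≤ levyProkhorovEDist (M a ω) (Mlim ω) →
          ω ∈ ⋃ S ∈ (Finset.range m).powerset, {ω | δ ≤ ‖I (κ S) a ω - c (κ S) ω‖ₑ} := by
        filter_upwards [hMlim', hfin a ha] with ω h1 h2 h3
        by_contra hcon
        simp only [mem_iUnion, Set.mem_ofPred_eq, not_exists, not_le] at hcon
        refine absurd (h3.trans ?_) (not_le.2 hδ)
        refine levyProkhorovEDist_le_of_lintegral_thickenedIndicator (hMD a ω) (hMlim ω) (hr n)
          hm hn' fun S hS => ?_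
        have hS' := hκ S
        have hb := le_add_of_enorm_toReal_sub_le (hIfin (κ S) a ω h2) (hcon S hS).le
        rw [← h1 (κ S), hS'] at hb
        exact hb
      calc P {ω | ε ≤ levyProkhorovEDist (M a ω) (Mlim ω)}
          ≤ P (⋃ S ∈ (Finset.range m).powerset, {ω | δ ≤ ‖I (κ S) a ω - c (κ S) ω‖ₑ}) :=
            measure_mono_ae hsub
        _ ≤ ∑ S ∈ (Finset.range m).powerset, P {ω | δ ≤ ‖I (κ S) a ω - c (κ S) ω‖ₑ} :=
            measure_biUnion_finset_le _ _
        _ ≤ _ := by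
            refine Finset.sum_le_sum fun S _ => ?_
            rw [eLpNorm_one_eq_lintegral_enorm]
            refine meas_ge_le_lintegral_div ?_ hδ0.ne' hδtop
            exact ((hmeas a ha (F _)).ennreal_toReal.sub (hcm _).aemeasurable).enorm
    have hz : Tendsto (fun a => ∑ S ∈ (Finset.range m).powerset,
        eLpNorm (I (κ S) a - c (κ S)) 1 P / δ) l (nhds 0) := by
      rw [← Finset.sum_const_zero (s := (Finset.range m).powerset)]
      refine tendsto_finsetSum _ fun S _ => ?_
      have := ENNReal.Tendsto.div_const (hlim (κ S)) (b := δ) (Or.inr hδ0.ne')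
      rwa [ENNReal.zero_div] at this
    refine tendsto_of_tendsto_of_tendsto_of_le_of_le' tendsto_const_nhds hz
      (Eventually.of_forall fun _ => zero_le) ?_
    filter_upwards [hs] with a ha using hbound a ha

end

/-- The average of `v ↦ exp (-t v)` over the unit interval. -/
noncomputable def expAvg (t : ℝ) : ℝ := ∫ v in (0 : ℝ)..1, Real.exp (-(t * v))

/-- The regularized logarithm `(1 - r ^ a) / a`, which tends to `-log r` as `a ↓ 0`. -/
noncomputable def regLog (a r : ℝ) : ℝ := (1 - r ^ a) / a

lemma intervalIntegrable_exp_neg_mul (t : ℝ) :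
    IntervalIntegrable (fun v => Real.exp (-(t * v))) volume 0 1 :=
  Continuous.intervalIntegrable (by fun_prop) _ _

lemma expAvg_eq {t : ℝ} (ht : t ≠ 0) : expAvg t = (1 - Real.exp (-t)) / t := by
  unfold expAvg
  have h : ∀ v ∈ uIcc (0 : ℝ) 1, HasDerivAt (fun v => Real.exp (-(t * v)) * (-(1 / t)))
      (Real.exp (-(t * v))) v := by
    intro v _
    have h1 : HasDerivAt (fun v : ℝ => -(t * v)) (-(t * 1)) v :=
      ((hasDerivAt_id' v).const_mul t).fun_neg
    refine (h1.exp.mul_const (-(1 / t))).congr_deriv ?_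
    field_simp
  rw [intervalIntegral.integral_eq_sub_of_hasDerivAt h (intervalIntegrable_exp_neg_mul t)]
  simp only [mul_one, mul_zero, neg_zero, Real.exp_zero]
  field_simp
  ring

lemma expAvg_antitone : Antitone expAvg := by
  intro s t hst
  refine intervalIntegral.integral_mono_on zero_le_one (intervalIntegrable_exp_neg_mul t)
    (intervalIntegrable_exp_neg_mul s) fun v hv => ?_
  rw [Real.exp_le_exp]
  nlinarith [hv.1]

lemma expAvg_zero : expAvg 0 = 1 := by simp [expAvg]

lemma expAvg_le_one {t : ℝ} (ht : 0 ≤ t) : expAvg t ≤ 1 := expAvg_zero ▸ expAvg_antitone ht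

lemma expAvg_nonneg (t : ℝ) : 0 ≤ expAvg t :=
  intervalIntegral.integral_nonneg zero_le_one fun _ _ => (Real.exp_pos _).le

lemma continuous_expAvg : Continuous expAvg := by
  unfold expAvg
  exact intervalIntegral.continuous_parametric_intervalIntegral_of_continuous' (by fun_prop) 0 1

lemma regLog_eq {a r : ℝ} (ha : 0 < a) (hr : 0 < r) :
    regLog a r = -Real.log r * expAvg (a * -Real.log r) := by
  rcases eq_or_ne (Real.log r) 0 with h | h
  · rw [h]
    have : r = 1 := by
      rw [Real.log_eq_zero] at h
      rcases h with h | h | h <;> linarith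
    simp [regLog, this]
  · rw [expAvg_eq (by simp [h, ha.ne']), regLog, Real.rpow_def_of_pos hr]
    have e : -(a * -Real.log r) = Real.log r * a := by ring
    rw [e]
    field_simp

lemma expAvg_two_mul_sub_le {A μ : ℝ} (hA0 : 0 ≤ A) (hA1 : A ≤ 1) (hμ1 : μ ≤ 1) :
    expAvg (2 * A) - 2 * μ * expAvg (A + 1) ≤ 1 - 2 * μ * expAvg 1 := by
  have hi := intervalIntegrable_exp_neg_mul
  have h : ∀ A, expAvg (2 * A) - 2 * μ * expAvg (A + 1)
      = ∫ v in (0 : ℝ)..1, (Real.exp (-(2 * A * v)) - 2 * μ * Real.exp (-((A + 1) * v))) := by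
    intro A
    unfold expAvg
    rw [intervalIntegral.integral_sub (hi _) ((hi _).const_mul _),
      intervalIntegral.integral_const_mul]
  have h0 := h 0
  rw [mul_zero, expAvg_zero, zero_add] at h0
  rw [h A, h0]
  refine intervalIntegral.integral_mono_on zero_le_one ((hi _).sub ((hi _).const_mul _)) ?_ ?_
  · exact Continuous.intervalIntegrable (by fun_prop) _ _
  · intro v hv
    have e1 : Real.exp (-(2 * A * v)) = Real.exp (-(A * v)) ^ 2 := by
      rw [← Real.exp_nat_mul]; congr 1; push_cast; ring
    have e2 : Real.exp (-((A + 1) * v)) = Real.exp (-(A * v)) * Real.exp (-v) := by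
      rw [← Real.exp_add]; congr 1; ring
    rw [e1, e2]
    simp only [zero_mul, neg_zero, Real.exp_zero, one_mul]
    set p := Real.exp (-(A * v))
    set q := Real.exp (-v)
    have hp1 : p ≤ 1 := Real.exp_le_one_iff.2 (by nlinarith [hv.1])
    have hqp : q ≤ p := Real.exp_le_exp.2 (by nlinarith [hv.1])
    have hq0 : 0 < q := Real.exp_pos _
    have hq1 : q ≤ 1 := hqp.trans hp1
    have hμq : μ * q ≤ q := by nlinarith
    nlinarith [mul_nonneg (sub_nonneg.2 hp1) (show 0 ≤ 1 + p - 2 * (μ * q) by nlinarith)]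

lemma regLog_le_neg_log {a r : ℝ} (ha : 0 < a) (hr : 0 < r) : regLog a r ≤ -Real.log r := by
  rw [regLog, div_le_iff₀ ha, Real.rpow_def_of_pos hr]
  have := Real.add_one_le_exp (Real.log r * a)
  linarith

lemma regLog_nonneg {a r : ℝ} (ha : 0 < a) (hr0 : 0 ≤ r) (hr : r ≤ 1) : 0 ≤ regLog a r :=
  div_nonneg (sub_nonneg.2 (Real.rpow_le_one hr0 hr ha.le)) ha.le

lemma regLog_zero {a : ℝ} (ha : 0 < a) : regLog a 0 = 1 / a := by
  rw [regLog, Real.zero_rpow ha.ne', sub_zero]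

lemma neg_le_regLog {a r : ℝ} (ha : 0 < a) (ha1 : a ≤ 1) (hr : 1 ≤ r) : -r ≤ regLog a r := by
  rw [regLog, le_div_iff₀ ha]
  have h := rpow_one_add_le_one_add_mul_self (s := r - 1) (by linarith) ha.le ha1
  rw [add_sub_cancel] at h
  nlinarith

lemma regLog_le_max {a r : ℝ} (ha : 0 < a) (hr : 0 < r) :
    regLog a r ≤ max 0 (-Real.log r) := (regLog_le_neg_log ha hr).trans (le_max_right _ _)

lemma abs_regLog_le {a r R : ℝ} (ha : 0 < a) (ha1 : a ≤ 1) (hr : 0 < r) (hrR : r ≤ R) :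
    |regLog a r| ≤ max 0 (-Real.log r) + R := by
  rw [abs_le]
  constructor
  · rcases le_total 1 r with h | h
    · have := neg_le_regLog ha ha1 h
      have := le_max_left 0 (-Real.log r)
      linarith
    · have := regLog_nonneg ha hr.le h
      have := le_max_left 0 (-Real.log r)
      linarith
  · have := regLog_le_max ha hr
    linarith

lemma tendsto_regLog {r : ℝ} (hr : 0 < r) :
    Tendsto (fun a => regLog a r) (nhdsWithin 0 (Ioi 0)) (nhds (-Real.log r)) := by
  have h : Tendsto (fun a => -Real.log r * expAvg (a * -Real.log r)) (nhdsWithin 0 (Ioi 0))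
      (nhds (-Real.log r * expAvg (0 * -Real.log r))) :=
    (((continuous_expAvg.comp (by fun_prop : Continuous fun a : ℝ => a * -Real.log r)).const_mul
      _).tendsto 0).mono_left nhdsWithin_le_nhds
  rw [zero_mul, expAvg_zero, mul_one] at h
  refine h.congr' ?_
  filter_upwards [self_mem_nhdsWithin] with a ha
  exact (regLog_eq ha hr).symm

/-- The exponent governing the truncated second moment at scale `exp (-s)`. -/
noncomputable def truncExponent (μ : ℝ) : ℝ :=
  1 + μ ^ 2 * (2 - Real.exp (-2)) / 2 - 2 * μ * expAvg 1

lemma exp_neg_one_bounds :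
    0.3678794 < Real.exp (-1) ∧ Real.exp (-1) < 0.3678795 := by
  have h1 := Real.exp_one_gt_d9
  have h2 := Real.exp_one_lt_d9
  rw [Real.exp_neg]
  constructor
  · rw [lt_inv_comm₀ (by norm_num) (Real.exp_pos _)]
    refine h2.trans (by norm_num)
  · rw [inv_lt_comm₀ (Real.exp_pos _) (by norm_num)]
    refine lt_trans (by norm_num) h1

lemma truncExponent_bounds : 0.57 < truncExponent 0.678 ∧ truncExponent 0.678 < 0.571423 := by
  obtain ⟨h1, h2⟩ := exp_neg_one_bounds
  have e : Real.exp (-2) = Real.exp (-1) ^ 2 := by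
    rw [← Real.exp_nat_mul]; norm_num
  rw [truncExponent, expAvg_eq one_ne_zero, e]
  constructor
  · nlinarith
  · nlinarith

lemma expAvg_two_lt : expAvg 2 < 0.44 := by
  obtain ⟨h1, h2⟩ := exp_neg_one_bounds
  have e : Real.exp (-2) = Real.exp (-1) ^ 2 := by
    rw [← Real.exp_nat_mul]; norm_num
  rw [expAvg_eq two_ne_zero, e]
  nlinarith

/-- A linear space of random variables, all of which are centered Gaussian. -/
def IsCenteredGaussianSpace {Ω : Type*} [MeasurableSpace Ω] (P : Measure Ω)
    (S : Submodule ℝ (Ω → ℝ)) : Prop :=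
  ∀ ξ ∈ S, Measurable ξ ∧ ∃ v : NNReal, P.map ξ = gaussianReal 0 v

namespace IsCenteredGaussianSpace

variable {Ω : Type*} [MeasurableSpace Ω] {P : Measure Ω} {S : Submodule ℝ (Ω → ℝ)}

lemma memLp_two (hS : IsCenteredGaussianSpace P S) {ξ : Ω → ℝ} (hξ : ξ ∈ S) : MemLp ξ 2 P := by
  obtain ⟨hm, v, hv⟩ := hS ξ hξ
  have h := memLp_id_gaussianReal' (μ := 0) (v := v) 2 (by simp)
  rw [← hv, memLp_map_measure_iff (by fun_prop) hm.aemeasurable] at h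
  exact h

lemma map_eq (hS : IsCenteredGaussianSpace P S) {ξ : Ω → ℝ} (hξ : ξ ∈ S) :
    P.map ξ = gaussianReal 0 (∫ ω, ξ ω * ξ ω ∂P).toNNReal := by
  obtain ⟨hm, v, hv⟩ := hS ξ hξ
  have h1 : Var[id; P.map ξ] = v := by rw [hv, variance_id_gaussianReal]
  have h2 : ∫ x, x ∂(P.map ξ) = 0 := by rw [hv]; simp
  rw [variance_eq_integral (by fun_prop)] at h1
  simp only [id, h2, sub_zero] at h1
  rw [integral_map hm.aemeasurable (by fun_prop)] at h1
  have : ∫ ω, ξ ω * ξ ω ∂P = v := by rw [← h1]; simp [pow_two]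
  rw [this, hv]; simp

lemma lintegral_exp (hS : IsCenteredGaussianSpace P S) {ξ : Ω → ℝ} (hξ : ξ ∈ S) :
    ∫⁻ ω, ENNReal.ofReal (Real.exp (ξ ω)) ∂P
      = ENNReal.ofReal (Real.exp ((∫ ω, ξ ω * ξ ω ∂P) / 2)) := by
  have hm := (hS ξ hξ).1
  have h0 : 0 ≤ ∫ ω, ξ ω * ξ ω ∂P := integral_nonneg fun ω => mul_self_nonneg _
  have hi : Integrable (fun ω => Real.exp (ξ ω)) P := by
    have h := integrable_exp_mul_gaussianReal (μ := 0) (v := (∫ ω, ξ ω * ξ ω ∂P).toNNReal) 1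
    rw [← hS.map_eq hξ, integrable_map_measure (by fun_prop) hm.aemeasurable] at h
    simpa [Function.comp_def] using h
  rw [← ofReal_integral_eq_lintegral_ofReal hi (ae_of_all _ fun ω => (Real.exp_pos _).le)]
  have := mgf_gaussianReal (hS.map_eq hξ) 1
  simp only [mgf, one_mul] at this
  rw [this]
  simp [h0]

lemma integrable_mul (hS : IsCenteredGaussianSpace P S) {ξ η : Ω → ℝ} (hξ : ξ ∈ S) (hη : η ∈ S) :
    Integrable (fun ω => ξ ω * η ω) P :=
  (hS.memLp_two hξ).integrable_mul (hS.memLp_two hη)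

lemma integral_add_smul_sq (hS : IsCenteredGaussianSpace P S) {ξ η : Ω → ℝ} (hξ : ξ ∈ S)
    (hη : η ∈ S) (a b : ℝ) :
    ∫ ω, (a * ξ ω + b * η ω) * (a * ξ ω + b * η ω) ∂P
      = a ^ 2 * ∫ ω, ξ ω * ξ ω ∂P + 2 * a * b * ∫ ω, ξ ω * η ω ∂P
        + b ^ 2 * ∫ ω, η ω * η ω ∂P := by
  have e : ∀ ω, (a * ξ ω + b * η ω) * (a * ξ ω + b * η ω)
      = a ^ 2 * (ξ ω * ξ ω) + 2 * a * b * (ξ ω * η ω) + b ^ 2 * (η ω * η ω) := fun ω => by ring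
  simp_rw [e]
  rw [integral_add, integral_add, integral_const_mul, integral_const_mul, integral_const_mul]
  · exact (hS.integrable_mul hξ hξ).const_mul _
  · exact (hS.integrable_mul hξ hη).const_mul _
  · exact ((hS.integrable_mul hξ hξ).const_mul _).add ((hS.integrable_mul hξ hη).const_mul _)
  · exact (hS.integrable_mul hη hη).const_mul _

/-- **Cameron–Martin shift** in dimension one: tilting by `exp U` shifts `η` by its covariance
with `U`. -/
lemma map_withDensity_exp [IsProbabilityMeasure P] (hS : IsCenteredGaussianSpace P S)
    {U η : Ω → ℝ} (hU : U ∈ S) (hη : η ∈ S) :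
    (P.withDensity fun ω =>
        ENNReal.ofReal (Real.exp (U ω - (∫ ω, U ω * U ω ∂P) / 2))).map η
      = P.map fun ω => η ω + ∫ ω, U ω * η ω ∂P := by
  set c := ∫ ω, U ω * U ω ∂P with hc
  set m := ∫ ω, U ω * η ω ∂P with hm
  set Q := P.withDensity fun ω => ENNReal.ofReal (Real.exp (U ω - c / 2)) with hQ
  have hUm := (hS U hU).1
  have hηm := (hS η hη).1
  have hdens : Measurable fun ω => ENNReal.ofReal (Real.exp (U ω - c / 2)) := by fun_prop
  have key : ∀ t : ℝ, ∫⁻ ω, ENNReal.ofReal (Real.exp (t * η ω)) ∂Q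
      = ENNReal.ofReal (Real.exp (t * m + t ^ 2 * (∫ ω, η ω * η ω ∂P) / 2)) := by
    intro t
    rw [hQ, lintegral_withDensity_eq_lintegral_mul _ hdens (by fun_prop)]
    have hmem : (fun ω => 1 * U ω + t * η ω) ∈ S :=
      S.add_mem (S.smul_mem 1 hU) (S.smul_mem t hη)
    have e := hS.lintegral_exp hmem
    rw [hS.integral_add_smul_sq hU hη 1 t] at e
    have : ∀ ω, ((fun ω => ENNReal.ofReal (Real.exp (U ω - c / 2))) *
        fun ω => ENNReal.ofReal (Real.exp (t * η ω))) ω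
        = ENNReal.ofReal (Real.exp (-(c / 2)))
          * ENNReal.ofReal (Real.exp (1 * U ω + t * η ω)) := by
      intro ω
      rw [Pi.mul_apply, ← ENNReal.ofReal_mul (Real.exp_pos _).le,
        ← ENNReal.ofReal_mul (Real.exp_pos _).le, ← Real.exp_add, ← Real.exp_add]
      congr 2; ring
    simp_rw [this]
    rw [lintegral_const_mul _ (by fun_prop), e, ← ENNReal.ofReal_mul (Real.exp_pos _).le,
      ← Real.exp_add]
    congr 2
    rw [← hc, ← hm]; ring
  have hprob : IsProbabilityMeasure Q := by
    constructor
    have := key 0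
    simpa using this
  have hmgfQ : ∀ t, mgf η Q t = Real.exp (t * m + t ^ 2 * (∫ ω, η ω * η ω ∂P) / 2) := by
    intro t
    rw [mgf, integral_eq_lintegral_of_nonneg_ae (ae_of_all _ fun ω => (Real.exp_pos _).le)
      (by fun_prop), key, ENNReal.toReal_ofReal (Real.exp_pos _).le]
  have h0 : 0 ≤ ∫ ω, η ω * η ω ∂P := integral_nonneg fun ω => mul_self_nonneg _
  have hP : P.map (fun ω => η ω + m) = gaussianReal m (∫ ω, η ω * η ω ∂P).toNNReal := by
    have : (fun ω => η ω + m) = (fun x => x + m) ∘ η := rfl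
    rw [this, ← Measure.map_map (by fun_prop) hηm, hS.map_eq hη, gaussianReal_map_add_const]
    simp
  have hmgf : mgf η Q = mgf id (gaussianReal m (∫ ω, η ω * η ω ∂P).toNNReal) := by
    funext t
    rw [hmgfQ, mgf_id_gaussianReal, Real.coe_toNNReal _ h0]
    congr 1; ring
  have hset : integrableExpSet η Q = univ := by
    ext t
    simp only [integrableExpSet, Set.mem_ofPred_eq, mem_univ, iff_true]
    refine ⟨by fun_prop, ?_⟩
    rw [hasFiniteIntegral_iff_ofReal (ae_of_all _ fun ω => (Real.exp_pos _).le), key]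
    exact ENNReal.ofReal_lt_top
  rw [hP]
  have hc : complexMGF η Q = complexMGF id (gaussianReal m (∫ ω, η ω * η ω ∂P).toNNReal) := by
    funext z
    exact eqOn_complexMGF_of_mgf hmgf (by simp [hset])
  have := Measure.ext_of_complexMGF_eq (μ := Q) hηm.aemeasurable aemeasurable_id hc
  rw [this, Measure.map_id]

/-- **Cameron–Martin shift** for finitely many jointly Gaussian variables. -/
lemma lintegral_exp_mul [IsProbabilityMeasure P] (hS : IsCenteredGaussianSpace P S)
    {ι : Type*} [Fintype ι] {U : Ω → ℝ} {V : ι → Ω → ℝ} (hU : U ∈ S) (hV : ∀ i, V i ∈ S)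
    {F : (ι → ℝ) → ENNReal} (hF : Measurable F) :
    ∫⁻ ω, ENNReal.ofReal (Real.exp (U ω - (∫ ω, U ω * U ω ∂P) / 2)) * F (fun i => V i ω) ∂P
      = ∫⁻ ω, F (fun i => V i ω + ∫ ω, U ω * V i ω ∂P) ∂P := by
  classical
  set Q := P.withDensity fun ω =>
    ENNReal.ofReal (Real.exp (U ω - (∫ ω, U ω * U ω ∂P) / 2)) with hQ
  have hUm := (hS U hU).1
  have hVm : ∀ i, Measurable (V i) := fun i => (hS _ (hV i)).1
  have hVm' : Measurable fun ω i => V i ω := measurable_pi_lambda _ hVm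
  have hdens : Measurable fun ω =>
      ENNReal.ofReal (Real.exp (U ω - (∫ ω, U ω * U ω ∂P) / 2)) := by fun_prop
  have hfin : IsFiniteMeasure Q := by
    constructor
    have := congrArg (fun μ => μ univ) (hS.map_withDensity_exp hU (S.zero_mem))
    rw [← hQ] at this
    simp only [Pi.zero_apply, mul_zero, integral_zero, add_zero] at this
    rw [Measure.map_apply (by exact measurable_const) MeasurableSet.univ,
      Measure.map_apply (by exact measurable_const) MeasurableSet.univ] at this
    simp only [preimage_univ] at this
    rw [this]; simp
  have hsh : Measurable fun ω i => V i ω + ∫ ω, U ω * V i ω ∂P :=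
    measurable_pi_lambda _ fun i => (hVm i).add_const _
  have hmap : Q.map (fun ω i => V i ω) = P.map (fun ω i => V i ω + ∫ ω, U ω * V i ω ∂P) := by
    have : IsFiniteMeasure (Q.map fun ω i => V i ω) := Measure.isFiniteMeasure_map _ _
    have : IsFiniteMeasure (P.map fun ω i => V i ω + ∫ ω, U ω * V i ω ∂P) :=
      Measure.isFiniteMeasure_map _ _
    refine Measure.ext_of_charFunDual ?_
    funext L
    rw [charFunDual_eq_charFun_map_one, charFunDual_eq_charFun_map_one,
      Measure.map_map (by fun_prop) hVm', Measure.map_map (by fun_prop) hsh]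
    have hL : ∀ v : ι → ℝ, L v = ∑ i, L (Pi.single i 1) * v i := by
      intro v
      conv_lhs => rw [pi_eq_sum_univ' v]
      rw [map_sum]
      refine Finset.sum_congr rfl fun i _ => ?_
      rw [map_smul, smul_eq_mul, mul_comm]
    have hmem : (fun ω => L (fun i => V i ω)) ∈ S := by
      have : (fun ω => L (fun i => V i ω)) = ∑ i, L (Pi.single i 1) • V i := by
        funext ω
        rw [Finset.sum_apply]
        exact hL _
      rw [this]
      exact S.sum_mem fun i _ => S.smul_mem _ (hV i)
    have hint : ∫ ω, U ω * L (fun i => V i ω) ∂P = L fun i => ∫ ω, U ω * V i ω ∂P := by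
      have hL' : ∀ ω, U ω * L (fun i => V i ω) = ∑ i, U ω * (L (Pi.single i 1) * V i ω) :=
        fun ω => by rw [hL, Finset.mul_sum]
      rw [hL, integral_congr_ae (ae_of_all _ hL'), integral_finsetSum]
      · refine Finset.sum_congr rfl fun i _ => ?_
        rw [← integral_const_mul]
        congr 1; funext ω; ring
      · intro i _
        have := (hS.integrable_mul hU (hV i)).const_mul (L (Pi.single i 1))
        refine this.congr (ae_of_all _ fun ω => ?_)
        simp only; ring
    have h1 := hS.map_withDensity_exp hU hmem
    rw [hint, ← hQ] at h1
    have e1 : (L ∘ fun ω i => V i ω) = fun ω => L fun i => V i ω := rfl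
    have e2 : (L ∘ fun ω i => V i ω + ∫ ω, U ω * V i ω ∂P)
        = fun ω => L (fun i => V i ω) + L fun i => ∫ ω, U ω * V i ω ∂P := by
      funext ω
      rw [← map_add]; rfl
    rw [e1, e2, h1]
  have a := lintegral_map (μ := Q) hF hVm'
  rw [hmap, lintegral_map hF hsh] at a
  have b := lintegral_withDensity_eq_lintegral_mul P hdens (hF.comp hVm')
  exact b.symm.trans a.symm

end IsCenteredGaussianSpace

/-- A Lipschitz cutoff, equal to `1` on `(-∞, 0]` and to `0` on `[1, ∞)`. -/
noncomputable def softCut (z : ℝ) : ℝ := max 0 (min 1 (1 - z))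

lemma softCut_nonneg (z : ℝ) : 0 ≤ softCut z := le_max_left _ _

lemma softCut_le_one (z : ℝ) : softCut z ≤ 1 := max_le zero_le_one (min_le_left _ _)

lemma continuous_softCut : Continuous softCut := by unfold softCut; fun_prop

@[fun_prop]
lemma measurable_softCut : Measurable softCut := continuous_softCut.measurable

lemma softCut_le_exp {a : ℝ} (ha : 0 ≤ a) (z : ℝ) : softCut z ≤ Real.exp (a * (1 - z)) := by
  rcases le_total z 1 with h | h
  · exact (softCut_le_one z).trans (Real.one_le_exp (mul_nonneg ha (by linarith)))
  · refine (max_le le_rfl ?_).trans (Real.exp_pos _).le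
    exact (min_le_right _ _).trans (by linarith)

lemma one_sub_softCut_le_exp {a : ℝ} (ha : 0 ≤ a) (z : ℝ) :
    1 - softCut z ≤ Real.exp (a * z) := by
  rcases le_total z 0 with h | h
  · have : 1 ≤ softCut z := le_max_of_le_right (le_min le_rfl (by linarith))
    linarith [Real.exp_pos (a * z)]
  · have := Real.one_le_exp (mul_nonneg ha h)
    linarith [softCut_nonneg z]

lemma abs_softCut_sub_le (z w : ℝ) : |softCut z - softCut w| ≤ |z - w| := by
  unfold softCut
  calc _ ≤ |min 1 (1 - z) - min 1 (1 - w)| := by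
        rw [max_comm 0, max_comm 0]; exact abs_max_sub_max_le_abs _ _ _
    _ ≤ |(1 - z) - (1 - w)| := by
        refine (abs_min_sub_min_le_max _ _ _ _).trans ?_
        simp
    _ = |z - w| := by rw [abs_sub_comm]; congr 1; ring

lemma prod_softCut_nonneg (A : Finset ℕ) (z : ℕ → ℝ) : 0 ≤ ∏ k ∈ A, softCut (z k) :=
  Finset.prod_nonneg fun _ _ => softCut_nonneg _

lemma prod_softCut_le_one (A : Finset ℕ) (z : ℕ → ℝ) : ∏ k ∈ A, softCut (z k) ≤ 1 :=
  Finset.prod_le_one (fun _ _ => softCut_nonneg _) fun _ _ => softCut_le_one _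

lemma prod_softCut_le (A : Finset ℕ) (z : ℕ → ℝ) {k : ℕ} (hk : k ∈ A) :
    ∏ k ∈ A, softCut (z k) ≤ softCut (z k) := by
  rw [← Finset.mul_prod_erase A _ hk]
  exact mul_le_of_le_one_right (softCut_nonneg _) (prod_softCut_le_one _ _)

lemma abs_prod_sub_prod_le {ι : Type*} (A : Finset ι) {a b : ι → ℝ} (ha0 : ∀ k, 0 ≤ a k)
    (ha1 : ∀ k, a k ≤ 1) (hb0 : ∀ k, 0 ≤ b k) (hb1 : ∀ k, b k ≤ 1) :
    |∏ k ∈ A, a k - ∏ k ∈ A, b k| ≤ ∑ k ∈ A, |a k - b k| := by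
  classical
  induction A using Finset.induction_on with
  | empty => simp
  | insert i A hi ih =>
    rw [Finset.prod_insert hi, Finset.prod_insert hi, Finset.sum_insert hi]
    have e : a i * ∏ k ∈ A, a k - b i * ∏ k ∈ A, b k
        = (a i - b i) * ∏ k ∈ A, a k + b i * (∏ k ∈ A, a k - ∏ k ∈ A, b k) := by ring
    rw [e]
    refine (abs_add_le _ _).trans (add_le_add ?_ ?_)
    · rw [abs_mul, abs_of_nonneg (Finset.prod_nonneg fun k _ => ha0 k)]
      exact mul_le_of_le_one_right (abs_nonneg _)
        (Finset.prod_le_one (fun k _ => ha0 k) fun k _ => ha1 k)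
    · rw [abs_mul, abs_of_nonneg (hb0 i)]
      exact (mul_le_of_le_one_left (abs_nonneg _) (hb1 i)).trans ih

lemma one_sub_prod_softCut_le (A : Finset ℕ) (z : ℕ → ℝ) :
    1 - ∏ k ∈ A, softCut (z k) ≤ ∑ k ∈ A, (1 - softCut (z k)) := by
  have h := abs_prod_sub_prod_le A (a := fun _ => 1) (b := fun k => softCut (z k))
    (fun _ => zero_le_one) (fun _ => le_rfl) (fun _ => softCut_nonneg _)
    fun _ => softCut_le_one _
  rw [Finset.prod_const_one] at h
  refine (le_abs_self _).trans (h.trans (Finset.sum_le_sum fun k _ => ?_))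
  rw [abs_of_nonneg (sub_nonneg.2 (softCut_le_one _))]

/-- The expected product of cutoffs of two sequences of shifted random variables. -/
noncomputable def cutExp {Ω : Type*} [MeasurableSpace Ω] (P : Measure Ω) (A : Finset ℕ)
    (Z Z' : ℕ → Ω → ℝ) (s s' : ℕ → ℝ) : ℝ :=
  ∫ ω, (∏ k ∈ A, softCut (Z k ω + s k)) * ∏ k ∈ A, softCut (Z' k ω + s' k) ∂P

section cutExp

variable {Ω : Type*} [MeasurableSpace Ω] {P : Measure Ω} {A : Finset ℕ} {Z Z' : ℕ → Ω → ℝ}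

lemma cutExp_comm (s s' : ℕ → ℝ) : cutExp P A Z Z' s s' = cutExp P A Z' Z s' s := by
  simp only [cutExp, mul_comm]

lemma cutExp_nonneg (s s' : ℕ → ℝ) : 0 ≤ cutExp P A Z Z' s s' :=
  integral_nonneg fun _ => mul_nonneg (prod_softCut_nonneg _ _) (prod_softCut_nonneg _ _)

lemma measurable_prod_softCut (hZ : ∀ k, Measurable (Z k)) (s : ℕ → ℝ) :
    Measurable fun ω => ∏ k ∈ A, softCut (Z k ω + s k) :=
  Finset.measurable_prod _ fun k _ => measurable_softCut.comp ((hZ k).add_const _)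

lemma integrable_cutExp [IsFiniteMeasure P] (hZ : ∀ k, Measurable (Z k))
    (hZ' : ∀ k, Measurable (Z' k)) (s s' : ℕ → ℝ) :
    Integrable (fun ω => (∏ k ∈ A, softCut (Z k ω + s k)) * ∏ k ∈ A, softCut (Z' k ω + s' k))
      P := by
  refine Integrable.of_bound
    ((measurable_prod_softCut hZ s).mul (measurable_prod_softCut hZ' s')).aestronglyMeasurable 1
    (ae_of_all _ fun ω => ?_)
  rw [Real.norm_of_nonneg (mul_nonneg (prod_softCut_nonneg _ _) (prod_softCut_nonneg _ _))]
  exact mul_le_one₀ (prod_softCut_le_one _ _) (prod_softCut_nonneg _ _) (prod_softCut_le_one _ _)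

lemma cutExp_le_one [IsProbabilityMeasure P] (hZ : ∀ k, Measurable (Z k))
    (hZ' : ∀ k, Measurable (Z' k)) (s s' : ℕ → ℝ) : cutExp P A Z Z' s s' ≤ 1 := by
  have h := integral_mono (integrable_cutExp (P := P) (A := A) hZ hZ' s s') (integrable_const 1)
    fun ω => mul_le_one₀ (prod_softCut_le_one A fun k => Z k ω + s k) (prod_softCut_nonneg _ _)
      (prod_softCut_le_one A fun k => Z' k ω + s' k)
  simpa [cutExp] using h

end cutExp

namespace IsCenteredGaussianSpace

variable {Ω : Type*} [MeasurableSpace Ω] {P : Measure Ω} {S : Submodule ℝ (Ω → ℝ)}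

lemma integrable_exp (hS : IsCenteredGaussianSpace P S) {ξ : Ω → ℝ} (hξ : ξ ∈ S) :
    Integrable (fun ω => Real.exp (ξ ω)) P := by
  refine ⟨((hS ξ hξ).1.exp).aestronglyMeasurable, ?_⟩
  rw [hasFiniteIntegral_iff_ofReal (ae_of_all _ fun ω => (Real.exp_pos _).le), hS.lintegral_exp hξ]
  exact ENNReal.ofReal_lt_top

lemma integral_exp (hS : IsCenteredGaussianSpace P S) {ξ : Ω → ℝ} (hξ : ξ ∈ S) :
    ∫ ω, Real.exp (ξ ω) ∂P = Real.exp ((∫ ω, ξ ω * ξ ω ∂P) / 2) := by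
  rw [integral_eq_lintegral_of_nonneg_ae (ae_of_all _ fun ω => (Real.exp_pos _).le)
    ((hS ξ hξ).1.exp).aestronglyMeasurable, hS.lintegral_exp hξ,
    ENNReal.toReal_ofReal (Real.exp_pos _).le]

lemma integral_exp_mul_add (hS : IsCenteredGaussianSpace P S) {ξ : Ω → ℝ} (hξ : ξ ∈ S) (a b : ℝ) :
    ∫ ω, Real.exp (a * ξ ω + b) ∂P = Real.exp (a ^ 2 * (∫ ω, ξ ω * ξ ω ∂P) / 2 + b) := by
  have h := hS.integral_exp (S.smul_mem a hξ)
  simp only [Pi.smul_apply, smul_eq_mul] at h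
  have e : ∀ ω, a * ξ ω * (a * ξ ω) = a ^ 2 * (ξ ω * ξ ω) := fun ω => by ring
  simp_rw [e] at h
  rw [integral_const_mul] at h
  simp_rw [Real.exp_add]
  rw [integral_mul_const, h]

lemma integrable_exp_mul_add (hS : IsCenteredGaussianSpace P S) {ξ : Ω → ℝ} (hξ : ξ ∈ S)
    (a b : ℝ) : Integrable (fun ω => Real.exp (a * ξ ω + b)) P := by
  simp_rw [Real.exp_add]
  exact (hS.integrable_exp (S.smul_mem a hξ)).mul_const _

/-- Chernoff bound for the expected product of cutoffs. -/
lemma cutExp_le [IsProbabilityMeasure P] (hS : IsCenteredGaussianSpace P S) {A : Finset ℕ}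
    {Z Z' : ℕ → Ω → ℝ} (hZ : ∀ k, Z k ∈ S) (hZ' : ∀ k, Z' k ∈ S) (s s' : ℕ → ℝ) {k : ℕ}
    (hk : k ∈ A) {a : ℝ} (ha : 0 ≤ a) :
    cutExp P A Z Z' s s' ≤ Real.exp (2 * a - a * (s k + s' k) + a ^ 2 / 2 *
      ((∫ ω, Z k ω * Z k ω ∂P) + 2 * (∫ ω, Z k ω * Z' k ω ∂P) + ∫ ω, Z' k ω * Z' k ω ∂P)) := by
  have hm : ∀ k, Measurable (Z k) := fun k => (hS _ (hZ k)).1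
  have hm' : ∀ k, Measurable (Z' k) := fun k => (hS _ (hZ' k)).1
  have hmem : (fun ω => 1 * Z k ω + 1 * Z' k ω) ∈ S :=
    S.add_mem (S.smul_mem 1 (hZ k)) (S.smul_mem 1 (hZ' k))
  have h1 := integral_mono (integrable_cutExp (P := P) (A := A) hm hm' s s')
    (hS.integrable_exp_mul_add hmem (-a) (2 * a - a * (s k + s' k))) (fun ω => by
      calc _ ≤ softCut (Z k ω + s k) * softCut (Z' k ω + s' k) :=
            mul_le_mul (prod_softCut_le A (fun k => Z k ω + s k) hk)
              (prod_softCut_le A (fun k => Z' k ω + s' k) hk) (prod_softCut_nonneg _ _)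
              (softCut_nonneg _)
        _ ≤ Real.exp (a * (1 - (Z k ω + s k))) * Real.exp (a * (1 - (Z' k ω + s' k))) :=
            mul_le_mul (softCut_le_exp ha _) (softCut_le_exp ha _) (softCut_nonneg _)
              (Real.exp_pos _).le
        _ = _ := by rw [← Real.exp_add]; congr 1; ring)
  refine h1.trans (le_of_eq ?_)
  rw [hS.integral_exp_mul_add hmem, hS.integral_add_smul_sq (hZ k) (hZ' k)]
  congr 1; ring

lemma integral_one_sub_softCut_le [IsProbabilityMeasure P] (hS : IsCenteredGaussianSpace P S)
    {ξ : Ω → ℝ} (hξ : ξ ∈ S) {θ σ v : ℝ} (hθ : 0 ≤ θ) (hv : ∫ ω, ξ ω * ξ ω ∂P ≤ v) :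
    ∫ ω, (1 - softCut (ξ ω + (σ - θ * v))) ∂P ≤ Real.exp (θ * σ - θ ^ 2 * v / 2) := by
  have hm := (hS ξ hξ).1
  have hint : Integrable (fun ω => 1 - softCut (ξ ω + (σ - θ * v))) P :=
    (integrable_const 1).sub (Integrable.of_bound
      (measurable_softCut.comp (hm.add_const _)).aestronglyMeasurable 1 (ae_of_all _ fun ω => by
      rw [Real.norm_of_nonneg (softCut_nonneg _)]; exact softCut_le_one _))
  refine (integral_mono hint (hS.integrable_exp_mul_add hξ θ (θ * (σ - θ * v))) fun ω => ?_).trans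
    ?_
  · rw [← mul_add]; exact one_sub_softCut_le_exp hθ _
  · rw [hS.integral_exp_mul_add hξ, Real.exp_le_exp]
    nlinarith [mul_le_mul_of_nonneg_left hv (sq_nonneg θ)]

/-- Stability of the expected product of cutoffs under a change of the shifts. -/
lemma abs_cutExp_sub_le [IsProbabilityMeasure P] (hS : IsCenteredGaussianSpace P S) {A : Finset ℕ}
    {Z Z' : ℕ → Ω → ℝ} (hZ : ∀ k, Z k ∈ S) (hZ' : ∀ k, Z' k ∈ S) {θ R : ℝ} (hθ : 0 ≤ θ)
    {σ τ : ℕ → ℝ} (s' : ℕ → ℝ) (hσ : ∀ k ∈ A, σ k ≤ R) (hτ : ∀ k ∈ A, τ k ≤ R)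
    (hv : ∀ k ∈ A, ∫ ω, Z k ω * Z k ω ∂P ≤ k) :
    |cutExp P A Z Z' (fun k => σ k - θ * k) s' - cutExp P A Z Z' (fun k => τ k - θ * k) s'|
      ≤ ∑ k ∈ A, min |σ k - τ k| (2 * Real.exp (θ * R) * Real.exp (-(θ ^ 2 / 2 * k))) := by
  have hm : ∀ k, Measurable (Z k) := fun k => (hS _ (hZ k)).1
  have hm' : ∀ k, Measurable (Z' k) := fun k => (hS _ (hZ' k)).1
  have hint : ∀ k t, Integrable (fun ω => softCut (Z k ω + t)) P := fun k t =>
    Integrable.of_bound (measurable_softCut.comp ((hm k).add_const _)).aestronglyMeasurable 1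
      (ae_of_all _ fun ω => by
      rw [Real.norm_of_nonneg (softCut_nonneg _)]; exact softCut_le_one _)
  have hint' : ∀ k t t', Integrable (fun ω => |softCut (Z k ω + t) - softCut (Z k ω + t')|) P :=
    fun k t t' => ((hint k t).sub (hint k t')).abs
  unfold cutExp
  rw [← integral_sub (integrable_cutExp hm hm' _ _) (integrable_cutExp hm hm' _ _)]
  calc _ ≤ ∫ ω, ∑ k ∈ A,
          |softCut (Z k ω + (σ k - θ * k)) - softCut (Z k ω + (τ k - θ * k))| ∂P := by
        refine abs_integral_le_integral_abs.trans (integral_mono ?_ ?_ fun ω => ?_)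
        · exact ((integrable_cutExp hm hm' _ _).sub (integrable_cutExp hm hm' _ _)).abs
        · exact integrable_finsetSum _ fun k _ => hint' k _ _
        · simp only
          rw [← sub_mul, abs_mul, abs_of_nonneg (prod_softCut_nonneg A fun k => Z' k ω + s' k)]
          refine (mul_le_of_le_one_right (abs_nonneg _) (prod_softCut_le_one _ _)).trans ?_
          exact abs_prod_sub_prod_le A (fun _ => softCut_nonneg _) (fun _ => softCut_le_one _)
            (fun _ => softCut_nonneg _) fun _ => softCut_le_one _
    _ = ∑ k ∈ A, ∫ ω, |softCut (Z k ω + (σ k - θ * k)) - softCut (Z k ω + (τ k - θ * k))| ∂P :=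
        integral_finsetSum _ fun k _ => hint' k _ _
    _ ≤ _ := by
        refine Finset.sum_le_sum fun k hk => le_min ?_ ?_
        · refine (integral_mono (hint' k _ _) (integrable_const |σ k - τ k|) fun ω => ?_).trans
            (by simp)
          refine (abs_softCut_sub_le _ _).trans (le_of_eq ?_)
          congr 1; ring
        · have hb : ∀ ρ : ℕ → ℝ, ρ k ≤ R → ∫ ω, (1 - softCut (Z k ω + (ρ k - θ * k))) ∂P
              ≤ Real.exp (θ * R) * Real.exp (-(θ ^ 2 / 2 * k)) := fun ρ hρ => by
            refine (hS.integral_one_sub_softCut_le (hZ k) hθ (hv k hk)).trans ?_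
            rw [← Real.exp_add, Real.exp_le_exp]
            nlinarith [mul_le_mul_of_nonneg_left hρ hθ]
          have i1 := (integrable_const (μ := P) (1 : ℝ)).sub (hint k (σ k - θ * k))
          have i2 := (integrable_const (μ := P) (1 : ℝ)).sub (hint k (τ k - θ * k))
          refine (integral_mono (hint' k _ _) (i1.add i2) fun ω => ?_).trans ?_
          · simp only [Pi.add_apply, Pi.sub_apply]
            rw [abs_le]
            constructor <;>
              linarith [softCut_le_one (Z k ω + (σ k - θ * k)),
                softCut_le_one (Z k ω + (τ k - θ * k))]
          · rw [integral_add' i1 i2]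
            have := hb σ (hσ k hk)
            have := hb τ (hτ k hk)
            simp only [Pi.sub_apply]
            linarith

/-- The tilted mass removed by the cutoffs. -/
lemma lintegral_exp_mul_one_sub_prod_le [IsProbabilityMeasure P] (hS : IsCenteredGaussianSpace P S)
    {A : Finset ℕ} {U : Ω → ℝ} {Z : ℕ → Ω → ℝ} (hU : U ∈ S) (hZ : ∀ k, Z k ∈ S) {θ : ℝ}
    (hθ : 0 ≤ θ) (hv : ∀ k ∈ A, ∫ ω, Z k ω * Z k ω ∂P ≤ k) :
    ∫⁻ ω, ENNReal.ofReal (Real.exp (U ω - (∫ ω, U ω * U ω ∂P) / 2)) *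
        ENNReal.ofReal (1 - ∏ k ∈ A, softCut (Z k ω - (∫ ω, U ω * Z k ω ∂P) - θ * k)) ∂P
      ≤ ∑ k ∈ A, ENNReal.ofReal (Real.exp (-(θ ^ 2 / 2 * k))) := by
  have hm : ∀ k, Measurable (Z k) := fun k => (hS _ (hZ k)).1
  have h := hS.lintegral_exp_mul (ι := A) (V := fun k => Z k) hU (fun k => hZ k)
    (F := fun v => ENNReal.ofReal (1 - ∏ k, softCut (v k - (∫ ω, U ω * Z k ω ∂P) - θ * (k : ℕ))))
    (by fun_prop)
  simp only [add_sub_cancel_right] at h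
  rw [lintegral_congr fun ω => by rw [← Finset.prod_coe_sort A
    fun k => softCut (Z k ω - (∫ ω, U ω * Z k ω ∂P) - θ * k)], h]
  calc _ ≤ ∫⁻ ω, ∑ k ∈ A, ENNReal.ofReal (1 - softCut (Z k ω + (0 - θ * k))) ∂P := by
        refine lintegral_mono fun ω => ?_
        rw [Finset.prod_coe_sort A fun k => softCut (Z k ω - θ * k),
          ← ENNReal.ofReal_sum_of_nonneg fun k _ => sub_nonneg.2 (softCut_le_one _)]
        refine ENNReal.ofReal_le_ofReal ?_
        refine (one_sub_prod_softCut_le A fun k => Z k ω - θ * k).trans (le_of_eq ?_)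
        refine Finset.sum_congr rfl fun k _ => ?_
        rw [zero_sub, ← sub_eq_add_neg]
    _ = ∑ k ∈ A, ∫⁻ ω, ENNReal.ofReal (1 - softCut (Z k ω + (0 - θ * k))) ∂P :=
        lintegral_finsetSum _ fun k _ => by have := hm k; fun_prop
    _ ≤ _ := by
        refine Finset.sum_le_sum fun k hk => ?_
        rw [← ofReal_integral_eq_lintegral_ofReal ?_
          (ae_of_all _ fun ω => sub_nonneg.2 (softCut_le_one _))]
        · refine ENNReal.ofReal_le_ofReal ?_
          refine (hS.integral_one_sub_softCut_le (hZ k) hθ (hv k hk)).trans (le_of_eq ?_)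
          congr 1; ring
        · exact (integrable_const 1).sub (Integrable.of_bound
            (measurable_softCut.comp ((hm k).add_const _)).aestronglyMeasurable 1
            (ae_of_all _ fun ω => by
              rw [Real.norm_of_nonneg (softCut_nonneg _)]; exact softCut_le_one _))

/-- Two-point function of truncated exponentials. -/
lemma lintegral_exp_mul_prod_mul_exp_mul_prod [IsProbabilityMeasure P]
    (hS : IsCenteredGaussianSpace P S) {A : Finset ℕ} {U U' : Ω → ℝ} {Z Z' : ℕ → Ω → ℝ}
    (hU : U ∈ S) (hU' : U' ∈ S) (hZ : ∀ k, Z k ∈ S) (hZ' : ∀ k, Z' k ∈ S) (s s' : ℕ → ℝ) :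
    ∫⁻ ω, ENNReal.ofReal (Real.exp (U ω - (∫ ω, U ω * U ω ∂P) / 2) *
          ∏ k ∈ A, softCut (Z k ω - s k)) *
        ENNReal.ofReal (Real.exp (U' ω - (∫ ω, U' ω * U' ω ∂P) / 2) *
          ∏ k ∈ A, softCut (Z' k ω - s' k)) ∂P
      = ENNReal.ofReal (Real.exp (∫ ω, U ω * U' ω ∂P) * cutExp P A Z Z'
          (fun k => (∫ ω, U ω * Z k ω ∂P) + (∫ ω, U' ω * Z k ω ∂P) - s k)
          (fun k => (∫ ω, U ω * Z' k ω ∂P) + (∫ ω, U' ω * Z' k ω ∂P) - s' k)) := by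
  have hm : ∀ k, Measurable (Z k) := fun k => (hS _ (hZ k)).1
  have hm' : ∀ k, Measurable (Z' k) := fun k => (hS _ (hZ' k)).1
  have hsum : (fun ω => U ω + U' ω) ∈ S := S.add_mem hU hU'
  have hadd : ∀ {η : Ω → ℝ}, η ∈ S → ∫ ω, (U ω + U' ω) * η ω ∂P
      = (∫ ω, U ω * η ω ∂P) + ∫ ω, U' ω * η ω ∂P := fun {η} hη => by
    simp_rw [add_mul]
    exact integral_add (hS.integrable_mul hU hη) (hS.integrable_mul hU' hη)
  have hvar : ∫ ω, (U ω + U' ω) * (U ω + U' ω) ∂P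
      = (∫ ω, U ω * U ω ∂P) + 2 * (∫ ω, U ω * U' ω ∂P) + ∫ ω, U' ω * U' ω ∂P := by
    have := hS.integral_add_smul_sq hU hU' 1 1
    simp only [one_mul, mul_one, one_pow] at this
    exact this
  have h := hS.lintegral_exp_mul (ι := A ⊕ A)
    (V := Sum.elim (fun k => Z k) (fun k => Z' k)) hsum
    (by rintro (k | k); exacts [hZ k, hZ' k])
    (F := fun v => ENNReal.ofReal ((∏ k, softCut (v (Sum.inl k) - s (k : ℕ))) *
      ∏ k, softCut (v (Sum.inr k) - s' (k : ℕ)))) (by fun_prop)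
  simp only [Sum.elim_inl, Sum.elim_inr, hadd (hZ _), hadd (hZ' _)] at h
  have e : ∀ ω, ENNReal.ofReal (Real.exp (U ω - (∫ ω, U ω * U ω ∂P) / 2) *
          ∏ k ∈ A, softCut (Z k ω - s k)) *
        ENNReal.ofReal (Real.exp (U' ω - (∫ ω, U' ω * U' ω ∂P) / 2) *
          ∏ k ∈ A, softCut (Z' k ω - s' k))
      = ENNReal.ofReal (Real.exp (∫ ω, U ω * U' ω ∂P)) *
        (ENNReal.ofReal (Real.exp (U ω + U' ω - (∫ ω, (U ω + U' ω) * (U ω + U' ω) ∂P) / 2)) *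
        ENNReal.ofReal ((∏ k : A, softCut (Z k ω - s k)) * ∏ k : A, softCut (Z' k ω - s' k))) := by
    intro ω
    rw [Finset.prod_coe_sort A fun k => softCut (Z k ω - s k),
      Finset.prod_coe_sort A fun k => softCut (Z' k ω - s' k), hvar,
      ← ENNReal.ofReal_mul (Real.exp_pos _).le, ← ENNReal.ofReal_mul (Real.exp_pos _).le,
      ← ENNReal.ofReal_mul (mul_nonneg (Real.exp_pos _).le (prod_softCut_nonneg _ _))]
    congr 1
    have : Real.exp (U ω - (∫ ω, U ω * U ω ∂P) / 2) * Real.exp (U' ω - (∫ ω, U' ω * U' ω ∂P) / 2)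
        = Real.exp (∫ ω, U ω * U' ω ∂P) * Real.exp (U ω + U' ω -
          ((∫ ω, U ω * U ω ∂P) + 2 * (∫ ω, U ω * U' ω ∂P) + ∫ ω, U' ω * U' ω ∂P) / 2) := by
      rw [← Real.exp_add, ← Real.exp_add]; congr 1; ring
    linear_combination (∏ k ∈ A, softCut (Z k ω - s k)) * (∏ k ∈ A, softCut (Z' k ω - s' k)) * this
  have hUm := (hS _ hU).1
  have hUm' := (hS _ hU').1
  rw [lintegral_congr e, lintegral_const_mul _ (by fun_prop), h,
    ENNReal.ofReal_mul (Real.exp_pos _).le]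
  congr 1
  rw [cutExp, ofReal_integral_eq_lintegral_ofReal (integrable_cutExp hm hm' _ _)
    (ae_of_all _ fun _ => mul_nonneg (prod_softCut_nonneg _ _) (prod_softCut_nonneg _ _))]
  refine lintegral_congr fun ω => ?_
  rw [Finset.prod_coe_sort A fun k => softCut (Z k ω +
      ((∫ ω, U ω * Z k ω ∂P) + ∫ ω, U' ω * Z k ω ∂P) - s k),
    Finset.prod_coe_sort A fun k => softCut (Z' k ω +
      ((∫ ω, U ω * Z' k ω ∂P) + ∫ ω, U' ω * Z' k ω ∂P) - s' k)]
  simp only [add_sub_assoc]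

end IsCenteredGaussianSpace

/-- Chernoff exponent of the truncated two-point function at logarithmic distance `s`, with the
cutoff at level `k ≈ s`. -/
lemma chernoff_exponent_le {H r γ μ θ ε B K₀ K₁ K₂ V₁ V₂ W : ℝ} {k : ℕ} (hH : 0 < H) (hr : 0 < r)
    (hs : 1 ≤ -Real.log r) (hsk : -Real.log r ≤ k) (hks : (k : ℝ) ≤ -Real.log r + 1)
    (hHs : H * -Real.log r ≤ 1) (hγ : 0 ≤ γ) (hμ0 : 0 ≤ μ) (hμ1 : μ ≤ 1) (hθ : 0 ≤ θ) (hε : 0 ≤ ε)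
    (h₀ : |K₀ - regLog (H + H) r| ≤ ε * |regLog (H + H) r| + B)
    (h₁ : |K₁ - regLog (H + 1 / k) r| ≤ ε * |regLog (H + 1 / k) r| + B)
    (h₂ : |K₂ - regLog (H + 1 / k) r| ≤ ε * |regLog (H + 1 / k) r| + B)
    (hV₁ : |V₁ - regLog (1 / k + 1 / k) 0| ≤ ε * |regLog (1 / k + 1 / k) 0| + B)
    (hV₂ : |V₂ - regLog (1 / k + 1 / k) 0| ≤ ε * |regLog (1 / k + 1 / k) 0| + B)
    (hW : |W - regLog (1 / k + 1 / k) r| ≤ ε * |regLog (1 / k + 1 / k) r| + B) :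
    γ ^ 2 * K₀ + (2 * (γ * μ) - γ * μ * ((γ * K₁ - θ * k) + (γ * K₂ - θ * k)) +
        (γ * μ) ^ 2 / 2 * (V₁ + 2 * W + V₂))
      ≤ (γ ^ 2 * (truncExponent μ + 4 * ε) + 2 * (γ * μ) * θ) * -Real.log r
        + (γ ^ 2 * B + 2 * (γ * μ) + 2 * (γ * μ) * γ * B + 2 * (γ * μ) * θ
          + (γ * μ) ^ 2 / 2 * (2 + 2 * ε + 4 * B)) := by
  set s := -Real.log r with hs_def
  have hs0 : 0 < s := by linarith
  have hk0 : (0 : ℝ) < k := by linarith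
  have hr1 : r ≤ 1 := by
    have : Real.log r < 0 := by linarith
    exact ((Real.log_neg_iff hr).1 this).le
  have hkp : (0 : ℝ) < 1 / k := by positivity
  have e₀ : regLog (H + H) r = s * expAvg (2 * (H * s)) := by
    rw [regLog_eq (by positivity) hr, ← hs_def]; congr 2; ring
  have e₁ : s * expAvg (H * s + 1) ≤ regLog (H + 1 / k) r := by
    rw [regLog_eq (by positivity) hr, ← hs_def]
    refine mul_le_mul_of_nonneg_left (expAvg_antitone ?_) hs0.le
    rw [add_mul]
    gcongr
    rw [one_div, inv_mul_le_iff₀ hk0]; linarith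
  have e₁' : regLog (H + 1 / k) r ≤ s := regLog_le_neg_log (by positivity) hr
  have n₁ : 0 ≤ regLog (H + 1 / k) r := regLog_nonneg (by positivity) hr.le hr1
  have e₃ : regLog (1 / k + 1 / k) 0 = k / 2 := by
    rw [regLog_zero (by positivity)]; field_simp; norm_num
  have n₂ : 0 ≤ regLog (1 / k + 1 / k) r := regLog_nonneg (by positivity) hr.le hr1
  have e₂ : regLog (1 / k + 1 / k) r ≤ k / 2 * (1 - Real.exp (-2)) := by
    have : regLog (1 / k + 1 / k) r = k / 2 * (1 - Real.exp (-(2 * (s / k)))) := by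
      rw [regLog, Real.rpow_def_of_pos hr]
      have : Real.log r * (1 / k + 1 / k) = -(2 * (s / k)) := by rw [hs_def]; ring
      rw [this]; field_simp; ring
    rw [this]
    have h1 : s / k ≤ 1 := (div_le_one hk0).2 hsk
    have h2 : Real.exp (-2) ≤ Real.exp (-(2 * (s / k))) := Real.exp_le_exp.2 (by linarith)
    gcongr
  have hexp : Real.exp (-2) ≤ 1 := Real.exp_le_one_iff.2 (by norm_num)
  have hexp0 := Real.exp_pos (-2)
  have ineq := mul_le_mul_of_nonneg_left
    (expAvg_two_mul_sub_le (A := H * s) (by positivity) hHs hμ1) hs0.le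
  have a0 : expAvg (2 * (H * s)) ≤ 1 := expAvg_le_one (by positivity)
  have n0 := expAvg_nonneg (2 * (H * s))
  rw [e₀, abs_of_nonneg (mul_nonneg hs0.le n0)] at h₀
  rw [abs_of_nonneg n₁] at h₁ h₂
  rw [e₃, abs_of_nonneg (by positivity : (0 : ℝ) ≤ k / 2)] at hV₁ hV₂
  rw [abs_of_nonneg n₂] at hW
  have b₀ : K₀ ≤ s * expAvg (2 * (H * s)) + ε * s + B := by
    have := mul_le_mul_of_nonneg_left (mul_le_of_le_one_right hs0.le a0) hε
    linarith [(abs_le.1 h₀).2]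
  have bK : ∀ K : ℝ, |K - regLog (H + 1 / k) r| ≤ ε * regLog (H + 1 / k) r + B →
      s * expAvg (H * s + 1) - ε * s - B ≤ K := fun K h => by
    have := mul_le_mul_of_nonneg_left e₁' hε
    linarith [(abs_le.1 h).1]
  have b₁ := bK K₁ h₁
  have b₂ := bK K₂ h₂
  have bV : ∀ V : ℝ, |V - (k : ℝ) / 2| ≤ ε * (k / 2) + B →
      V ≤ (s + 1) / 2 + ε * ((s + 1) / 2) + B :=
    fun V h => by
      have := mul_le_mul_of_nonneg_left (show (k : ℝ) / 2 ≤ (s + 1) / 2 by linarith) hε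
      linarith [(abs_le.1 h).2]
  have c₁ := bV V₁ hV₁
  have c₂ := bV V₂ hV₂
  have c₃ : W ≤ (s + 1) / 2 * (1 - Real.exp (-2)) + ε * ((s + 1) / 2) + B := by
    have h1 : (k : ℝ) / 2 * (1 - Real.exp (-2)) ≤ (s + 1) / 2 * (1 - Real.exp (-2)) :=
      mul_le_mul_of_nonneg_right (by linarith) (by linarith)
    have h2 : (s + 1) / 2 * (1 - Real.exp (-2)) ≤ (s + 1) / 2 :=
      mul_le_of_le_one_right (by linarith) (by linarith)
    have := mul_le_mul_of_nonneg_left (e₂.trans (h1.trans h2)) hε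
    linarith [(abs_le.1 hW).2]
  have hl : 0 ≤ γ * μ := mul_nonneg hγ hμ0
  have d₀ := mul_le_mul_of_nonneg_left b₀ (sq_nonneg γ)
  have d₁ := mul_le_mul_of_nonneg_left (add_le_add b₁ b₂) (mul_nonneg hl hγ)
  have d₂ := mul_le_mul_of_nonneg_left
    (add_le_add (add_le_add c₁ (mul_le_mul_of_nonneg_left c₃ zero_le_two)) c₂)
    (by positivity : 0 ≤ (γ * μ) ^ 2 / 2)
  have d₃ := mul_le_mul_of_nonneg_left hks (mul_nonneg hl hθ)
  have d₄ := mul_le_mul_of_nonneg_left ineq (sq_nonneg γ)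
  have d₅ : (γ * μ) ^ 2 * (2 - Real.exp (-2)) ≤ (γ * μ) ^ 2 * 2 := by gcongr; linarith
  have d₆ : γ ^ 2 * (ε * s) * (2 * μ) ≤ γ ^ 2 * (ε * s) * 2 := by gcongr; linarith
  have d₇ : γ ^ 2 * (ε * s) * μ ^ 2 ≤ γ ^ 2 * (ε * s) * 1 := by gcongr; exact pow_le_one₀ hμ0 hμ1
  unfold truncExponent
  clear_value s
  clear h₀ h₁ h₂ hV₁ hV₂ hW e₀ e₁ e₁' n₁ e₃ n₂ e₂ ineq b₀ bK b₁ b₂ bV c₁ c₂ c₃ hexp hexp0 a0 n0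
  generalize Real.exp (-2) = q at *
  generalize expAvg (2 * (H * s)) = p₁ at *
  generalize expAvg (H * s + 1) = p₂ at *
  generalize expAvg 1 = p₃ at *
  linarith [d₀, d₁, d₂, d₃, d₄, d₅, d₆, d₇]

/-- The covariance `E[X^H(x) X^h(y)]`. -/
noncomputable def crossCov {Ω E : Type*} [MeasurableSpace Ω] (P : Measure Ω) (X : ℝ → E → Ω → ℝ)
    (H h : ℝ) (x y : E) : ℝ := ∫ ω, X H x ω * X h y ω ∂P

/-- A measurable Gaussian family whose covariances are comparable to the regularized logarithm on
`D` and converge off the diagonal. -/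
structure IsRegularizedField {Ω E : Type*} [MeasurableSpace Ω] [NormedAddCommGroup E]
    [MeasurableSpace E] (P : Measure Ω) (D : Set E) (H₀ B : ℝ) (X : ℝ → E → Ω → ℝ) : Prop where
  gauss : ∃ S, IsCenteredGaussianSpace P S ∧ ∀ H x, X H x ∈ S
  meas : ∀ H, Measurable fun p : E × Ω => X H p.1 p.2
  pos : 0 < H₀
  le_half : H₀ ≤ 1 / 2
  nonneg : 0 ≤ B
  bound : ∀ ε > 0, ∃ η > 0, ∀ H ∈ Ioo 0 (min η H₀), ∀ h ∈ Ioo 0 (min η H₀), ∀ x ∈ D, ∀ y ∈ D,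
    |crossCov P X H h x y - regLog (H + h) ‖x - y‖| ≤ ε * |regLog (H + h) ‖x - y‖| + B
  lim : ∀ x ∈ D, ∀ y ∈ D, x ≠ y → ∃ c, Tendsto (fun p : ℝ × ℝ => crossCov P X p.1 p.2 x y)
    (nhdsWithin 0 (Ioo 0 H₀) ×ˢ nhdsWithin 0 (Ioo 0 H₀)) (nhds c)

namespace IsRegularizedField

variable {Ω E : Type*} [MeasurableSpace Ω] [NormedAddCommGroup E] [MeasurableSpace E]
  {P : Measure Ω} {D : Set E} {H₀ B : ℝ} {X : ℝ → E → Ω → ℝ}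

lemma exists_abs_crossCov_le (hX : IsRegularizedField P D H₀ B X) {R : ℝ}
    (hDR : ∀ x ∈ D, ∀ y ∈ D, ‖x - y‖ ≤ R) :
    ∃ η > 0, ∀ H ∈ Ioo 0 (min η H₀), ∀ h ∈ Ioo 0 (min η H₀), ∀ x ∈ D, ∀ y ∈ D, x ≠ y →
      |crossCov P X H h x y| ≤ 2 * (max 0 (-Real.log ‖x - y‖) + R) + B := by
  obtain ⟨η, hη, hb⟩ := hX.bound 1 one_pos
  refine ⟨η, hη, fun H hH h hh x hx y hy hxy => ?_⟩
  have h1 := hb H hH h hh x hx y hy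
  have hl := hX.le_half
  have hH2 := hH.2.trans_le (min_le_right _ _)
  have hh2 := hh.2.trans_le (min_le_right _ _)
  have h2 := abs_regLog_le (add_pos hH.1 hh.1) (by linarith) (norm_pos_iff.2 (sub_ne_zero.2 hxy))
    (hDR x hx y hy)
  have h3 := abs_sub_abs_le_abs_sub (crossCov P X H h x y) (regLog (H + h) ‖x - y‖)
  linarith

lemma exists_truncated_two_point_le [IsProbabilityMeasure P] (hX : IsRegularizedField P D H₀ B X)
    {R δ γ : ℝ} (hR : 1 ≤ R)
    (hDR : ∀ x ∈ D, ∀ y ∈ D, ‖x - y‖ ≤ R) (hδ : 1 ≤ δ) (hγ : 0 < γ) (hγδ : γ ^ 2 ≤ 1.75001 * δ) :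
    ∃ (a θ : ℝ) (k₁ : ℕ), 0 < a ∧ a < δ ∧ 0 < θ ∧ 1 ≤ k₁ ∧
      (∀ k ≥ k₁, ∀ x ∈ D, crossCov P X (1 / (k : ℝ)) (1 / k) x x ≤ k) ∧
      ∀ k₀ ≥ k₁, ∃ K ≥ 0, ∃ η > 0, ∀ H ∈ Ioo 0 (min η H₀), ∀ N : ℕ, 1 / H + 2 ≤ N →
        ∀ x ∈ D, ∀ y ∈ D, x ≠ y →
        Real.exp (γ ^ 2 * crossCov P X H H x y) * cutExp P (Finset.Ico k₀ N)
          (fun k => X (1 / (k : ℝ)) x) (fun k => X (1 / (k : ℝ)) y)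
          (fun k => γ * crossCov P X H (1 / (k : ℝ)) y x - θ * k)
          (fun k => γ * crossCov P X H (1 / (k : ℝ)) x y - θ * k) ≤ K * ‖x - y‖ ^ (-a) := by
  obtain ⟨S, hS, hXS⟩ := hX.gauss
  have hB := hX.nonneg
  have hH₀ := hX.pos
  have hE2 := expAvg_two_lt
  obtain ⟨μ, hμ⟩ : ∃ μ : ℝ, μ = 0.678 := ⟨_, rfl⟩
  obtain ⟨ht1, ht2⟩ := hμ ▸ truncExponent_bounds
  have hμ0 : 0 < μ := by rw [hμ]; norm_num
  obtain ⟨ε, hε⟩ : ∃ ε : ℝ, ε = 0.0000001 := ⟨_, rfl⟩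
  have hε0 : 0 < ε := by rw [hε]; norm_num
  obtain ⟨θ, hθ⟩ : ∃ θ : ℝ, θ = 0.000001 / (2 * γ) := ⟨_, rfl⟩
  have hθγ : 2 * (γ * μ) * θ = 0.000001 * μ := by rw [hθ]; field_simp
  have hθ0 : 0 < θ := by rw [hθ]; positivity
  obtain ⟨a, ha⟩ : ∃ a : ℝ, a = γ ^ 2 * (truncExponent μ + 4 * ε) + 2 * (γ * μ) * θ := ⟨_, rfl⟩
  have hγ2 : 0 < γ ^ 2 := by positivity
  have ha0 : 0 < a := by
    have : 0 < truncExponent μ := by linarith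
    rw [ha]; positivity
  have haδ : a < δ := by
    rw [ha, hθγ]
    have h1 : γ ^ 2 * (truncExponent μ + 4 * ε) ≤ 1.75001 * δ * (0.571423 + 4 * ε) :=
      mul_le_mul hγδ (by linarith) (by positivity) (by positivity)
    have h2 : 1.75001 * δ * (0.571423 + 4 * ε) + 0.000001 * μ < δ := by
      rw [hε, hμ]; nlinarith
    linarith
  obtain ⟨η₁, hη₁, hb⟩ := hX.bound ε (by positivity)
  obtain ⟨k₁, hk₁⟩ := exists_nat_gt (max (max 1 (1 / min η₁ H₀)) (4 * B))
  have hm : 0 < min η₁ H₀ := lt_min hη₁ hH₀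
  have hk : ∀ k ≥ k₁, 1 < (k : ℝ) ∧ 1 / (k : ℝ) ∈ Ioo 0 (min η₁ H₀) ∧ 4 * B < k := by
    intro k hk
    have hk' : (k₁ : ℝ) ≤ k := Nat.cast_le.2 hk
    have h1 := (max_lt_iff.1 hk₁)
    have h2 := (max_lt_iff.1 h1.1)
    have h0 : 0 < (k : ℝ) := by linarith [h2.1]
    refine ⟨by linarith [h2.1], ⟨by positivity, ?_⟩, by linarith [h1.2]⟩
    rw [one_div, inv_lt_comm₀ h0 hm, ← one_div]
    linarith [h2.2]
  have hk₁1 : (1 : ℝ) < k₁ := (hk k₁ le_rfl).1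
  refine ⟨a, θ, k₁, ha0, haδ, hθ0, by exact_mod_cast hk₁1.le, fun k hkk x hx => ?_, ?_⟩
  · obtain ⟨h1, h2, h3⟩ := hk k hkk
    have h := hb _ h2 _ h2 x hx x hx
    have e : regLog (1 / k + 1 / k) 0 = (k : ℝ) / 2 := by
      rw [regLog_zero (by positivity)]; field_simp; norm_num
    rw [sub_self, norm_zero, e, abs_of_nonneg (by positivity : (0 : ℝ) ≤ k / 2)] at h
    have h4 := (abs_le.1 h).2
    rw [hε] at h4
    linarith
  intro k₀ hk₀
  set c₁ := γ ^ 2 * (2 * (k₀ + R) + B) with hc₁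
  set c₂ := γ ^ 2 * B + 2 * (γ * μ) + 2 * (γ * μ) * γ * B + 2 * (γ * μ) * θ
          + (γ * μ) ^ 2 / 2 * (2 + 2 * ε + 4 * B) with hc₂
  have hR0 : 0 < R := by linarith
  obtain ⟨η₂, hη₂, hb₂⟩ := hX.exists_abs_crossCov_le hDR
  refine ⟨max (Real.exp c₁ * R ^ a) (Real.exp c₂),
    le_max_of_le_right (Real.exp_pos _).le, min η₁ η₂, lt_min hη₁ hη₂, ?_⟩
  intro H hH N hN x hx y hy hxy
  have hH1 : H ∈ Ioo 0 (min η₁ H₀) := ⟨hH.1, hH.2.trans_le (min_le_min_right _ (min_le_left _ _))⟩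
  have hH2 : H ∈ Ioo 0 (min η₂ H₀) := ⟨hH.1, hH.2.trans_le (min_le_min_right _ (min_le_right _ _))⟩
  have hr : 0 < ‖x - y‖ := norm_pos_iff.2 (sub_ne_zero.2 hxy)
  have hyx : ‖y - x‖ = ‖x - y‖ := norm_sub_rev _ _
  have hpow : ‖x - y‖ ^ (-a) = Real.exp (a * -Real.log ‖x - y‖) := by
    rw [Real.rpow_def_of_pos hr]; congr 1; ring
  have hpow0 : 0 < ‖x - y‖ ^ (-a) := Real.rpow_pos_of_pos hr _
  have hcut1 := cutExp_le_one (P := P) (A := Finset.Ico k₀ N)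
    (fun k => (hS _ (hXS (1 / (k : ℝ)) x)).1) (fun k => (hS _ (hXS (1 / (k : ℝ)) y)).1)
    (fun k => γ * crossCov P X H (1 / (k : ℝ)) y x - θ * k)
    (fun k => γ * crossCov P X H (1 / (k : ℝ)) x y - θ * k)
  rcases lt_or_ge (-Real.log ‖x - y‖) k₀ with hs | hs
  · refine (mul_le_of_le_one_right (Real.exp_pos _).le hcut1).trans ?_
    have h1 : crossCov P X H H x y ≤ 2 * (k₀ + R) + B := by
      have h2 : max 0 (-Real.log ‖x - y‖) ≤ k₀ := max_le (by positivity) hs.le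
      linarith [le_abs_self (crossCov P X H H x y), hb₂ H hH2 H hH2 x hx y hy hxy]
    calc _ ≤ Real.exp c₁ := Real.exp_le_exp.2 (mul_le_mul_of_nonneg_left h1 hγ2.le)
      _ ≤ Real.exp c₁ * (R ^ a * ‖x - y‖ ^ (-a)) := by
          refine le_mul_of_one_le_right (Real.exp_pos _).le ?_
          rw [Real.rpow_neg hr.le, ← div_eq_mul_inv, one_le_div (by positivity)]
          exact Real.rpow_le_rpow hr.le (hDR x hx y hy) ha0.le
      _ ≤ _ := by rw [← mul_assoc]; gcongr; exact le_max_left _ _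
  have hs1 : 1 ≤ -Real.log ‖x - y‖ := by
    have : (k₁ : ℝ) ≤ k₀ := Nat.cast_le.2 hk₀
    linarith
  refine le_trans ?_ (mul_le_mul_of_nonneg_right (le_max_right _ _) hpow0.le)
  rw [hpow, ← Real.exp_add]
  rcases le_total (H * -Real.log ‖x - y‖) 1 with hA | hA
  · set k := ⌈-Real.log ‖x - y‖⌉₊ with hkdef
    have hkl : -Real.log ‖x - y‖ ≤ k := Nat.le_ceil _
    have hku : (k : ℝ) < -Real.log ‖x - y‖ + 1 := Nat.ceil_lt_add_one (by linarith)
    have hk₀k : k₀ ≤ k := by exact_mod_cast hs.trans hkl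
    have hkN : k < N := by
      have : -Real.log ‖x - y‖ ≤ 1 / H := by rw [le_div_iff₀ hH.1]; linarith
      have : (k : ℝ) < N := by linarith
      exact_mod_cast this
    obtain ⟨-, hk2, -⟩ := hk k (hk₀.trans hk₀k)
    have hc := hS.cutExp_le (fun k => hXS (1 / (k : ℝ)) x) (fun k => hXS (1 / (k : ℝ)) y)
      (fun k => γ * crossCov P X H (1 / (k : ℝ)) y x - θ * k)
      (fun k => γ * crossCov P X H (1 / (k : ℝ)) x y - θ * k) (Finset.mem_Ico.2 ⟨hk₀k, hkN⟩)
      (by positivity : 0 ≤ γ * μ)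
    refine (mul_le_mul_of_nonneg_left hc (Real.exp_pos _).le).trans ?_
    rw [← Real.exp_add, Real.exp_le_exp]
    have h := chernoff_exponent_le (γ := γ) (μ := μ) (θ := θ) hH.1 hr hs1 hkl hku.le hA hγ.le
      (by positivity) (by norm_num [hμ]) hθ0.le (by positivity) (hb H hH1 H hH1 x hx y hy)
      (by rw [← hyx]; exact hb H hH1 _ hk2 y hy x hx) (hb H hH1 _ hk2 x hx y hy)
      (by have := hb _ hk2 _ hk2 x hx x hx; rwa [sub_self, norm_zero] at this)
      (by have := hb _ hk2 _ hk2 y hy y hy; rwa [sub_self, norm_zero] at this)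
      (hb _ hk2 _ hk2 x hx y hy)
    rw [← ha, ← hc₂] at h
    simp only [crossCov] at h ⊢
    rw [add_comm c₂]
    exact h
  · refine (mul_le_of_le_one_right (Real.exp_pos _).le hcut1).trans ?_
    rw [Real.exp_le_exp]
    have hs0 : 0 < -Real.log ‖x - y‖ := by linarith
    have h1 := hb H hH1 H hH1 x hx y hy
    rw [regLog_eq (add_pos hH.1 hH.1) hr] at h1
    have h2 : expAvg ((H + H) * -Real.log ‖x - y‖) ≤ 0.44 :=
      (expAvg_antitone (by linarith)).trans hE2.le
    have h3 := expAvg_nonneg ((H + H) * -Real.log ‖x - y‖)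
    rw [abs_of_nonneg (mul_nonneg hs0.le h3)] at h1
    have h4 := mul_le_mul_of_nonneg_left h2 hs0.le
    have h5 : crossCov P X H H x y ≤ 0.5 * -Real.log ‖x - y‖ + B := by
      have := (abs_le.1 h1).2
      rw [hε] at this
      linarith
    have h6 : γ ^ 2 * 0.5 * -Real.log ‖x - y‖ ≤ a * -Real.log ‖x - y‖ := by
      refine mul_le_mul_of_nonneg_right ?_ hs0.le
      have : γ ^ 2 * 0.5 ≤ γ ^ 2 * (truncExponent μ + 4 * ε) :=
        mul_le_mul_of_nonneg_left (by linarith) hγ2.le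
      have : 0 ≤ 2 * (γ * μ) * θ := by positivity
      linarith
    have h7 : γ ^ 2 * B ≤ c₂ := by
      rw [hc₂]
      have : 0 ≤ 2 * (γ * μ) + 2 * (γ * μ) * γ * B + 2 * (γ * μ) * θ
          + (γ * μ) ^ 2 / 2 * (2 + 2 * ε + 4 * B) := by positivity
      linarith
    have := mul_le_mul_of_nonneg_left h5 hγ2.le
    linarith

end IsRegularizedField

/-- A measure without atoms on the diagonal whose Riesz energies below `δ` are finite. -/
def HasFiniteEnergies {E : Type*} [NormedAddCommGroup E] [MeasurableSpace E] (ν : Measure E)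
    (δ : ℝ) : Prop :=
  (∀ᵐ p ∂ν.prod ν, p.1 ≠ p.2) ∧
    ∀ a < δ, ∫⁻ p, ENNReal.ofReal (‖p.1 - p.2‖ ^ (-a)) ∂ν.prod ν < ⊤

lemma hasFiniteEnergies_restrict {E : Type*} [NormedAddCommGroup E] [NormedSpace ℝ E]
    [FiniteDimensional ℝ E] [MeasurableSpace E] [BorelSpace E] (μ : Measure E)
    [μ.IsAddHaarMeasure] [Nontrivial E] {D : Set E} (hD : MeasurableSet D)
    (hDb : Bornology.IsBounded D) : HasFiniteEnergies (μ.restrict D) (Module.finrank ℝ E) := by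
  have hfin : IsFiniteMeasure (μ.restrict D) :=
    ⟨by rw [Measure.restrict_apply_univ]; exact hDb.measure_lt_top⟩
  constructor
  · have hm : MeasurableSet {p : E × E | p.1 = p.2} :=
      measurableSet_eq_fun measurable_fst measurable_snd
    have h0 : (μ.restrict D).prod (μ.restrict D) {p : E × E | p.1 = p.2} = 0 := by
      rw [Measure.measure_prod_null hm]
      refine ae_of_all _ fun x => ?_
      have : Prod.mk x ⁻¹' {p : E × E | p.1 = p.2} = {x} := by
        ext y
        simp only [Set.mem_preimage, Set.mem_ofPred_eq, Set.mem_singleton_iff]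
        exact eq_comm
      simp only [this]; exact measure_singleton x
    exact measure_eq_zero_iff_ae_notMem.1 h0
  · intro a ha
    obtain ⟨R, hR⟩ := hDb.exists_pos_norm_le
    obtain ⟨hR0, hR⟩ := hR
    have hint : IntegrableOn (fun x : E => ‖x‖ ^ (-a)) (Metric.ball 0 (2 * R + 1)) μ := by
      rw [integrableOn_fun_norm_addHaar μ (f := fun r => r ^ (-a))]
      have h := (intervalIntegral.integrableOn_Ioo_rpow_iff (s := (Module.finrank ℝ E : ℝ) - 1 - a)
        (t := 2 * R + 1) (by positivity)).2 (by linarith)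
      refine h.congr_fun (fun y hy => ?_) measurableSet_Ioo
      have : ((Module.finrank ℝ E - 1 : ℕ) : ℝ) = (Module.finrank ℝ E : ℝ) - 1 := by
        rw [Nat.cast_sub Module.finrank_pos, Nat.cast_one]
      simp only [smul_eq_mul]
      rw [← Real.rpow_natCast, ← Real.rpow_add hy.1, this, sub_eq_add_neg]
    have hlt := hint.lintegral_lt_top
    have hmeas : Measurable fun x : E => ENNReal.ofReal (‖x‖ ^ (-a)) := by fun_prop
    rw [lintegral_prod _ (by fun_prop)]
    calc _ ≤ ∫⁻ _ in D, ∫⁻ z in Metric.ball 0 (2 * R + 1), ENNReal.ofReal (‖z‖ ^ (-a)) ∂μ ∂μ := by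
          refine setLIntegral_mono measurable_const fun x hx => ?_
          rw [← lintegral_indicator hD, ← lintegral_indicator measurableSet_ball]
          rw [← lintegral_sub_left_eq_self _ x]
          refine lintegral_mono fun y => ?_
          by_cases hy : x - y ∈ D
          · have hb : y ∈ Metric.ball (0 : E) (2 * R + 1) := by
              rw [mem_ball_zero_iff]
              have := norm_sub_le x (x - y)
              rw [sub_sub_cancel] at this
              linarith [hR x hx, hR _ hy]
            rw [indicator_of_mem hy, indicator_of_mem hb, sub_sub_cancel]
          · rw [indicator_of_notMem hy]; exact zero_le
      _ < ⊤ := by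
          rw [setLIntegral_const]
          exact ENNReal.mul_lt_top hlt hDb.measure_lt_top

section covarianceBound

variable {Ω E : Type*} [MeasurableSpace Ω] [MeasurableSpace E] {P : Measure Ω}

lemma integrable_prod_of_integral_abs_le [SFinite P] {ν : Measure E} [IsFiniteMeasure ν]
    {F : E × Ω → ℝ} (hF : Measurable F) (hi : ∀ x, Integrable (fun ω => F (x, ω)) P) {C : ℝ}
    (hC : ∀ᵐ x ∂ν, ∫ ω, |F (x, ω)| ∂P ≤ C) : Integrable F (ν.prod P) := by
  rw [integrable_prod_iff hF.aestronglyMeasurable]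
  refine ⟨ae_of_all _ hi, Integrable.of_bound ?_ C ?_⟩
  · exact (hF.norm.stronglyMeasurable.integral_prod_right').aestronglyMeasurable
  · filter_upwards [hC] with x hx
    rw [Real.norm_of_nonneg (integral_nonneg fun _ => norm_nonneg _)]
    exact hx

lemma integral_abs_mul_le {f g : Ω → ℝ} (hf : MemLp f 2 P) (hg : MemLp g 2 P) {t : ℝ}
    (ht : 0 < t) : ∫ ω, |f ω * g ω| ∂P
      ≤ t / 2 * ∫ ω, g ω * g ω ∂P + 1 / (2 * t) * ∫ ω, f ω * f ω ∂P := by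
  rw [← integral_const_mul, ← integral_const_mul, ← integral_add]
  · refine integral_mono (hf.integrable_mul hg).abs
      (((hg.integrable_mul hg).const_mul _).add ((hf.integrable_mul hf).const_mul _)) fun ω => ?_
    have e : t / 2 * (g ω * g ω) + 1 / (2 * t) * (f ω * f ω) - |f ω| * |g ω|
        = 1 / (2 * t) * (t * |g ω| - |f ω|) ^ 2 := by
      rw [← abs_mul_abs_self (g ω), ← abs_mul_abs_self (f ω)]
      field_simp; ring
    have : 0 ≤ 1 / (2 * t) * (t * |g ω| - |f ω|) ^ 2 := by positivity
    simp only [abs_mul]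
    linarith
  · exact (hg.integrable_mul hg).const_mul _
  · exact (hf.integrable_mul hf).const_mul _

/-- The covariances of a random field with a fixed variable are small on average if the
covariances of the field are. -/
lemma lintegral_abs_integral_mul_le [IsProbabilityMeasure P] {ν : Measure E} [IsFiniteMeasure ν]
    {Δ : E → Ω → ℝ} (hm : Measurable fun p : E × Ω => Δ p.1 p.2) (h2 : ∀ x, MemLp (Δ x) 2 P) {C : ℝ}
    (hC : ∀ᵐ x ∂ν, ∫ ω, Δ x ω * Δ x ω ∂P ≤ C) {Z : Ω → ℝ} (hZm : Measurable Z)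
    (hZ : MemLp Z 2 P) {t : ℝ} (ht : 0 < t) :
    ∫⁻ x, ENNReal.ofReal |∫ ω, Δ x ω * Z ω ∂P| ∂ν ≤ ENNReal.ofReal (t / 2 * ∫ ω, Z ω * Z ω ∂P
      + 1 / (2 * t) * ∫ p, |∫ ω, Δ p.1 ω * Δ p.2 ω ∂P| ∂ν.prod ν) := by
  have hΔ : ∀ x, Measurable (Δ x) := fun x => hm.of_uncurry_left (x := x)
  have hcm : Measurable fun x => ∫ ω, Δ x ω * Z ω ∂P :=
    (StronglyMeasurable.integral_prod_right' (f := fun p : E × Ω => Δ p.1 p.2 * Z p.2)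
      (by fun_prop : Measurable _).stronglyMeasurable).measurable
  set φ : E → ℝ := fun x => if 0 ≤ ∫ ω, Δ x ω * Z ω ∂P then 1 else -1 with hφ
  have hφm : Measurable φ := Measurable.ite (measurableSet_le measurable_const hcm)
    measurable_const measurable_const
  have hφ1 : ∀ x, |φ x| = 1 := fun x => by
    simp only [hφ]; split_ifs <;> simp
  have hφc : ∀ x, φ x * ∫ ω, Δ x ω * Z ω ∂P = |∫ ω, Δ x ω * Z ω ∂P| := fun x => by
    simp only [hφ]
    split_ifs with h
    · rw [abs_of_nonneg h, one_mul]
    · rw [abs_of_neg (not_le.1 h), neg_one_mul]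
  have i1 : Integrable (fun p : E × Ω => φ p.1 * (Δ p.1 p.2 * Z p.2)) (ν.prod P) := by
    refine integrable_prod_of_integral_abs_le (by fun_prop)
      (fun x => ((h2 x).integrable_mul hZ).const_mul (φ x))
      (C := 1 / 2 * ∫ ω, Z ω * Z ω ∂P + 1 / (2 * 1) * C) ?_
    filter_upwards [hC] with x hx
    simp only [abs_mul (φ x), hφ1, one_mul]
    refine (integral_abs_mul_le (h2 x) hZ one_pos).trans ?_
    gcongr
  have i2 : Integrable (fun p : (E × E) × Ω => φ p.1.1 * φ p.1.2 * (Δ p.1.1 p.2 * Δ p.1.2 p.2))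
      ((ν.prod ν).prod P) := by
    have hm1 : Measurable fun p : (E × E) × Ω => Δ p.1.1 p.2 :=
      hm.comp (measurable_fst.fst.prodMk measurable_snd)
    have hm2 : Measurable fun p : (E × E) × Ω => Δ p.1.2 p.2 :=
      hm.comp (measurable_fst.snd.prodMk measurable_snd)
    refine integrable_prod_of_integral_abs_le (by fun_prop)
      (fun x => ((h2 x.1).integrable_mul (h2 x.2)).const_mul (φ x.1 * φ x.2))
      (C := 1 / 2 * C + 1 / (2 * 1) * C) ?_
    filter_upwards [Measure.quasiMeasurePreserving_fst.ae hC,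
      Measure.quasiMeasurePreserving_snd.ae hC] with x hx hx'
    simp only [abs_mul (φ x.1 * φ x.2), abs_mul (φ x.1) (φ x.2), hφ1, one_mul]
    refine (integral_abs_mul_le (h2 x.1) (h2 x.2) one_pos).trans ?_
    gcongr
  set I : Ω → ℝ := fun ω => ∫ x, φ x * Δ x ω ∂ν with hI
  have hIZ : ∀ ω, ∫ x, φ x * (Δ x ω * Z ω) ∂ν = I ω * Z ω := fun ω => by
    simp only [hI, ← mul_assoc]; rw [integral_mul_const]
  have hII : ∀ ω, ∫ p : E × E, φ p.1 * φ p.2 * (Δ p.1 ω * Δ p.2 ω) ∂ν.prod ν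
      = I ω * I ω := fun ω => by
    rw [hI, ← integral_prod_mul]
    congr 1; funext p; ring
  have hleft : ∫ x, |∫ ω, Δ x ω * Z ω ∂P| ∂ν = ∫ ω, I ω * Z ω ∂P := by
    have := integral_integral_swap (f := fun x ω => φ x * (Δ x ω * Z ω)) i1
    simp only [hIZ, integral_const_mul, hφc] at this
    exact this
  have hsq : ∫ ω, I ω * I ω ∂P ≤ ∫ p, |∫ ω, Δ p.1 ω * Δ p.2 ω ∂P| ∂ν.prod ν := by
    have h := integral_integral_swap
      (f := fun (p : E × E) ω => φ p.1 * φ p.2 * (Δ p.1 ω * Δ p.2 ω)) i2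
    simp only [hII, integral_const_mul] at h
    rw [← h]
    refine (le_abs_self _).trans (abs_integral_le_integral_abs.trans (le_of_eq ?_))
    simp only [abs_mul (φ _ * φ _), abs_mul (φ _) (φ _), hφ1, one_mul]
  have j1 : Integrable (fun ω => I ω * Z ω) P := by
    have := i1.integral_prod_right
    simpa only [hIZ] using this
  have j2 : Integrable (fun ω => I ω * I ω) P := by
    have := i2.integral_prod_right
    simpa only [hII] using this
  have hIm : Measurable I :=
    (StronglyMeasurable.integral_prod_left' (f := fun p : E × Ω => φ p.1 * Δ p.1 p.2)
      (by fun_prop : Measurable _).stronglyMeasurable).measurable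
  have hI2 : MemLp I 2 P := by
    rw [memLp_two_iff_integrable_sq hIm.aestronglyMeasurable]
    simpa only [pow_two] using j2
  have j3 : Integrable (fun x => |∫ ω, Δ x ω * Z ω ∂P|) ν := by
    have := i1.integral_prod_left
    simpa only [integral_const_mul, hφc] using this
  rw [← ofReal_integral_eq_lintegral_ofReal j3 (ae_of_all _ fun _ => abs_nonneg _), hleft]
  refine ENNReal.ofReal_le_ofReal ?_
  calc _ ≤ ∫ ω, |I ω * Z ω| ∂P := (le_abs_self _).trans abs_integral_le_integral_abs
    _ ≤ _ := integral_abs_mul_le hI2 hZ ht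
    _ ≤ _ := by gcongr

end covarianceBound

lemma HasFiniteEnergies.integrable_max_neg_log {E : Type*} [NormedAddCommGroup E]
    [MeasurableSpace E] [BorelSpace E] [SecondCountableTopology E] {ν : Measure E} {δ : ℝ}
    (hν : HasFiniteEnergies ν δ) (hδ : 0 < δ) :
    Integrable (fun p : E × E => max 0 (-Real.log ‖p.1 - p.2‖)) (ν.prod ν) := by
  obtain ⟨h1, h2⟩ := hν
  have hs : 0 < δ / 2 := by linarith
  have hi : Integrable (fun p : E × E => ‖p.1 - p.2‖ ^ (-(δ / 2))) (ν.prod ν) := by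
    refine ⟨(by fun_prop : Measurable _).aestronglyMeasurable, ?_⟩
    rw [hasFiniteIntegral_iff_ofReal (ae_of_all _ fun p => by positivity)]
    exact h2 _ (by linarith)
  refine (hi.div_const (δ / 2)).mono' (by fun_prop : Measurable _).aestronglyMeasurable ?_
  filter_upwards [h1] with p hp
  have hr : 0 < ‖p.1 - p.2‖ := norm_pos_iff.2 (sub_ne_zero.2 hp)
  rw [Real.norm_of_nonneg (le_max_left _ _)]
  refine max_le (by positivity) ?_
  rw [← Real.log_inv, Real.rpow_neg hr.le, ← Real.inv_rpow hr.le]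
  exact Real.log_le_rpow_div (by positivity) hs

namespace Filter.Tendsto

variable {α β : Type*} {l : Filter α} {m : Filter β} {F : α × α → β}

lemma diag_fst (h : Tendsto F (l ×ˢ l) m) : Tendsto (fun p : α × α => F (p.1, p.1)) (l ×ˢ l) m :=
  h.comp (tendsto_fst.prodMk tendsto_fst)

lemma diag_snd (h : Tendsto F (l ×ˢ l) m) : Tendsto (fun p : α × α => F (p.2, p.2)) (l ×ˢ l) m :=
  h.comp (tendsto_snd.prodMk tendsto_snd)

lemma prod_swap (h : Tendsto F (l ×ˢ l) m) : Tendsto (fun p : α × α => F (p.2, p.1)) (l ×ˢ l) m :=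
  h.comp (tendsto_snd.prodMk tendsto_fst)

end Filter.Tendsto

namespace IsRegularizedField

variable {Ω E : Type*} [MeasurableSpace Ω] [NormedAddCommGroup E] [MeasurableSpace E]
  {P : Measure Ω} {D : Set E} {H₀ B : ℝ} {X : ℝ → E → Ω → ℝ}

lemma measurable_crossCov [SFinite P] (hX : IsRegularizedField P D H₀ B X) (H h : ℝ) :
    Measurable fun p : E × E => crossCov P X H h p.1 p.2 := by
  have h1 : Measurable fun p : (E × E) × Ω => X H p.1.1 p.2 :=
    (hX.meas H).comp (measurable_fst.fst.prodMk measurable_snd)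
  have h2 : Measurable fun p : (E × E) × Ω => X h p.1.2 p.2 :=
    (hX.meas h).comp (measurable_fst.snd.prodMk measurable_snd)
  exact (StronglyMeasurable.integral_prod_right' (h1.mul h2).stronglyMeasurable).measurable

lemma memLp_two (hX : IsRegularizedField P D H₀ B X) (H : ℝ) (x : E) : MemLp (X H x) 2 P := by
  obtain ⟨S, hS, hXS⟩ := hX.gauss
  exact hS.memLp_two (hXS H x)

lemma integral_sub_mul_sub (hX : IsRegularizedField P D H₀ B X) (H h : ℝ) (x y : E) :
    ∫ ω, (X H x ω - X h x ω) * (X H y ω - X h y ω) ∂P = crossCov P X H H x y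
      - crossCov P X H h x y - crossCov P X h H x y + crossCov P X h h x y := by
  have hi : ∀ H h x y, Integrable (fun ω => X H x ω * X h y ω) P := fun H h x y =>
    (hX.memLp_two H x).integrable_mul (hX.memLp_two h y)
  have e : ∀ ω, (X H x ω - X h x ω) * (X H y ω - X h y ω) = X H x ω * X H y ω
      - X H x ω * X h y ω - X h x ω * X H y ω + X h x ω * X h y ω := fun ω => by ring
  have i1 : Integrable (fun ω => X H x ω * X H y ω - X H x ω * X h y ω) P :=
    (hi _ _ _ _).sub (hi _ _ _ _)
  have i2 : Integrable
      (fun ω => X H x ω * X H y ω - X H x ω * X h y ω - X h x ω * X H y ω) P :=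
    i1.sub (hi _ _ _ _)
  simp_rw [e, crossCov]
  rw [integral_add i2 (hi _ _ _ _), integral_sub i1 (hi _ _ _ _),
    integral_sub (hi _ _ _ _) (hi _ _ _ _)]

lemma eventually_mem_Ioo {η : ℝ} (hη : 0 < η) :
    ∀ᶠ H in nhdsWithin (0 : ℝ) (Ioo 0 H₀), H ∈ Ioo 0 (min η H₀) := by
  filter_upwards [self_mem_nhdsWithin, mem_nhdsWithin_of_mem_nhds (Iio_mem_nhds hη)] with H h1 h2
  exact ⟨h1.1, lt_min h2 h1.2⟩

variable [BorelSpace E] [SecondCountableTopology E] {ν : Measure E}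

lemma tendsto_integral_abs_increment_cov [IsProbabilityMeasure P] [IsFiniteMeasure ν]
    (hX : IsRegularizedField P D H₀ B X) {R δ : ℝ}
    (hDR : ∀ x ∈ D, ∀ y ∈ D, ‖x - y‖ ≤ R) (hν : HasFiniteEnergies ν δ) (hδ : 0 < δ)
    (hνD : ∀ᵐ x ∂ν, x ∈ D) :
    Tendsto (fun p : ℝ × ℝ => ∫ q, |∫ ω, (X p.1 q.1 ω - X p.2 q.1 ω) *
        (X p.1 q.2 ω - X p.2 q.2 ω) ∂P| ∂ν.prod ν)
      (nhdsWithin 0 (Ioo 0 H₀) ×ˢ nhdsWithin 0 (Ioo 0 H₀)) (nhds 0) := by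
  simp_rw [hX.integral_sub_mul_sub]
  have hm := hX.measurable_crossCov
  obtain ⟨η, hη, hb⟩ := hX.exists_abs_crossCov_le hDR
  have hev := eventually_mem_Ioo (H₀ := H₀) hη
  have hD2 : ∀ᵐ q ∂ν.prod ν, q.1 ∈ D ∧ q.2 ∈ D :=
    (Measure.quasiMeasurePreserving_fst.ae hνD).and (Measure.quasiMeasurePreserving_snd.ae hνD)
  rw [show nhds (0 : ℝ) = nhds (∫ q : E × E, (0 : ℝ) ∂ν.prod ν) by simp]
  refine tendsto_integral_filter_of_dominated_convergence
    (fun q => 4 * (2 * (max 0 (-Real.log ‖q.1 - q.2‖) + R) + B)) ?_ ?_ ?_ ?_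
  · refine Eventually.of_forall fun p => Measurable.aestronglyMeasurable ?_
    exact ((((hm _ _).sub (hm _ _)).sub (hm _ _)).add (hm _ _)).abs
  · filter_upwards [hev.prod_mk hev] with p hp
    filter_upwards [hD2, hν.1] with q hq hne
    have b := fun H hH h hh => hb H hH h hh q.1 hq.1 q.2 hq.2 hne
    rw [Real.norm_eq_abs, abs_abs]
    refine (abs_add_le _ _).trans ?_
    have h1 := abs_sub (crossCov P X p.1 p.1 q.1 q.2 - crossCov P X p.1 p.2 q.1 q.2)
      (crossCov P X p.2 p.1 q.1 q.2)
    have h2 := abs_sub (crossCov P X p.1 p.1 q.1 q.2) (crossCov P X p.1 p.2 q.1 q.2)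
    linarith [b _ hp.1 _ hp.1, b _ hp.1 _ hp.2, b _ hp.2 _ hp.1, b _ hp.2 _ hp.2]
  · exact ((((hν.integrable_max_neg_log hδ).add (integrable_const R)).const_mul 2).add
      (integrable_const B)).const_mul 4
  · filter_upwards [hD2, hν.1] with q hq hne
    obtain ⟨c, hc⟩ := hX.lim q.1 hq.1 q.2 hq.2 hne
    have := (((hc.diag_fst.sub hc).sub hc.prod_swap).add hc.diag_snd).abs
    simpa using this

lemma tendsto_lintegral_abs_crossCov_sub [IsProbabilityMeasure P] [IsFiniteMeasure ν]
    (hX : IsRegularizedField P D H₀ B X) {R δ : ℝ}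
    (hDR : ∀ x ∈ D, ∀ y ∈ D, ‖x - y‖ ≤ R) (hν : HasFiniteEnergies ν δ) (hδ : 0 < δ)
    (hνD : ∀ᵐ x ∂ν, x ∈ D) {h₀ V : ℝ} (hV : ∀ x ∈ D, crossCov P X h₀ h₀ x x ≤ V) :
    Tendsto (fun p : ℝ × ℝ => ∫⁻ q, ENNReal.ofReal
        |crossCov P X p.1 h₀ q.1 q.2 - crossCov P X p.2 h₀ q.1 q.2| ∂ν.prod ν)
      (nhdsWithin 0 (Ioo 0 H₀) ×ˢ nhdsWithin 0 (Ioo 0 H₀)) (nhds 0) := by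
  have hm := hX.measurable_crossCov
  obtain ⟨η, hη, hb⟩ := hX.bound 1 one_pos
  have hev := eventually_mem_Ioo (H₀ := H₀) hη
  have hJ := hX.tendsto_integral_abs_increment_cov hDR hν hδ hνD
  have key : ∀ t > 0, ∀ᶠ p : ℝ × ℝ in nhdsWithin 0 (Ioo 0 H₀) ×ˢ nhdsWithin 0 (Ioo 0 H₀),
      ∫⁻ q, ENNReal.ofReal
        |crossCov P X p.1 h₀ q.1 q.2 - crossCov P X p.2 h₀ q.1 q.2| ∂ν.prod ν
      ≤ ENNReal.ofReal (t / 2 * V + 1 / (2 * t) * ∫ q, |∫ ω, (X p.1 q.1 ω - X p.2 q.1 ω) *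
        (X p.1 q.2 ω - X p.2 q.2 ω) ∂P| ∂ν.prod ν) * ν univ := by
    intro t ht
    filter_upwards [hev.prod_mk hev] with p hp
    rw [lintegral_prod_symm _ (by have := hm p.1 h₀; have := hm p.2 h₀; fun_prop),
      ← lintegral_const]
    refine lintegral_mono_ae ?_
    filter_upwards [hνD] with y hy
    have e : ∀ x, crossCov P X p.1 h₀ x y - crossCov P X p.2 h₀ x y
        = ∫ ω, (X p.1 x ω - X p.2 x ω) * X h₀ y ω ∂P := fun x => by
      simp_rw [sub_mul]
      exact (integral_sub ((hX.memLp_two _ _).integrable_mul (hX.memLp_two _ _))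
        ((hX.memLp_two _ _).integrable_mul (hX.memLp_two _ _))).symm
    simp only [e]
    refine (lintegral_abs_integral_mul_le (Δ := fun x ω => X p.1 x ω - X p.2 x ω)
      ((hX.meas p.1).sub (hX.meas p.2)) (fun x => (hX.memLp_two _ _).sub (hX.memLp_two _ _))
      (C := 4 * (1 * |regLog (p.1 + p.1) 0| + |regLog (p.1 + p.1) 0| + B) +
        4 * (1 * |regLog (p.2 + p.2) 0| + |regLog (p.2 + p.2) 0| + B) +
        4 * (1 * |regLog (p.1 + p.2) 0| + |regLog (p.1 + p.2) 0| + B) +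
        4 * (1 * |regLog (p.2 + p.1) 0| + |regLog (p.2 + p.1) 0| + B)) ?_ 
      ((hX.meas h₀).of_uncurry_left (x := y)) (hX.memLp_two _ _) ht).trans ?_
    · filter_upwards [hνD] with x hx
      rw [hX.integral_sub_mul_sub]
      have b : ∀ H ∈ Ioo 0 (min η H₀), ∀ h ∈ Ioo 0 (min η H₀), |crossCov P X H h x x|
          ≤ 1 * |regLog (H + h) 0| + |regLog (H + h) 0| + B := fun H hH h hh => by
        have h1 := hb H hH h hh x hx x hx
        rw [sub_self, norm_zero] at h1
        linarith [abs_sub_abs_le_abs_sub (crossCov P X H h x x) (regLog (H + h) 0)]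
      have b1 := b _ hp.1 _ hp.1
      have b2 := b _ hp.2 _ hp.2
      have b3 := b _ hp.1 _ hp.2
      have b4 := b _ hp.2 _ hp.1
      linarith [le_abs_self (crossCov P X p.1 p.1 x x), le_abs_self (crossCov P X p.2 p.2 x x),
        neg_le_abs (crossCov P X p.1 p.2 x x), neg_le_abs (crossCov P X p.2 p.1 x x),
        abs_nonneg (crossCov P X p.1 p.1 x x), abs_nonneg (crossCov P X p.2 p.2 x x),
        abs_nonneg (crossCov P X p.1 p.2 x x), abs_nonneg (crossCov P X p.2 p.1 x x)]
    · refine ENNReal.ofReal_le_ofReal ?_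
      have := hV y hy
      simp only [crossCov] at this
      gcongr
  have hfin := measure_ne_top ν univ
  rw [ENNReal.tendsto_nhds_zero]
  intro ε hε
  have h1 : Tendsto (fun t : ℝ => ENNReal.ofReal (t / 2 * V + t) * ν univ) (nhds 0) (nhds 0) := by
    have : Tendsto (fun t : ℝ => t / 2 * V + t) (nhds 0) (nhds 0) := by
      have : Continuous fun t : ℝ => t / 2 * V + t := by fun_prop
      simpa using this.tendsto 0
    have := ENNReal.Tendsto.mul_const (ENNReal.tendsto_ofReal this) (Or.inr hfin)
    simpa using this
  obtain ⟨t, ht1, ht0⟩ := (((h1.mono_left nhdsWithin_le_nhds).eventually_le_const hε).and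
    (self_mem_nhdsWithin : Ioi (0 : ℝ) ∈ nhdsWithin 0 (Ioi 0))).exists
  have ht : 0 < t := ht0
  filter_upwards [key t ht, hJ.eventually_le_const (show (0 : ℝ) < 2 * t * t by positivity)]
    with p hp1 hp2
  refine hp1.trans (le_trans ?_ ht1)
  gcongr
  rw [one_div, inv_mul_le_iff₀ (by positivity)]
  exact hp2

end IsRegularizedField

section ENNReal

lemma ENNReal.tsub_sq_add_le (a b : ENNReal) : (a - b) ^ 2 + 2 * (a * b) ≤ a ^ 2 + b ^ 2 := by
  rcases le_total a b with h | h
  · rw [tsub_eq_zero_of_le h]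
    obtain ⟨c, rfl⟩ := exists_add_of_le h
    calc (0 : ENNReal) ^ 2 + 2 * (a * (a + c)) ≤ 2 * (a * (a + c)) + c ^ 2 := by simp
      _ = a ^ 2 + (a + c) ^ 2 := by ring
  · obtain ⟨c, rfl⟩ := exists_add_of_le h
    have : b + c - b ≤ c := by rw [tsub_le_iff_left]
    calc (b + c - b) ^ 2 + 2 * ((b + c) * b) ≤ c ^ 2 + 2 * ((b + c) * b) := by gcongr
      _ = (b + c) ^ 2 + b ^ 2 := by ring

lemma ENNReal.le_add_inv_mul_sq {ε : ENNReal} (h0 : ε ≠ 0) (ht : ε ≠ ⊤) (u : ENNReal) :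
    u ≤ ε + ε⁻¹ * u ^ 2 := by
  rcases le_total u ε with h | h
  · exact h.trans le_self_add
  · calc u = ε⁻¹ * (ε * u) := by rw [← mul_assoc, ENNReal.inv_mul_cancel h0 ht, one_mul]
      _ ≤ ε⁻¹ * u ^ 2 := by rw [pow_two]; gcongr
      _ ≤ _ := le_add_self

end ENNReal

section secondMoment

variable {Ω E : Type*} [MeasurableSpace Ω] [MeasurableSpace E] {P : Measure Ω} {ν : Measure E}

lemma lintegral_mul_lintegral [SFinite P] [SFinite ν] {Y Y' : E → Ω → ENNReal}
    (hY : Measurable fun p : E × Ω => Y p.1 p.2) (hY' : Measurable fun p : E × Ω => Y' p.1 p.2) :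
    ∫⁻ ω, (∫⁻ x, Y x ω ∂ν) * (∫⁻ x, Y' x ω ∂ν) ∂P
      = ∫⁻ p, ∫⁻ ω, Y p.1 ω * Y' p.2 ω ∂P ∂ν.prod ν := by
  have h1 : Measurable fun p : (E × E) × Ω => Y p.1.1 p.2 :=
    hY.comp (measurable_fst.fst.prodMk measurable_snd)
  have h2 : Measurable fun p : (E × E) × Ω => Y' p.1.2 p.2 :=
    hY'.comp (measurable_fst.snd.prodMk measurable_snd)
  rw [lintegral_lintegral_swap (f := fun (p : E × E) ω => Y p.1 ω * Y' p.2 ω)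
    (h1.mul h2).aemeasurable]
  refine lintegral_congr fun ω => ?_
  exact (lintegral_prod_mul (hY.of_uncurry_right (y := ω)).aemeasurable
    (hY'.of_uncurry_right (y := ω)).aemeasurable).symm

lemma lintegral_sub_sq_le [SFinite P] [SFinite ν] {Y Y' : E → Ω → ENNReal}
    (hY : Measurable fun p : E × Ω => Y p.1 p.2) (hY' : Measurable fun p : E × Ω => Y' p.1 p.2)
    {ρ : E × E → ENNReal} (hρ : ∀ᵐ p ∂ν.prod ν, ∫⁻ ω, Y p.1 ω * Y p.2 ω ∂P
      + ∫⁻ ω, Y' p.1 ω * Y' p.2 ω ∂P ≤ ρ p + 2 * ∫⁻ ω, Y p.1 ω * Y' p.2 ω ∂P)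
    (hfin : ∫⁻ p, ∫⁻ ω, Y p.1 ω * Y' p.2 ω ∂P ∂ν.prod ν ≠ ⊤) :
    ∫⁻ ω, (∫⁻ x, Y x ω ∂ν - ∫⁻ x, Y' x ω ∂ν) ^ 2 ∂P ≤ ∫⁻ p, ρ p ∂ν.prod ν := by
  have hm : ∀ {Z Z' : E → Ω → ENNReal}, (Measurable fun p : E × Ω => Z p.1 p.2) →
      (Measurable fun p : E × Ω => Z' p.1 p.2) →
      Measurable fun p : E × E => ∫⁻ ω, Z p.1 ω * Z' p.2 ω ∂P := fun hZ hZ' =>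
    ((hZ.comp (measurable_fst.fst.prodMk measurable_snd)).mul
      (hZ'.comp (measurable_fst.snd.prodMk measurable_snd))).lintegral_prod_right'
  have mY : Measurable fun ω => ∫⁻ x, Y x ω ∂ν := hY.lintegral_prod_left'
  have mY' : Measurable fun ω => ∫⁻ x, Y' x ω ∂ν := hY'.lintegral_prod_left'
  refine ENNReal.le_of_add_le_add_right
    (ENNReal.mul_ne_top (a := 2) ENNReal.ofNat_ne_top hfin) ?_
  calc _ = ∫⁻ ω, (∫⁻ x, Y x ω ∂ν - ∫⁻ x, Y' x ω ∂ν) ^ 2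
        + 2 * ((∫⁻ x, Y x ω ∂ν) * ∫⁻ x, Y' x ω ∂ν) ∂P := by
        rw [lintegral_add_right _ (by fun_prop), lintegral_const_mul _ (by fun_prop),
          lintegral_mul_lintegral hY hY']
    _ ≤ ∫⁻ ω, (∫⁻ x, Y x ω ∂ν) * (∫⁻ x, Y x ω ∂ν)
        + (∫⁻ x, Y' x ω ∂ν) * (∫⁻ x, Y' x ω ∂ν) ∂P := by
        refine lintegral_mono fun ω => ?_
        rw [← pow_two, ← pow_two]
        exact ENNReal.tsub_sq_add_le _ _
    _ = ∫⁻ p, (∫⁻ ω, Y p.1 ω * Y p.2 ω ∂P + ∫⁻ ω, Y' p.1 ω * Y' p.2 ω ∂P) ∂ν.prod ν := by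
        rw [lintegral_add_right _ (by fun_prop), lintegral_mul_lintegral hY hY,
          lintegral_mul_lintegral hY' hY', lintegral_add_right _ (hm hY' hY')]
    _ ≤ ∫⁻ p, (ρ p + 2 * ∫⁻ ω, Y p.1 ω * Y' p.2 ω ∂P) ∂ν.prod ν := lintegral_mono_ae hρ
    _ = _ := by
        rw [lintegral_add_right _ ((hm hY hY').const_mul 2), lintegral_const_mul _ (hm hY hY')]

end secondMoment

section truncation

variable {T α : Type*} [MeasurableSpace T] {μ : Measure T} {l : Filter α}

/-- Domination by an integrable function, together with an estimate that is only useful where the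
a.e. finite weight `w` is bounded, gives convergence of integrals to zero. -/
lemma tendsto_lintegral_of_le_of_le_add_mul_sum [IsFiniteMeasure μ] [l.IsCountablyGenerated]
    {ρ ψ : α → T → ENNReal} {dom w : T → ENNReal} {a : ℕ → α → T → ENNReal} {c : ℕ → ENNReal}
    {A : α → Finset ℕ}
    (hdomm : Measurable dom) (hdom : ∫⁻ q, dom q ∂μ ≠ ⊤) (hwm : Measurable w)
    (hw : ∀ᵐ q ∂μ, w q ≠ ⊤) (hψm : ∀ p, Measurable (ψ p))
    (hψ : ∀ᵐ q ∂μ, Tendsto (fun p => ψ p q) l (nhds 0)) (ham : ∀ k p, Measurable (a k p))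
    (ha : ∀ k, Tendsto (fun p => ∫⁻ q, a k p q ∂μ) l (nhds 0)) (hc : ∑' k, c k ≠ ⊤)
    (h1 : ∀ᶠ p in l, ∀ᵐ q ∂μ, ρ p q ≤ dom q)
    (h2 : ∀ᶠ p in l, ∀ᵐ q ∂μ, ρ p q ≤ ψ p q + w q * ∑ k ∈ A p, min (a k p q) (w q * c k)) :
    Tendsto (fun p => ∫⁻ q, ρ p q ∂μ) l (nhds 0) := by
  have hmin : Tendsto (fun p => ∫⁻ q, min (dom q) (ψ p q) ∂μ) l (nhds 0) := by
    rw [show nhds (0 : ENNReal) = nhds (∫⁻ q, 0 ∂μ) by simp]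
    refine tendsto_lintegral_filter_of_dominated_convergence dom
      (Eventually.of_forall fun p => hdomm.min (hψm p))
      (Eventually.of_forall fun p => ae_of_all _ fun q => min_le_left _ _) hdom ?_
    filter_upwards [hψ] with q hq
    refine tendsto_of_tendsto_of_tendsto_of_le_of_le tendsto_const_nhds hq
      (fun _ => zero_le) fun _ => min_le_right _ _
  have htail : Tendsto (fun R : ℕ => ∫⁻ q, {q | (R : ENNReal) < w q}.indicator dom q ∂μ) atTop
      (nhds 0) := by
    rw [show nhds (0 : ENNReal) = nhds (∫⁻ q, 0 ∂μ) by simp]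
    refine tendsto_lintegral_of_dominated_convergence dom
      (fun R => hdomm.indicator (measurableSet_lt measurable_const hwm))
      (fun R => ae_of_all _ fun q => indicator_le_self' (fun _ _ => zero_le) q) hdom ?_
    filter_upwards [hw] with q hq
    obtain ⟨n, hn⟩ := ENNReal.exists_nat_gt hq
    refine tendsto_const_nhds.congr' ?_
    filter_upwards [eventually_ge_atTop n] with R hR
    rw [indicator_of_notMem]
    simp only [Set.mem_ofPred_eq, not_lt]
    exact hn.le.trans (by exact_mod_cast hR)
  rw [ENNReal.tendsto_nhds_zero]
  intro ε hε
  have hε4 : 0 < ε / 4 := ENNReal.div_pos hε.ne' (by simp)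
  obtain ⟨R, hR⟩ := (htail.eventually_le_const hε4).exists
  have hcn : Tendsto (fun n => (R : ENNReal) * (R * ∑' k, c (k + n)) * μ univ) atTop (nhds 0) := by
    have := ENNReal.tendsto_sum_nat_add c hc
    have := ENNReal.Tendsto.const_mul (a := (R : ENNReal)) this (Or.inr (by simp))
    have := ENNReal.Tendsto.const_mul (a := (R : ENNReal)) this (Or.inr (by simp))
    have := ENNReal.Tendsto.mul_const (b := μ univ) this (Or.inr (measure_ne_top _ _))
    simpa using this
  obtain ⟨n, hn⟩ := (hcn.eventually_le_const hε4).exists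
  have hsum : Tendsto (fun p => (R : ENNReal) * ∑ k ∈ Finset.range n, ∫⁻ q, a k p q ∂μ) l
      (nhds 0) := by
    have := tendsto_finsetSum (Finset.range n) fun k _ => ha k
    have := ENNReal.Tendsto.const_mul (a := (R : ENNReal)) this (Or.inr (by simp))
    simpa using this
  filter_upwards [h1, h2, hmin.eventually_le_const hε4, hsum.eventually_le_const hε4]
    with p hp1 hp2 hp3 hp4
  have hm1 : Measurable ({q | (R : ENNReal) < w q}.indicator dom) :=
    hdomm.indicator (measurableSet_lt measurable_const hwm)
  have hm2 : Measurable fun q => min (dom q) (ψ p q) := hdomm.min (hψm p)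
  have hm3 : Measurable fun q => (R : ENNReal) * ∑ k ∈ Finset.range n, a k p q :=
    (Finset.measurable_fun_sum _ fun k _ => ham k p).const_mul _
  calc ∫⁻ q, ρ p q ∂μ ≤ ∫⁻ q, ({q | (R : ENNReal) < w q}.indicator dom q + min (dom q) (ψ p q)
        + R * ∑ k ∈ Finset.range n, a k p q + R * (R * ∑' k, c (k + n))) ∂μ := by
        refine lintegral_mono_ae ?_
        filter_upwards [hp1, hp2] with q hq1 hq2
        by_cases hwR : (R : ENNReal) < w q
        · rw [indicator_of_mem (by exact hwR)]
          exact hq1.trans (by rw [add_assoc, add_assoc]; exact le_self_add)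
        rw [not_lt] at hwR
        rcases le_total (dom q) (ψ p q) with h | h
        · rw [min_eq_left h]
          refine hq1.trans ?_
          rw [add_assoc, add_assoc, add_left_comm]
          exact le_self_add
        · rw [min_eq_right h]
          refine hq2.trans ?_
          rw [add_assoc (_ + ψ p q), add_comm _ (ψ p q), add_assoc]
          gcongr
          refine le_trans ?_ le_add_self
          rw [← mul_add]
          gcongr
          calc ∑ k ∈ A p, min (a k p q) (w q * c k)
              ≤ ∑' k, min (a k p q) (w q * c k) := ENNReal.sum_le_tsum _
            _ = ∑ k ∈ Finset.range n, min (a k p q) (w q * c k)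
                + ∑' k, min (a (k + n) p q) (w q * c (k + n)) :=
              (ENNReal.summable.sum_add_tsum_nat_add' (f := fun k => min (a k p q) (w q * c k))
                (k := n)).symm
            _ ≤ _ := by
              rw [← ENNReal.tsum_mul_left]
              gcongr with k _ k
              · exact min_le_left _ _
              · exact (min_le_right _ _).trans (by gcongr)
    _ = ∫⁻ q, {q | (R : ENNReal) < w q}.indicator dom q ∂μ + ∫⁻ q, min (dom q) (ψ p q) ∂μ
        + R * ∑ k ∈ Finset.range n, ∫⁻ q, a k p q ∂μ + R * (R * ∑' k, c (k + n)) * μ univ := by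
        rw [lintegral_add_right _ measurable_const, lintegral_add_right _ hm3,
          lintegral_add_right _ hm2, lintegral_const,
          lintegral_const_mul _ (Finset.measurable_fun_sum _ fun k _ => ham k p),
          lintegral_finsetSum _ fun k _ => ham k p]
    _ ≤ ε / 4 + ε / 4 + ε / 4 + ε / 4 := add_le_add (add_le_add (add_le_add hR hp3) hp4) hn
    _ = ε := by
        rw [add_assoc, ← two_mul, ← two_mul, ← mul_assoc]
        norm_num
        exact ENNReal.mul_div_cancel (by simp) (by simp)

end truncation

section truncatedDensity

variable {Ω E : Type*} [MeasurableSpace Ω] (P : Measure Ω) (X : ℝ → E → Ω → ℝ)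

/-- The normalized exponential of `γ X^H(x)`. -/
noncomputable def wickDensity (γ H : ℝ) (x : E) (ω : Ω) : ℝ :=
  Real.exp (γ * X H x ω - γ ^ 2 / 2 * crossCov P X H H x x)

/-- A soft indicator that the approximations `X^{1/k}(x)`, `k ∈ A`, exceed the values expected under
the measure tilted by `γ X^H(x)` by at most `θ k`. -/
noncomputable def cutoff (γ θ : ℝ) (A : Finset ℕ) (H : ℝ) (x : E) (ω : Ω) : ℝ :=
  ∏ k ∈ A, softCut (X (1 / (k : ℝ)) x ω - (γ * crossCov P X H (1 / (k : ℝ)) x x + θ * k))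

/-- The two-point moment of the truncated densities. -/
noncomputable def pairMoment (γ θ : ℝ) (A : Finset ℕ) (H h : ℝ) (x y : E) : ℝ :=
  Real.exp (γ ^ 2 * crossCov P X H h x y) * cutExp P A
    (fun k => X (1 / (k : ℝ)) x) (fun k => X (1 / (k : ℝ)) y)
    (fun k => γ * crossCov P X h (1 / (k : ℝ)) y x - θ * k)
    (fun k => γ * crossCov P X H (1 / (k : ℝ)) x y - θ * k)

variable {P X}

lemma cutoff_nonneg (γ θ : ℝ) (A : Finset ℕ) (H : ℝ) (x : E) (ω : Ω) :
    0 ≤ cutoff P X γ θ A H x ω := prod_softCut_nonneg _ _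

lemma cutoff_le_one (γ θ : ℝ) (A : Finset ℕ) (H : ℝ) (x : E) (ω : Ω) :
    cutoff P X γ θ A H x ω ≤ 1 := prod_softCut_le_one _ _

lemma wickDensity_pos (γ H : ℝ) (x : E) (ω : Ω) : 0 < wickDensity P X γ H x ω := Real.exp_pos _

lemma wickDensity_eq (γ H : ℝ) (x : E) (ω : Ω) : wickDensity P X γ H x ω =
    Real.exp ((γ • X H x) ω - (∫ ω, (γ • X H x) ω * (γ • X H x) ω ∂P) / 2) := by
  have : ∀ ω, (γ • X H x) ω * (γ • X H x) ω = γ ^ 2 * (X H x ω * X H x ω) := fun ω => by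
    simp only [Pi.smul_apply, smul_eq_mul]; ring
  simp_rw [this, integral_const_mul, wickDensity, crossCov, Pi.smul_apply, smul_eq_mul]
  congr 1; ring

lemma integral_smul_mul_eq (γ H h : ℝ) (x y : E) :
    ∫ ω, (γ • X H x) ω * X h y ω ∂P = γ * crossCov P X H h x y := by
  simp only [Pi.smul_apply, smul_eq_mul, mul_assoc, integral_const_mul, crossCov]

lemma pairMoment_nonneg (γ θ : ℝ) (A : Finset ℕ) (H h : ℝ) (x y : E) :
    0 ≤ pairMoment P X γ θ A H h x y := mul_nonneg (Real.exp_pos _).le (cutExp_nonneg _ _)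

end truncatedDensity

lemma mul_sub_mul_le {e e' c c' : ℝ} (hc : 0 ≤ c) (hc1 : c ≤ 1) (he' : 0 ≤ e') :
    e * c - e' * c' ≤ |e - e'| + e' * |c - c'| := by
  calc e * c - e' * c' = (e - e') * c + e' * (c - c') := by ring
    _ ≤ |e - e'| * 1 + e' * |c - c'| :=
      add_le_add ((mul_le_mul_of_nonneg_right (le_abs_self _) hc).trans
        (mul_le_mul_of_nonneg_left hc1 (abs_nonneg _)))
        (mul_le_mul_of_nonneg_left (le_abs_self _) he')
    _ = _ := by ring

namespace IsRegularizedField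

variable {Ω E : Type*} [MeasurableSpace Ω] [NormedAddCommGroup E] [MeasurableSpace E]
  {P : Measure Ω} {D : Set E} {H₀ B : ℝ} {X : ℝ → E → Ω → ℝ}

lemma lintegral_wickDensity (hX : IsRegularizedField P D H₀ B X) (γ H : ℝ) (x : E) :
    ∫⁻ ω, ENNReal.ofReal (wickDensity P X γ H x ω) ∂P = 1 := by
  obtain ⟨S, hS, hXS⟩ := hX.gauss
  have h := hS.lintegral_exp (S.smul_mem γ (hXS H x))
  have hm : Measurable fun ω => ENNReal.ofReal (Real.exp ((γ • X H x) ω)) :=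
    ((hS _ (S.smul_mem γ (hXS H x))).1).exp.ennreal_ofReal
  simp_rw [wickDensity_eq, Real.exp_sub, div_eq_mul_inv _ (Real.exp _),
    ENNReal.ofReal_mul (Real.exp_pos _).le]
  rw [lintegral_mul_const _ hm, h, ← ENNReal.ofReal_mul (Real.exp_pos _).le,
    mul_inv_cancel₀ (Real.exp_pos _).ne', ENNReal.ofReal_one]

variable [IsProbabilityMeasure P]

lemma lintegral_truncated_mul (hX : IsRegularizedField P D H₀ B X) (γ θ : ℝ) (A : Finset ℕ)
    (H h : ℝ) (x y : E) :
    ∫⁻ ω, ENNReal.ofReal (wickDensity P X γ H x ω * cutoff P X γ θ A H x ω) *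
        ENNReal.ofReal (wickDensity P X γ h y ω * cutoff P X γ θ A h y ω) ∂P
      = ENNReal.ofReal (pairMoment P X γ θ A H h x y) := by
  obtain ⟨S, hS, hXS⟩ := hX.gauss
  simp_rw [wickDensity_eq, cutoff]
  rw [hS.lintegral_exp_mul_prod_mul_exp_mul_prod (S.smul_mem γ (hXS H x))
    (S.smul_mem γ (hXS h y)) (Z := fun k => X (1 / (k : ℝ)) x) (Z' := fun k => X (1 / (k : ℝ)) y)
    (fun k => hXS _ x) (fun k => hXS _ y), pairMoment]
  have e : ∫ ω, (γ • X H x) ω * (γ • X h y) ω ∂P = γ ^ 2 * crossCov P X H h x y := by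
    have : ∀ ω, (γ • X H x) ω * (γ • X h y) ω = γ ^ 2 * (X H x ω * X h y ω) := fun ω => by
      simp only [Pi.smul_apply, smul_eq_mul]; ring
    simp_rw [this, integral_const_mul, crossCov]
  rw [e]
  simp_rw [integral_smul_mul_eq]
  congr 3 <;> funext k <;> ring

lemma lintegral_wickDensity_mul_one_sub_cutoff_le (hX : IsRegularizedField P D H₀ B X)
    (γ : ℝ) {θ : ℝ} (hθ : 0 ≤ θ) {A : Finset ℕ} (H : ℝ) {x : E}
    (hv : ∀ k ∈ A, crossCov P X (1 / (k : ℝ)) (1 / k) x x ≤ k) :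
    ∫⁻ ω, ENNReal.ofReal (wickDensity P X γ H x ω) *
        ENNReal.ofReal (1 - cutoff P X γ θ A H x ω) ∂P
      ≤ ∑ k ∈ A, ENNReal.ofReal (Real.exp (-(θ ^ 2 / 2 * k))) := by
  obtain ⟨S, hS, hXS⟩ := hX.gauss
  have h := hS.lintegral_exp_mul_one_sub_prod_le (A := A) (S.smul_mem γ (hXS H x))
    (Z := fun k => X (1 / (k : ℝ)) x) (fun k => hXS _ x) hθ hv
  simp_rw [integral_smul_mul_eq, ← wickDensity_eq, sub_sub] at h
  exact h

lemma pairMoment_le_exp (hX : IsRegularizedField P D H₀ B X) (γ θ : ℝ) (A : Finset ℕ)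
    (H h : ℝ) (x y : E) :
    pairMoment P X γ θ A H h x y ≤ Real.exp (γ ^ 2 * crossCov P X H h x y) := by
  obtain ⟨S, hS, hXS⟩ := hX.gauss
  exact mul_le_of_le_one_right (Real.exp_pos _).le
    (cutExp_le_one (fun k => (hS _ (hXS _ x)).1) (fun k => (hS _ (hXS _ y)).1) _ _)

lemma pairMoment_add_sub_le (hX : IsRegularizedField P D H₀ B X) (γ : ℝ) {θ : ℝ} (hθ : 0 ≤ θ)
    {A : Finset ℕ} {H h R : ℝ} {x y : E}
    (hvx : ∀ k ∈ A, crossCov P X (1 / (k : ℝ)) (1 / k) x x ≤ k)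
    (hvy : ∀ k ∈ A, crossCov P X (1 / (k : ℝ)) (1 / k) y y ≤ k)
    (hHx : ∀ k ∈ A, γ * crossCov P X H (1 / (k : ℝ)) x y ≤ R)
    (hHy : ∀ k ∈ A, γ * crossCov P X H (1 / (k : ℝ)) y x ≤ R)
    (hhx : ∀ k ∈ A, γ * crossCov P X h (1 / (k : ℝ)) x y ≤ R)
    (hhy : ∀ k ∈ A, γ * crossCov P X h (1 / (k : ℝ)) y x ≤ R) :
    pairMoment P X γ θ A H H x y + pairMoment P X γ θ A h h x y
        - 2 * pairMoment P X γ θ A H h x y ≤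
      (|Real.exp (γ ^ 2 * crossCov P X H H x y) - Real.exp (γ ^ 2 * crossCov P X H h x y)|
        + |Real.exp (γ ^ 2 * crossCov P X h h x y) - Real.exp (γ ^ 2 * crossCov P X H h x y)|)
      + Real.exp (γ ^ 2 * crossCov P X H h x y) * ∑ k ∈ A,
        (min |γ * crossCov P X H (1 / (k : ℝ)) y x - γ * crossCov P X h (1 / (k : ℝ)) y x|
          (2 * Real.exp (θ * R) * Real.exp (-(θ ^ 2 / 2 * k)))
        + min |γ * crossCov P X h (1 / (k : ℝ)) x y - γ * crossCov P X H (1 / (k : ℝ)) x y|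
          (2 * Real.exp (θ * R) * Real.exp (-(θ ^ 2 / 2 * k)))) := by
  obtain ⟨S, hS, hXS⟩ := hX.gauss
  have hm : ∀ k h, Measurable (X k h) := fun k h => (hS _ (hXS k h)).1
  have d1 := hS.abs_cutExp_sub_le (A := A) (Z := fun k => X (1 / (k : ℝ)) x)
    (Z' := fun k => X (1 / (k : ℝ)) y) (fun k => hXS _ x) (fun k => hXS _ y) hθ
    (σ := fun k => γ * crossCov P X H (1 / (k : ℝ)) y x)
    (τ := fun k => γ * crossCov P X h (1 / (k : ℝ)) y x)
    (fun k => γ * crossCov P X H (1 / (k : ℝ)) x y - θ * k) hHy hhy hvx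
  have d2 := hS.abs_cutExp_sub_le (A := A) (Z := fun k => X (1 / (k : ℝ)) y)
    (Z' := fun k => X (1 / (k : ℝ)) x) (fun k => hXS _ y) (fun k => hXS _ x) hθ
    (σ := fun k => γ * crossCov P X h (1 / (k : ℝ)) x y)
    (τ := fun k => γ * crossCov P X H (1 / (k : ℝ)) x y)
    (fun k => γ * crossCov P X h (1 / (k : ℝ)) y x - θ * k) hhx hHx hvy
  rw [cutExp_comm, cutExp_comm (Z := fun k => X (1 / (k : ℝ)) y)] at d2
  have m1 := mul_sub_mul_le (e := Real.exp (γ ^ 2 * crossCov P X H H x y))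
    (c' := cutExp P A (fun k => X (1 / (k : ℝ)) x) (fun k => X (1 / (k : ℝ)) y)
      (fun k => γ * crossCov P X h (1 / (k : ℝ)) y x - θ * k)
      (fun k => γ * crossCov P X H (1 / (k : ℝ)) x y - θ * k))
    (cutExp_nonneg (P := P) (A := A) (Z := fun k => X (1 / (k : ℝ)) x)
      (Z' := fun k => X (1 / (k : ℝ)) y) (fun k => γ * crossCov P X H (1 / (k : ℝ)) y x - θ * k)
      (fun k => γ * crossCov P X H (1 / (k : ℝ)) x y - θ * k))
    (cutExp_le_one (fun k => hm _ x) (fun k => hm _ y) _ _)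
    (Real.exp_pos (γ ^ 2 * crossCov P X H h x y)).le
  have m2 := mul_sub_mul_le (e := Real.exp (γ ^ 2 * crossCov P X h h x y))
    (c' := cutExp P A (fun k => X (1 / (k : ℝ)) x) (fun k => X (1 / (k : ℝ)) y)
      (fun k => γ * crossCov P X h (1 / (k : ℝ)) y x - θ * k)
      (fun k => γ * crossCov P X H (1 / (k : ℝ)) x y - θ * k))
    (cutExp_nonneg (P := P) (A := A) (Z := fun k => X (1 / (k : ℝ)) x)
      (Z' := fun k => X (1 / (k : ℝ)) y) (fun k => γ * crossCov P X h (1 / (k : ℝ)) y x - θ * k)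
      (fun k => γ * crossCov P X h (1 / (k : ℝ)) x y - θ * k))
    (cutExp_le_one (fun k => hm _ x) (fun k => hm _ y) _ _)
    (Real.exp_pos (γ ^ 2 * crossCov P X H h x y)).le
  have n1 := mul_le_mul_of_nonneg_left d1 (Real.exp_pos (γ ^ 2 * crossCov P X H h x y)).le
  have n2 := mul_le_mul_of_nonneg_left d2 (Real.exp_pos (γ ^ 2 * crossCov P X H h x y)).le
  rw [Finset.sum_add_distrib, mul_add]
  simp only [pairMoment]
  linarith

lemma measurable_wickDensity (hX : IsRegularizedField P D H₀ B X) (γ H : ℝ) :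
    Measurable fun p : E × Ω => wickDensity P X γ H p.1 p.2 := by
  have h1 := hX.meas H
  have h2 : Measurable fun x => crossCov P X H H x x :=
    (hX.measurable_crossCov H H).comp (measurable_id.prodMk measurable_id)
  exact ((h1.const_mul γ).sub ((h2.comp measurable_fst).const_mul _)).exp

lemma measurable_cutoff (hX : IsRegularizedField P D H₀ B X) (γ θ : ℝ) (A : Finset ℕ) (H : ℝ) :
    Measurable fun p : E × Ω => cutoff P X γ θ A H p.1 p.2 := by
  refine Finset.measurable_fun_prod _ fun k _ => measurable_softCut.comp ?_
  have h2 : Measurable fun x => crossCov P X H (1 / (k : ℝ)) x x :=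
    (hX.measurable_crossCov H _).comp (measurable_id.prodMk measurable_id)
  exact (hX.meas _).sub (((h2.comp measurable_fst).const_mul _).add_const _)

end IsRegularizedField

namespace IsRegularizedField

variable {Ω E : Type*} [MeasurableSpace Ω] [NormedAddCommGroup E] [MeasurableSpace E]
  {P : Measure Ω} [IsProbabilityMeasure P] {D : Set E} {H₀ B : ℝ} {X : ℝ → E → Ω → ℝ}
  [BorelSpace E] [SecondCountableTopology E] {ν : Measure E} [IsFiniteMeasure ν]

lemma tendsto_lintegral_pairMoment (hX : IsRegularizedField P D H₀ B X) {R δ γ : ℝ} (hR : 1 ≤ R)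
    (hDR : ∀ x ∈ D, ∀ y ∈ D, ‖x - y‖ ≤ R) (hν : HasFiniteEnergies ν δ)
    (hνD : ∀ᵐ x ∂ν, x ∈ D) (hδ : 1 ≤ δ) (hγ : 0 < γ) (hγδ : γ ^ 2 ≤ 1.75001 * δ) :
    ∃ θ > 0, ∃ k₁ : ℕ, (∀ k ≥ k₁, ∀ x ∈ D, crossCov P X (1 / (k : ℝ)) (1 / k) x x ≤ k) ∧
      ∀ k₀ ≥ k₁, ∃ A : ℝ × ℝ → Finset ℕ, (∀ p, ∀ k ∈ A p, k₀ ≤ k) ∧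
      Tendsto (fun p : ℝ × ℝ => ∫⁻ q, ENNReal.ofReal (pairMoment P X γ θ (A p) p.1 p.1 q.1 q.2
        + pairMoment P X γ θ (A p) p.2 p.2 q.1 q.2
        - 2 * pairMoment P X γ θ (A p) p.1 p.2 q.1 q.2) ∂ν.prod ν)
      (nhdsWithin 0 (Ioo 0 H₀) ×ˢ nhdsWithin 0 (Ioo 0 H₀)) (nhds 0) := by
  obtain ⟨a, θ, k₁, ha0, haδ, hθ, hk₁, hvar, hdom⟩ :=
    hX.exists_truncated_two_point_le hR hDR hδ hγ hγδ
  obtain ⟨η, hη, hb⟩ := hX.exists_abs_crossCov_le hDR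
  have hm := hX.measurable_crossCov
  have hmin : 0 < min η H₀ := lt_min hη hX.pos
  obtain ⟨k₂, hk₂⟩ := exists_nat_gt (1 / min η H₀)
  refine ⟨θ, hθ, max k₁ k₂, fun k hk => hvar k ((le_max_left _ _).trans hk), fun k₀ hk₀ => ?_⟩
  obtain ⟨K, hK, η', hη', hdom⟩ := hdom k₀ ((le_max_left _ _).trans hk₀)
  have hkI : ∀ k ≥ k₀, 1 / (k : ℝ) ∈ Ioo 0 (min η H₀) := fun k hk => by
    have h1 : (k₂ : ℝ) ≤ k := by exact_mod_cast (le_max_right k₁ k₂).trans (hk₀.trans hk)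
    have h0 : 0 < 1 / min η H₀ := by positivity
    exact ⟨by have : (0 : ℝ) < k := by linarith
              positivity, (one_div_lt hmin (by linarith)).1 (by linarith)⟩
  have hvar' : ∀ k ≥ k₀, ∀ x ∈ D, crossCov P X (1 / (k : ℝ)) (1 / k) x x ≤ k := fun k hk =>
    hvar k (((le_max_left _ _).trans hk₀).trans hk)
  refine ⟨fun p => Finset.Ico k₀ (max ⌈1 / p.1⌉₊ ⌈1 / p.2⌉₊ + 2),
    fun p k hk => (Finset.mem_Ico.1 hk).1, ?_⟩
  have hev := (eventually_mem_Ioo (H₀ := H₀) hη).and (eventually_mem_Ioo (H₀ := H₀) hη')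
  have hD2 : ∀ᵐ q ∂ν.prod ν, (q.1 ∈ D ∧ q.2 ∈ D) ∧ q.1 ≠ q.2 :=
    ((Measure.quasiMeasurePreserving_fst.ae hνD).and
      (Measure.quasiMeasurePreserving_snd.ae hνD)).and hν.1
  obtain ⟨b, hbdef⟩ : ∃ b : E × E → ℝ,
      b = fun q => 2 * (max 0 (-Real.log ‖q.1 - q.2‖) + R) + B := ⟨_, rfl⟩
  have hbm : Measurable b := by rw [hbdef]; fun_prop
  have hb1 : ∀ H ∈ Ioo 0 (min η H₀), ∀ h ∈ Ioo 0 (min η H₀), ∀ q : E × E,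
      (q.1 ∈ D ∧ q.2 ∈ D) ∧ q.1 ≠ q.2 → crossCov P X H h q.1 q.2 ≤ b q ∧
        crossCov P X H h q.2 q.1 ≤ b q := fun H hH h hh q hq => by
    have h1 := hb H hH h hh q.1 hq.1.1 q.2 hq.1.2 hq.2
    have h2 := hb H hH h hh q.2 hq.1.2 q.1 hq.1.1 hq.2.symm
    rw [norm_sub_rev] at h2
    rw [hbdef]
    exact ⟨(le_abs_self _).trans h1, (le_abs_self _).trans h2⟩
  refine tendsto_lintegral_of_le_of_le_add_mul_sum
    (dom := fun q => ENNReal.ofReal (2 * K) * ENNReal.ofReal (‖q.1 - q.2‖ ^ (-a)))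
    (w := fun q => ENNReal.ofReal (Real.exp (γ ^ 2 * b q) + 4 * Real.exp (θ * (γ * b q))))
    (c := fun k => ENNReal.ofReal (Real.exp (-(θ ^ 2 / 2 * k))))
    (a := fun k p q => if k₀ ≤ k then ENNReal.ofReal γ * (ENNReal.ofReal
        |crossCov P X p.1 (1 / (k : ℝ)) q.2 q.1 - crossCov P X p.2 (1 / (k : ℝ)) q.2 q.1|
      + ENNReal.ofReal
        |crossCov P X p.1 (1 / (k : ℝ)) q.1 q.2 - crossCov P X p.2 (1 / (k : ℝ)) q.1 q.2|) else 0)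
    (ψ := fun p q => ENNReal.ofReal
      (|Real.exp (γ ^ 2 * crossCov P X p.1 p.1 q.1 q.2)
          - Real.exp (γ ^ 2 * crossCov P X p.1 p.2 q.1 q.2)|
        + |Real.exp (γ ^ 2 * crossCov P X p.2 p.2 q.1 q.2)
          - Real.exp (γ ^ 2 * crossCov P X p.1 p.2 q.1 q.2)|))
    (A := fun p => Finset.Ico k₀ (max ⌈1 / p.1⌉₊ ⌈1 / p.2⌉₊ + 2))
    (by fun_prop) ?_ (by fun_prop) (by simp) ?_ ?_ ?_ ?_ ?_ ?_ ?_
  · rw [lintegral_const_mul _ (by fun_prop)]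
    exact ENNReal.mul_ne_top ENNReal.ofReal_ne_top (hν.2 a haδ).ne
  · intro p
    have h1 := hm p.1 p.1
    have h2 := hm p.1 p.2
    have h3 := hm p.2 p.2
    fun_prop
  · filter_upwards [hD2] with q hq
    obtain ⟨c, hc⟩ := hX.lim q.1 hq.1.1 q.2 hq.1.2 hq.2
    have he : ∀ {u : ℝ × ℝ → ℝ}, Tendsto u (nhdsWithin 0 (Ioo 0 H₀) ×ˢ nhdsWithin 0 (Ioo 0 H₀))
        (nhds c) → Tendsto (fun p => Real.exp (γ ^ 2 * u p))
        (nhdsWithin 0 (Ioo 0 H₀) ×ˢ nhdsWithin 0 (Ioo 0 H₀)) (nhds (Real.exp (γ ^ 2 * c))) :=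
      fun hu => (Real.continuous_exp.tendsto _).comp (hu.const_mul _)
    have := (((he hc.diag_fst).sub (he hc)).abs).add (((he hc.diag_snd).sub (he hc)).abs)
    simpa using ENNReal.tendsto_ofReal this
  · intro k p
    split_ifs
    · have h1 := hm p.1 (1 / (k : ℝ))
      have h2 := hm p.2 (1 / (k : ℝ))
      have h3 := h1.comp measurable_swap
      have h4 := h2.comp measurable_swap
      simp only [Function.comp_def, Prod.fst_swap, Prod.snd_swap] at h3 h4
      fun_prop
    · exact measurable_const
  · intro k
    split_ifs with hk
    · have h := hX.tendsto_lintegral_abs_crossCov_sub hDR hν (by linarith) hνD (hvar' k hk)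
      have hmk : ∀ p : ℝ × ℝ, Measurable fun q : E × E => ENNReal.ofReal
          |crossCov P X p.1 (1 / (k : ℝ)) q.1 q.2 - crossCov P X p.2 (1 / (k : ℝ)) q.1 q.2| :=
        fun p => ((hm p.1 _).sub (hm p.2 _)).abs.ennreal_ofReal
      have e : ∀ p : ℝ × ℝ, ∫⁻ q, ENNReal.ofReal γ * (ENNReal.ofReal
          |crossCov P X p.1 (1 / (k : ℝ)) q.2 q.1 - crossCov P X p.2 (1 / (k : ℝ)) q.2 q.1|
        + ENNReal.ofReal |crossCov P X p.1 (1 / (k : ℝ)) q.1 q.2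
          - crossCov P X p.2 (1 / (k : ℝ)) q.1 q.2|) ∂ν.prod ν
          = ENNReal.ofReal γ * (∫⁻ q, ENNReal.ofReal |crossCov P X p.1 (1 / (k : ℝ)) q.1 q.2
          - crossCov P X p.2 (1 / (k : ℝ)) q.1 q.2| ∂ν.prod ν
          + ∫⁻ q, ENNReal.ofReal |crossCov P X p.1 (1 / (k : ℝ)) q.1 q.2
          - crossCov P X p.2 (1 / (k : ℝ)) q.1 q.2| ∂ν.prod ν) := fun p => by
        rw [lintegral_const_mul _ (by exact ((hmk p).comp measurable_swap).add (hmk p)),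
          lintegral_add_right _ (hmk p)]
        congr 2
        exact lintegral_prod_swap (μ := ν) (ν := ν) fun q => ENNReal.ofReal
          |crossCov P X p.1 (1 / (k : ℝ)) q.1 q.2 - crossCov P X p.2 (1 / (k : ℝ)) q.1 q.2|
      simp_rw [e]
      have := ENNReal.Tendsto.const_mul (a := ENNReal.ofReal γ) (h.add h)
        (Or.inr ENNReal.ofReal_ne_top)
      simpa using this
    · simp only [lintegral_zero]
      exact tendsto_const_nhds
  · have hs : Summable fun k : ℕ => Real.exp (-(θ ^ 2 / 2 * k)) := by
      have := Real.summable_exp_nat_mul_iff.2 (show -(θ ^ 2 / 2) < 0 by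
        have : 0 < θ ^ 2 := by positivity
        linarith)
      refine this.congr fun k => ?_
      congr 1; ring
    rw [← ENNReal.ofReal_tsum_of_nonneg (fun _ => (Real.exp_pos _).le) hs]
    exact ENNReal.ofReal_ne_top
  · filter_upwards [hev.prod_mk hev] with p hp
    filter_upwards [hD2] with q hq
    have hN : ∀ H : ℝ, ⌈1 / H⌉₊ ≤ max ⌈1 / p.1⌉₊ ⌈1 / p.2⌉₊ →
        1 / H + 2 ≤ ((max ⌈1 / p.1⌉₊ ⌈1 / p.2⌉₊ + 2 : ℕ) : ℝ) := fun H h => by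
      have h1 := Nat.le_ceil (1 / H)
      have h2 : (⌈1 / H⌉₊ : ℝ) ≤ (max ⌈1 / p.1⌉₊ ⌈1 / p.2⌉₊ : ℕ) := by exact_mod_cast h
      push_cast at h2 ⊢
      linarith
    have h1 := hdom p.1 hp.1.2 _ (hN _ (le_max_left _ _)) q.1 hq.1.1 q.2 hq.1.2 hq.2
    have h2 := hdom p.2 hp.2.2 _ (hN _ (le_max_right _ _)) q.1 hq.1.1 q.2 hq.1.2 hq.2
    have h3 := pairMoment_nonneg (P := P) (X := X) γ θ
      (Finset.Ico k₀ (max ⌈1 / p.1⌉₊ ⌈1 / p.2⌉₊ + 2)) p.1 p.2 q.1 q.2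
    rw [← ENNReal.ofReal_mul (by positivity)]
    refine ENNReal.ofReal_le_ofReal ?_
    simp only [pairMoment] at h3 ⊢
    linarith
  · filter_upwards [hev.prod_mk hev] with p hp
    filter_upwards [hD2] with q hq
    have hbd : ∀ H ∈ Ioo 0 (min η H₀),
        ∀ k ∈ Finset.Ico k₀ (max ⌈1 / p.1⌉₊ ⌈1 / p.2⌉₊ + 2),
        γ * crossCov P X H (1 / (k : ℝ)) q.1 q.2 ≤ γ * b q ∧
        γ * crossCov P X H (1 / (k : ℝ)) q.2 q.1 ≤ γ * b q := fun H hH k hk => by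
      have := hb1 H hH _ (hkI k (Finset.mem_Ico.1 hk).1) q hq
      exact ⟨mul_le_mul_of_nonneg_left this.1 hγ.le, mul_le_mul_of_nonneg_left this.2 hγ.le⟩
    have hmain := hX.pairMoment_add_sub_le γ hθ.le (H := p.1) (h := p.2) (R := γ * b q)
      (A := Finset.Ico k₀ (max ⌈1 / p.1⌉₊ ⌈1 / p.2⌉₊ + 2)) (x := q.1) (y := q.2)
      (fun k hk => hvar' k (Finset.mem_Ico.1 hk).1 _ hq.1.1)
      (fun k hk => hvar' k (Finset.mem_Ico.1 hk).1 _ hq.1.2)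
      (fun k hk => (hbd _ hp.1.1 k hk).1) (fun k hk => (hbd _ hp.1.1 k hk).2)
      (fun k hk => (hbd _ hp.2.1 k hk).1) (fun k hk => (hbd _ hp.2.1 k hk).2)
    have hexp : Real.exp (γ ^ 2 * crossCov P X p.1 p.2 q.1 q.2) ≤ Real.exp (γ ^ 2 * b q) :=
      Real.exp_le_exp.2 (mul_le_mul_of_nonneg_left (hb1 _ hp.1.1 _ hp.2.1 q hq).1 (by positivity))
    refine (ENNReal.ofReal_le_ofReal hmain).trans ?_
    refine ENNReal.ofReal_add_le.trans ?_
    gcongr ?_ + ?_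
    · exact le_rfl
    rw [ENNReal.ofReal_mul (Real.exp_pos _).le]
    refine mul_le_mul' (ENNReal.ofReal_le_ofReal (hexp.trans (le_add_of_nonneg_right
      (by positivity)))) ?_
    rw [ENNReal.ofReal_sum_of_nonneg fun k _ => by positivity]
    refine Finset.sum_le_sum fun k hk => le_min ?_ ?_
    · rw [if_pos (Finset.mem_Ico.1 hk).1, ← ENNReal.ofReal_add (abs_nonneg _) (abs_nonneg _),
        ← ENNReal.ofReal_mul hγ.le, mul_add]
      refine ENNReal.ofReal_le_ofReal (add_le_add ((min_le_left _ _).trans (le_of_eq ?_))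
        ((min_le_left _ _).trans (le_of_eq ?_)))
      · rw [← mul_sub, abs_mul, abs_of_pos hγ]
      · rw [← mul_sub, abs_mul, abs_of_pos hγ, abs_sub_comm]
    · rw [← ENNReal.ofReal_mul (by positivity)]
      refine ENNReal.ofReal_le_ofReal ((add_le_add (min_le_right _ _) (min_le_right _ _)).trans ?_)
      have h1 : 0 < Real.exp (γ ^ 2 * b q) * Real.exp (-(θ ^ 2 / 2 * k)) := by positivity
      linarith

end IsRegularizedField

namespace IsRegularizedField

variable {Ω E : Type*} [MeasurableSpace Ω] [NormedAddCommGroup E] [MeasurableSpace E]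
  {P : Measure Ω} [IsProbabilityMeasure P] {D : Set E} {H₀ B : ℝ} {X : ℝ → E → Ω → ℝ}

omit [IsProbabilityMeasure P] in
lemma exists_crossCov_le (hX : IsRegularizedField P D H₀ B X) :
    ∃ η > 0, ∀ H ∈ Ioo 0 (min η H₀), ∀ h ∈ Ioo 0 (min η H₀), ∃ V, ∀ x ∈ D, ∀ y ∈ D,
      crossCov P X H h x y ≤ V := by
  obtain ⟨η, hη, hb⟩ := hX.bound 1 one_pos
  have hd : ∀ H ∈ Ioo 0 (min η H₀), ∀ x ∈ D, crossCov P X H H x x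
      ≤ |regLog (H + H) 0| + (1 * |regLog (H + H) 0| + B) := fun H hH x hx => by
    have h1 := hb H hH H hH x hx x hx
    rw [sub_self, norm_zero] at h1
    linarith [le_abs_self (crossCov P X H H x x - regLog (H + H) 0),
      le_abs_self (regLog (H + H) 0)]
  refine ⟨η, hη, fun H hH h hh => ⟨1 / 2 * (|regLog (h + h) 0| + (1 * |regLog (h + h) 0| + B))
    + 1 / (2 * 1) * (|regLog (H + H) 0| + (1 * |regLog (H + H) 0| + B)), fun x hx y hy => ?_⟩⟩
  refine (le_abs_self _).trans (abs_integral_le_integral_abs.trans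
    ((integral_abs_mul_le (hX.memLp_two H x) (hX.memLp_two h y) one_pos).trans ?_))
  have h1 := hd H hH x hx
  have h2 := hd h hh y hy
  simp only [crossCov] at h1 h2
  gcongr

variable [BorelSpace E] [SecondCountableTopology E] {ν : Measure E} [IsFiniteMeasure ν]

omit [BorelSpace E] in
lemma lintegral_wickDensity_mul_le (hX : IsRegularizedField P D H₀ B X)
    (hνD : ∀ᵐ x ∂ν, x ∈ D) (γ : ℝ) {θ : ℝ} (hθ : 0 ≤ θ) {A : Finset ℕ} (H : ℝ)
    (hv : ∀ k ∈ A, ∀ x ∈ D, crossCov P X (1 / (k : ℝ)) (1 / k) x x ≤ k) :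
    ∫⁻ ω, ∫⁻ x, ENNReal.ofReal (wickDensity P X γ H x ω) *
        ENNReal.ofReal (1 - cutoff P X γ θ A H x ω) ∂ν ∂P
      ≤ (∑ k ∈ A, ENNReal.ofReal (Real.exp (-(θ ^ 2 / 2 * k)))) * ν univ := by
  rw [← lintegral_const]
  have h1 := hX.measurable_wickDensity γ H
  have h2 := hX.measurable_cutoff γ θ A H
  have hm : Measurable fun p : E × Ω => ENNReal.ofReal (wickDensity P X γ H p.1 p.2) *
        ENNReal.ofReal (1 - cutoff P X γ θ A H p.1 p.2) :=
    h1.ennreal_ofReal.mul (measurable_const.sub h2).ennreal_ofReal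
  rw [← lintegral_lintegral_swap (f := fun x ω => ENNReal.ofReal (wickDensity P X γ H x ω) *
        ENNReal.ofReal (1 - cutoff P X γ θ A H x ω)) hm.aemeasurable]
  refine lintegral_mono_ae ?_
  filter_upwards [hνD] with x hx
  exact hX.lintegral_wickDensity_mul_one_sub_cutoff_le γ hθ H fun k hk => hv k hk x hx

lemma eventually_lintegral_wickDensity_sub_le (hX : IsRegularizedField P D H₀ B X) {R δ γ : ℝ}
    (hR : 1 ≤ R) (hDR : ∀ x ∈ D, ∀ y ∈ D, ‖x - y‖ ≤ R) (hν : HasFiniteEnergies ν δ)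
    (hνD : ∀ᵐ x ∂ν, x ∈ D) (hδ : 1 ≤ δ) (hγ : 0 < γ) (hγδ : γ ^ 2 ≤ 1.75001 * δ)
    {f : E → ENNReal} (hf : Measurable f) (hf1 : ∀ x, f x ≤ 1) {ε : ENNReal} (hε : 0 < ε) :
    ∀ᶠ p : ℝ × ℝ in nhdsWithin 0 (Ioo 0 H₀) ×ˢ nhdsWithin 0 (Ioo 0 H₀),
      ∫⁻ ω, (∫⁻ x, ENNReal.ofReal (wickDensity P X γ p.1 x ω) * f x ∂ν
        - ∫⁻ x, ENNReal.ofReal (wickDensity P X γ p.2 x ω) * f x ∂ν) ∂P ≤ ε := by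
  rcases eq_or_ne ε ⊤ with rfl | hεt
  · simp
  have hε3 : 0 < ε / 3 := ENNReal.div_pos hε.ne' (by simp)
  have hε3t : ε / 3 ≠ ⊤ := (ENNReal.div_lt_top hεt (by simp)).ne
  obtain ⟨θ, hθ, k₁, hvar, hlim⟩ := hX.tendsto_lintegral_pairMoment hR hDR hν hνD hδ hγ hγδ
  have hc : ∑' k : ℕ, ENNReal.ofReal (Real.exp (-(θ ^ 2 / 2 * k))) ≠ ⊤ := by
    have hs : Summable fun k : ℕ => Real.exp (-(θ ^ 2 / 2 * k)) := by
      have := Real.summable_exp_nat_mul_iff.2 (show -(θ ^ 2 / 2) < 0 by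
        have : 0 < θ ^ 2 := by positivity
        linarith)
      refine this.congr fun k => ?_
      congr 1; ring
    rw [← ENNReal.ofReal_tsum_of_nonneg (fun _ => (Real.exp_pos _).le) hs]
    exact ENNReal.ofReal_ne_top
  have hcn := ENNReal.Tendsto.mul_const (b := ν univ) (ENNReal.tendsto_sum_nat_add _ hc)
    (Or.inr (measure_ne_top _ _))
  rw [zero_mul] at hcn
  obtain ⟨k₀, hk₀, hk₁⟩ := ((hcn.eventually_le_const hε3).and (eventually_ge_atTop k₁)).exists
  obtain ⟨A, hA, hlim⟩ := hlim k₀ hk₁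
  have hsumA : ∀ p, ∑ k ∈ A p, ENNReal.ofReal (Real.exp (-(θ ^ 2 / 2 * k)))
      ≤ ∑' k : ℕ, ENNReal.ofReal (Real.exp (-(θ ^ 2 / 2 * (k + k₀ : ℕ)))) := fun p => by
    calc _ = ∑ k ∈ (A p).image (· - k₀),
          ENNReal.ofReal (Real.exp (-(θ ^ 2 / 2 * (k + k₀ : ℕ)))) := by
          rw [Finset.sum_image fun i hi j hj hij => by
            have hij' : i - k₀ = j - k₀ := hij
            have := hA p i hi; have := hA p j hj; omega]
          exact Finset.sum_congr rfl fun k hk => by rw [Nat.sub_add_cancel (hA p k hk)]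
      _ ≤ _ := ENNReal.sum_le_tsum _
  obtain ⟨η, hη, hV⟩ := hX.exists_crossCov_le
  have hev := eventually_mem_Ioo (H₀ := H₀) hη
  have hlim' := ENNReal.Tendsto.const_mul (a := (ε / 3)⁻¹) hlim
    (Or.inr (ENNReal.inv_ne_top.2 hε3.ne'))
  rw [mul_zero] at hlim'
  have hD2 : ∀ᵐ q ∂ν.prod ν, q.1 ∈ D ∧ q.2 ∈ D :=
    (Measure.quasiMeasurePreserving_fst.ae hνD).and (Measure.quasiMeasurePreserving_snd.ae hνD)
  filter_upwards [hlim'.eventually_le_const hε3, hev.prod_mk hev] with p hp1 hp2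
  have hmY : ∀ H, Measurable fun q : E × Ω => ENNReal.ofReal
      (wickDensity P X γ H q.1 q.2 * cutoff P X γ θ (A p) H q.1 q.2) * f q.1 := fun H =>
    ((hX.measurable_wickDensity γ H).mul (hX.measurable_cutoff γ θ (A p) H)).ennreal_ofReal.mul
      (hf.comp measurable_fst)
  have hmB : Measurable fun q : E × Ω => ENNReal.ofReal (wickDensity P X γ p.1 q.1 q.2) *
      ENNReal.ofReal (1 - cutoff P X γ θ (A p) p.1 q.1 q.2) :=
    (hX.measurable_wickDensity γ _).ennreal_ofReal.mul
      (measurable_const.sub (hX.measurable_cutoff γ θ (A p) _)).ennreal_ofReal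
  have hmom : ∀ H h x y, ∫⁻ ω, (ENNReal.ofReal (wickDensity P X γ H x ω *
        cutoff P X γ θ (A p) H x ω) * f x) * (ENNReal.ofReal (wickDensity P X γ h y ω *
        cutoff P X γ θ (A p) h y ω) * f y) ∂P
      = (f x * f y) * ENNReal.ofReal (pairMoment P X γ θ (A p) H h x y) := fun H h x y => by
    rw [← hX.lintegral_truncated_mul, ← lintegral_const_mul]
    · exact lintegral_congr fun ω => by ring
    · have hm : ∀ H x, Measurable fun ω => ENNReal.ofReal (wickDensity P X γ H x ω *
          cutoff P X γ θ (A p) H x ω) := fun H x =>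
        (((hX.measurable_wickDensity γ H).comp measurable_prodMk_left).mul
          ((hX.measurable_cutoff γ θ (A p) H).comp measurable_prodMk_left)).ennreal_ofReal
      exact (hm H x).mul (hm h y)
  have hff : ∀ x y, f x * f y ≤ 1 := fun x y => mul_le_one' (hf1 x) (hf1 y)
  have hsq := lintegral_sub_sq_le (P := P) (ν := ν)
    (Y := fun x ω => ENNReal.ofReal
      (wickDensity P X γ p.1 x ω * cutoff P X γ θ (A p) p.1 x ω) * f x)
    (Y' := fun x ω => ENNReal.ofReal
      (wickDensity P X γ p.2 x ω * cutoff P X γ θ (A p) p.2 x ω) * f x) (hmY p.1) (hmY p.2)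
    (ρ := fun q => ENNReal.ofReal (pairMoment P X γ θ (A p) p.1 p.1 q.1 q.2
        + pairMoment P X γ θ (A p) p.2 p.2 q.1 q.2
        - 2 * pairMoment P X γ θ (A p) p.1 p.2 q.1 q.2))
    (ae_of_all _ fun q => by
      simp only [hmom]
      rw [← mul_add, ← ENNReal.ofReal_add (pairMoment_nonneg _ _ _ _ _ _ _)
        (pairMoment_nonneg _ _ _ _ _ _ _)]
      calc _ ≤ (f q.1 * f q.2) * (ENNReal.ofReal (pairMoment P X γ θ (A p) p.1 p.1 q.1 q.2
            + pairMoment P X γ θ (A p) p.2 p.2 q.1 q.2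
            - 2 * pairMoment P X γ θ (A p) p.1 p.2 q.1 q.2)
            + ENNReal.ofReal (2 * pairMoment P X γ θ (A p) p.1 p.2 q.1 q.2)) := by
            gcongr
            refine le_trans (le_of_eq ?_) ENNReal.ofReal_add_le
            rw [sub_add_cancel]
        _ ≤ _ := by
            rw [mul_add, ENNReal.ofReal_mul (by norm_num), ENNReal.ofReal_ofNat,
              mul_left_comm]
            gcongr
            exact mul_le_of_le_one_left' (hff _ _))
    (by
      obtain ⟨V, hV⟩ := hV p.1 hp2.1 p.2 hp2.2
      refine ((lintegral_mono_ae (g := fun _ => ENNReal.ofReal (Real.exp (γ ^ 2 * V))) ?_).trans_lt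
        ?_).ne
      · filter_upwards [hD2] with q hq
        rw [hmom]
        refine (mul_le_of_le_one_left' (hff _ _)).trans (ENNReal.ofReal_le_ofReal ?_)
        refine (hX.pairMoment_le_exp γ θ _ _ _ _ _).trans (Real.exp_le_exp.2 ?_)
        exact mul_le_mul_of_nonneg_left (hV _ hq.1 _ hq.2) (by positivity)
      · rw [lintegral_const]
        exact ENNReal.mul_lt_top ENNReal.ofReal_lt_top (measure_lt_top _ _))
  have hsplit : ∀ ω, ∫⁻ x, ENNReal.ofReal (wickDensity P X γ p.1 x ω) * f x ∂ν
        - ∫⁻ x, ENNReal.ofReal (wickDensity P X γ p.2 x ω) * f x ∂ν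
      ≤ (∫⁻ x, ENNReal.ofReal (wickDensity P X γ p.1 x ω * cutoff P X γ θ (A p) p.1 x ω) * f x ∂ν
        - ∫⁻ x, ENNReal.ofReal (wickDensity P X γ p.2 x ω * cutoff P X γ θ (A p) p.2 x ω) * f x ∂ν)
      + ∫⁻ x, ENNReal.ofReal (wickDensity P X γ p.1 x ω) *
        ENNReal.ofReal (1 - cutoff P X γ θ (A p) p.1 x ω) ∂ν := fun ω => by
    rw [tsub_le_iff_right]
    have h1 : ∫⁻ x, ENNReal.ofReal (wickDensity P X γ p.1 x ω) * f x ∂ν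
        ≤ ∫⁻ x, ENNReal.ofReal (wickDensity P X γ p.1 x ω * cutoff P X γ θ (A p) p.1 x ω)
          * f x ∂ν + ∫⁻ x, ENNReal.ofReal (wickDensity P X γ p.1 x ω) *
        ENNReal.ofReal (1 - cutoff P X γ θ (A p) p.1 x ω) ∂ν := by
      have hm : Measurable fun x => ENNReal.ofReal (wickDensity P X γ p.1 x ω) *
          ENNReal.ofReal (1 - cutoff P X γ θ (A p) p.1 x ω) := hmB.comp measurable_prodMk_right
      rw [← lintegral_add_right _ hm]
      refine lintegral_mono fun x => ?_
      have hw := (wickDensity_pos (P := P) (X := X) γ p.1 x ω).le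
      have hc0 := cutoff_nonneg (P := P) (X := X) γ θ (A p) p.1 x ω
      have hc1 := cutoff_le_one (P := P) (X := X) γ θ (A p) p.1 x ω
      calc ENNReal.ofReal (wickDensity P X γ p.1 x ω) * f x
          = ENNReal.ofReal (wickDensity P X γ p.1 x ω * cutoff P X γ θ (A p) p.1 x ω) * f x
            + ENNReal.ofReal (wickDensity P X γ p.1 x ω) *
              ENNReal.ofReal (1 - cutoff P X γ θ (A p) p.1 x ω) * f x := by
            rw [← add_mul, ← ENNReal.ofReal_mul hw,
              ← ENNReal.ofReal_add (by positivity) (mul_nonneg hw (by linarith))]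
            congr 2; ring
        _ ≤ _ := add_le_add le_rfl (mul_le_of_le_one_right' (hf1 x))
    have h2 : ∫⁻ x, ENNReal.ofReal (wickDensity P X γ p.2 x ω * cutoff P X γ θ (A p) p.2 x ω)
          * f x ∂ν ≤ ∫⁻ x, ENNReal.ofReal (wickDensity P X γ p.2 x ω) * f x ∂ν := by
      refine lintegral_mono fun x => ?_
      gcongr
      exact mul_le_of_le_one_right (wickDensity_pos _ _ _ _).le (cutoff_le_one _ _ _ _ _ _)
    refine h1.trans ?_
    rw [add_right_comm]
    gcongr
    exact le_tsub_add.trans (by gcongr)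
  calc _ ≤ ∫⁻ ω, ((∫⁻ x, ENNReal.ofReal (wickDensity P X γ p.1 x ω *
            cutoff P X γ θ (A p) p.1 x ω) * f x ∂ν
        - ∫⁻ x, ENNReal.ofReal (wickDensity P X γ p.2 x ω *
            cutoff P X γ θ (A p) p.2 x ω) * f x ∂ν)
      + ∫⁻ x, ENNReal.ofReal (wickDensity P X γ p.1 x ω) *
        ENNReal.ofReal (1 - cutoff P X γ θ (A p) p.1 x ω) ∂ν) ∂P := lintegral_mono hsplit
    _ = ∫⁻ ω, (∫⁻ x, ENNReal.ofReal (wickDensity P X γ p.1 x ω *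
            cutoff P X γ θ (A p) p.1 x ω) * f x ∂ν
        - ∫⁻ x, ENNReal.ofReal (wickDensity P X γ p.2 x ω *
            cutoff P X γ θ (A p) p.2 x ω) * f x ∂ν) ∂P
      + ∫⁻ ω, ∫⁻ x, ENNReal.ofReal (wickDensity P X γ p.1 x ω) *
        ENNReal.ofReal (1 - cutoff P X γ θ (A p) p.1 x ω) ∂ν ∂P :=
        lintegral_add_right _ hmB.lintegral_prod_left'
    _ ≤ (ε / 3 + ε / 3) + ε / 3 := by
        refine add_le_add ?_ ?_
        · refine (lintegral_mono fun ω => ENNReal.le_add_inv_mul_sq hε3.ne' hε3t _).trans ?_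
          have hm : Measurable fun ω => (∫⁻ x, ENNReal.ofReal (wickDensity P X γ p.1 x ω *
              cutoff P X γ θ (A p) p.1 x ω) * f x ∂ν - ∫⁻ x, ENNReal.ofReal
              (wickDensity P X γ p.2 x ω * cutoff P X γ θ (A p) p.2 x ω) * f x ∂ν) ^ 2 :=
            ((hmY p.1).lintegral_prod_left'.sub (hmY p.2).lintegral_prod_left').pow_const 2
          rw [lintegral_add_left measurable_const, lintegral_const, measure_univ, mul_one,
            lintegral_const_mul _ hm]
          gcongr
          exact (mul_le_mul' le_rfl hsq).trans hp1
        · refine (hX.lintegral_wickDensity_mul_le hνD γ hθ.le p.1 fun k hk =>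
            hvar k (hk₁.trans (hA p k hk))).trans (le_trans ?_ hk₀)
          gcongr
          exact hsumA p
    _ = ε := ENNReal.add_thirds ε

end IsRegularizedField

lemma isCenteredGaussianSpace_span {Ω ι : Type*} [MeasurableSpace Ω] {P : Measure Ω} {Z : ι → Ω → ℝ}
    (hZm : ∀ i, Measurable (Z i))
    (hZ : ∀ (n : ℕ) (c : Fin n → ℝ) (s : Fin n → ι),
      ∃ v : NNReal, P.map (fun ω => ∑ i, c i * Z (s i) ω) = gaussianReal 0 v) :
    IsCenteredGaussianSpace P (Submodule.span ℝ (range Z)) := by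
  intro ξ hξ
  obtain ⟨n, c, s, rfl⟩ := Submodule.mem_span_set'.1 hξ
  choose t ht using fun i => (s i).2
  have he : (∑ i, c i • (s i : Ω → ℝ)) = fun ω => ∑ i, c i * Z (t i) ω := by
    ext ω
    simp [Finset.sum_apply, ht]
  rw [he]
  exact ⟨Finset.measurable_fun_sum _ fun i _ => (hZm _).const_mul _, hZ n c t⟩

/-- The field restricted to `D` and to the parameters in `(0, H₀)`, extended by zero. -/
noncomputable def restrictField {Ω E : Type*} (D : Set E) (H₀ : ℝ) (X : ℝ → E → Ω → ℝ)
    (H : ℝ) (x : E) : Ω → ℝ :=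
  (Ioo 0 H₀ ×ˢ D).indicator (fun q => X q.1 q.2) (H, x)

section restrictField

variable {Ω E : Type*} {D : Set E} {H₀ H : ℝ} {x : E} {X : ℝ → E → Ω → ℝ}

lemma restrictField_of_mem (hH : H ∈ Ioo 0 H₀) (hx : x ∈ D) : restrictField D H₀ X H x = X H x :=
  indicator_of_mem (mk_mem_prod hH hx) _

lemma restrictField_of_notMem (h : ¬ (H ∈ Ioo 0 H₀ ∧ x ∈ D)) : restrictField D H₀ X H x = 0 :=
  indicator_of_notMem (fun h' => h ⟨h'.1, h'.2⟩) _

lemma measurable_restrictField [MeasurableSpace Ω] [MeasurableSpace E] (hD : MeasurableSet D)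
    (hX : Measurable fun p : ℝ × E × Ω => X p.1 p.2.1 p.2.2) (H : ℝ) :
    Measurable fun p : E × Ω => restrictField D H₀ X H p.1 p.2 := by
  by_cases hH : H ∈ Ioo 0 H₀
  · have h : (fun p : E × Ω => restrictField D H₀ X H p.1 p.2)
        = (D ×ˢ univ).indicator fun p => X H p.1 p.2 := by
      ext p
      by_cases hp : p.1 ∈ D
      · rw [restrictField_of_mem hH hp, indicator_of_mem (mk_mem_prod hp (mem_univ _))]
      · rw [restrictField_of_notMem fun h => hp h.2, indicator_of_notMem fun h => hp h.1]
        rfl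
    rw [h]
    exact (hX.comp (measurable_const.prodMk measurable_id)).indicator (hD.prod MeasurableSet.univ)
  · have h : (fun p : E × Ω => restrictField D H₀ X H p.1 p.2) = fun _ => 0 := by
      ext p
      rw [restrictField_of_notMem fun h => hH h.1]
      rfl
    rw [h]
    exact measurable_const

lemma restrictField_gaussian [MeasurableSpace Ω] {P : Measure Ω} [IsProbabilityMeasure P]
    (hgauss : ∀ (n : ℕ) (c : Fin n → ℝ) (Hs : Fin n → ℝ) (xs : Fin n → E),
      (∀ i, Hs i ∈ Ioo 0 H₀) → (∀ i, xs i ∈ D) →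
      ∃ v : NNReal, P.map (fun ω => ∑ i, c i * X (Hs i) (xs i) ω) = gaussianReal 0 v)
    (n : ℕ) (c : Fin n → ℝ) (s : Fin n → ℝ × E) :
    ∃ v : NNReal, P.map (fun ω => ∑ i, c i * restrictField D H₀ X (s i).1 (s i).2 ω)
      = gaussianReal 0 v := by
  by_cases hne : ∃ q : ℝ × E, q.1 ∈ Ioo 0 H₀ ∧ q.2 ∈ D
  · obtain ⟨q₀, hq₀⟩ := hne
    classical
    let a : Fin n → Prop := fun i => (s i).1 ∈ Ioo 0 H₀ ∧ (s i).2 ∈ D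
    obtain ⟨v, hv⟩ := hgauss n (fun i => if a i then c i else 0)
      (fun i => if a i then (s i).1 else q₀.1) (fun i => if a i then (s i).2 else q₀.2)
      (fun i => by split_ifs with h; exacts [h.1, hq₀.1])
      (fun i => by split_ifs with h; exacts [h.2, hq₀.2])
    refine ⟨v, hv ▸ congrArg (fun f => P.map f) ?_⟩
    ext ω
    refine Finset.sum_congr rfl fun i _ => ?_
    by_cases h : a i
    · rw [restrictField_of_mem h.1 h.2, if_pos h, if_pos h, if_pos h]
    · rw [restrictField_of_notMem h, if_neg h]
      simp
  · refine ⟨0, ?_⟩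
    have h : ∀ i, restrictField D H₀ X (s i).1 (s i).2 = 0 := fun i =>
      restrictField_of_notMem fun h => hne ⟨s i, h⟩
    simp [h]

end restrictField

lemma isRegularizedField_restrictField {Ω E : Type*} [MeasurableSpace Ω] [NormedAddCommGroup E]
    [MeasurableSpace E] {P : Measure Ω} [IsProbabilityMeasure P] {D : Set E}
    (hD : MeasurableSet D) {H₀ : ℝ} (hH₀ : H₀ ∈ Ioo (0 : ℝ) (1 / 2)) {X : ℝ → E → Ω → ℝ}
    (hXmeas : Measurable fun p : ℝ × E × Ω => X p.1 p.2.1 p.2.2)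
    {C : ℝ → ℝ → ℝ} {G : ℝ → ℝ → E → E → ℝ} {g : E → E → ℝ}
    (hgauss : ∀ (n : ℕ) (c : Fin n → ℝ) (Hs : Fin n → ℝ) (xs : Fin n → E),
      (∀ i, Hs i ∈ Ioo 0 H₀) → (∀ i, xs i ∈ D) →
      ∃ v : NNReal, P.map (fun ω => ∑ i, c i * X (Hs i) (xs i) ω) = gaussianReal 0 v)
    (hcov : ∀ H h : ℝ, H ∈ Ioo 0 H₀ → h ∈ Ioo 0 H₀ → ∀ x ∈ D, ∀ y ∈ D,
      ∫ ω, X H x ω * X h y ω ∂P =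
        C H h * ((1 - ‖x - y‖ ^ (H + h)) / (H + h) + G H h x y))
    (hA1 : ∀ ε > (0 : ℝ), ∃ η > (0 : ℝ), ∀ H h : ℝ,
      H ∈ Ioo 0 (min η H₀) → h ∈ Ioo 0 (min η H₀) → |C H h - 1| ≤ ε)
    {K : ℝ} (hK : ∀ x ∈ D, ∀ y ∈ D, |g x y| ≤ K) (hK0 : 0 ≤ K)
    (hA2 : ∀ ε > (0 : ℝ), ∃ η > (0 : ℝ), ∀ H h : ℝ,
      H ∈ Ioo 0 (min η H₀) → h ∈ Ioo 0 (min η H₀) →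
      ∀ x ∈ D, ∀ y ∈ D, |G H h x y - g x y| ≤ ε) :
    IsRegularizedField P D H₀ (2 * (K + 1)) (restrictField D H₀ X) := by
  have hcov' : ∀ H ∈ Ioo 0 H₀, ∀ h ∈ Ioo 0 H₀, ∀ x ∈ D, ∀ y ∈ D,
      crossCov P (restrictField D H₀ X) H h x y
        = C H h * (regLog (H + h) ‖x - y‖ + G H h x y) := fun H hH h hh x hx y hy => by
    rw [crossCov, restrictField_of_mem hH hx, restrictField_of_mem hh hy, hcov H h hH hh x hx y hy,
      regLog]
  have hm := measurable_restrictField (H₀ := H₀) hD hXmeas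
  refine ⟨⟨_, isCenteredGaussianSpace_span
    (Z := fun q : ℝ × E => restrictField D H₀ X q.1 q.2)
    (fun q => (hm q.1).comp measurable_prodMk_left) (restrictField_gaussian hgauss),
    fun H x => Submodule.subset_span ⟨(H, x), rfl⟩⟩, hm, hH₀.1, hH₀.2.le, by positivity, ?_, ?_⟩
  · intro ε hε
    obtain ⟨η₁, hη₁, h1⟩ := hA1 (min ε 1) (lt_min hε one_pos)
    obtain ⟨η₂, hη₂, h2⟩ := hA2 1 one_pos
    refine ⟨min η₁ η₂, lt_min hη₁ hη₂, fun H hH h hh x hx y hy => ?_⟩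
    have hle : ∀ t ∈ Ioo 0 (min (min η₁ η₂) H₀),
        t ∈ Ioo 0 (min η₁ H₀) ∧ t ∈ Ioo 0 (min η₂ H₀) ∧ t ∈ Ioo 0 H₀ := fun t ht => by
      obtain ⟨h0, ht⟩ := ht
      simp only [lt_min_iff] at ht
      exact ⟨⟨h0, lt_min ht.1.1 ht.2⟩, ⟨h0, lt_min ht.1.2 ht.2⟩, ⟨h0, ht.2⟩⟩
    obtain ⟨hH1, hH2, hH3⟩ := hle H hH
    obtain ⟨hh1, hh2, hh3⟩ := hle h hh
    have hC := h1 H h hH1 hh1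
    have hG := h2 H h hH2 hh2 x hx y hy
    have hg := hK x hx y hy
    have hC2 : |C H h| ≤ 2 := by
      have := abs_sub_abs_le_abs_sub (C H h) 1
      rw [abs_one] at this
      linarith [hC.trans (min_le_right ε 1)]
    have hG2 : |G H h x y| ≤ K + 1 := by
      have := abs_sub_abs_le_abs_sub (G H h x y) (g x y)
      linarith
    rw [hcov' H hH3 h hh3 x hx y hy, show C H h * (regLog (H + h) ‖x - y‖ + G H h x y)
      - regLog (H + h) ‖x - y‖ = (C H h - 1) * regLog (H + h) ‖x - y‖ + C H h * G H h x y by ring]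
    refine (abs_add_le _ _).trans ?_
    rw [abs_mul, abs_mul]
    gcongr
    exact hC.trans (min_le_left _ _)
  · intro x hx y hy hxy
    have hev : ∀ η > 0, ∀ᶠ p : ℝ × ℝ in nhdsWithin 0 (Ioo 0 H₀) ×ˢ nhdsWithin 0 (Ioo 0 H₀),
        p.1 ∈ Ioo 0 (min η H₀) ∧ p.2 ∈ Ioo 0 (min η H₀) := fun η hη =>
      (IsRegularizedField.eventually_mem_Ioo (H₀ := H₀) hη).prod_mk
        (IsRegularizedField.eventually_mem_Ioo (H₀ := H₀) hη)
    have hCt : Tendsto (fun p : ℝ × ℝ => C p.1 p.2)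
        (nhdsWithin 0 (Ioo 0 H₀) ×ˢ nhdsWithin 0 (Ioo 0 H₀)) (nhds 1) := by
      rw [Metric.tendsto_nhds]
      intro ε hε
      obtain ⟨η, hη, h1⟩ := hA1 (ε / 2) (half_pos hε)
      filter_upwards [hev η hη] with p hp
      rw [Real.dist_eq]
      linarith [h1 p.1 p.2 hp.1 hp.2]
    have hGt : Tendsto (fun p : ℝ × ℝ => G p.1 p.2 x y)
        (nhdsWithin 0 (Ioo 0 H₀) ×ˢ nhdsWithin 0 (Ioo 0 H₀)) (nhds (g x y)) := by
      rw [Metric.tendsto_nhds]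
      intro ε hε
      obtain ⟨η, hη, h1⟩ := hA2 (ε / 2) (half_pos hε)
      filter_upwards [hev η hη] with p hp
      rw [Real.dist_eq]
      linarith [h1 p.1 p.2 hp.1 hp.2 x hx y hy]
    have hadd : Tendsto (fun p : ℝ × ℝ => p.1 + p.2)
        (nhdsWithin 0 (Ioo 0 H₀) ×ˢ nhdsWithin 0 (Ioo 0 H₀)) (nhdsWithin 0 (Ioi 0)) := by
      refine tendsto_nhdsWithin_iff.2 ⟨?_, ?_⟩
      · have h1 : Tendsto (fun p : ℝ × ℝ => p.1)
          (nhdsWithin 0 (Ioo 0 H₀) ×ˢ nhdsWithin 0 (Ioo 0 H₀)) (nhds 0) :=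
          tendsto_fst.mono_right nhdsWithin_le_nhds
        have h2 : Tendsto (fun p : ℝ × ℝ => p.2)
          (nhdsWithin 0 (Ioo 0 H₀) ×ˢ nhdsWithin 0 (Ioo 0 H₀)) (nhds 0) :=
          tendsto_snd.mono_right nhdsWithin_le_nhds
        simpa using h1.add h2
      · filter_upwards [hev 1 one_pos] with p hp using add_pos hp.1.1 hp.2.1
    refine ⟨_, Tendsto.congr' ?_ (hCt.mul (((tendsto_regLog
      (norm_pos_iff.2 (sub_ne_zero.2 hxy))).comp hadd).add hGt))⟩
    filter_upwards [hev 1 one_pos] with p hp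
    exact (hcov' p.1 ⟨hp.1.1, hp.1.2.trans_le (min_le_right _ _)⟩ p.2
      ⟨hp.2.1, hp.2.2.trans_le (min_le_right _ _)⟩ x hx y hy).symm

theorem stmt_0
    {d : ℕ} (hd : 1 ≤ d)
    {Ω : Type} [MeasurableSpace Ω] (P : Measure Ω) [IsProbabilityMeasure P]
    (D : Set (EuclideanSpace ℝ (Fin d)))
    (hDopen : IsOpen D) (hDconn : IsConnected D) (hDbdd : Bornology.IsBounded D)
    (H₀ : ℝ) (hH₀ : H₀ ∈ Set.Ioo (0 : ℝ) (1/2))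
    (X : ℝ → EuclideanSpace ℝ (Fin d) → Ω → ℝ)
    (hXmeas : Measurable fun p : ℝ × EuclideanSpace ℝ (Fin d) × Ω => X p.1 p.2.1 p.2.2)
    (C : ℝ → ℝ → ℝ) (G : ℝ → ℝ → EuclideanSpace ℝ (Fin d) → EuclideanSpace ℝ (Fin d) → ℝ)
    (g : EuclideanSpace ℝ (Fin d) → EuclideanSpace ℝ (Fin d) → ℝ)
    (hCpos : ∀ H h : ℝ, H ∈ Set.Ioo 0 H₀ → h ∈ Set.Ioo 0 H₀ → 0 < C H h)
    (hGbdd : ∀ H h : ℝ, H ∈ Set.Ioo 0 H₀ → h ∈ Set.Ioo 0 H₀ →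
      ∃ K : ℝ, ∀ x ∈ D, ∀ y ∈ D, |G H h x y| ≤ K)
    (hgauss : ∀ (n : ℕ) (c : Fin n → ℝ) (Hs : Fin n → ℝ) (xs : Fin n → EuclideanSpace ℝ (Fin d)),
      (∀ i, Hs i ∈ Set.Ioo 0 H₀) → (∀ i, xs i ∈ D) →
      ∃ v : NNReal, P.map (fun ω => ∑ i, c i * X (Hs i) (xs i) ω) = gaussianReal 0 v)
    (hcov : ∀ H h : ℝ, H ∈ Set.Ioo 0 H₀ → h ∈ Set.Ioo 0 H₀ → ∀ x ∈ D, ∀ y ∈ D,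
      ∫ ω, X H x ω * X h y ω ∂P =
        C H h * ((1 - ‖x - y‖ ^ (H + h)) / (H + h) + G H h x y))
    (hA1 : ∀ ε > (0 : ℝ), ∃ η > (0 : ℝ), ∀ H h : ℝ,
      H ∈ Set.Ioo 0 (min η H₀) → h ∈ Set.Ioo 0 (min η H₀) → |C H h - 1| ≤ ε)
    (hgbdd : ∃ K : ℝ, ∀ x ∈ D, ∀ y ∈ D, |g x y| ≤ K)
    (hA2 : ∀ ε > (0 : ℝ), ∃ η > (0 : ℝ), ∀ H h : ℝ,
      H ∈ Set.Ioo 0 (min η H₀) → h ∈ Set.Ioo 0 (min η H₀) →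
      ∀ x ∈ D, ∀ y ∈ D, |G H h x y - g x y| ≤ ε)
    :
    ∃ γstar : ℝ, γstar > Real.sqrt (7 * d / 4) ∧
      ∀ γ ∈ Set.Ioc (0 : ℝ) γstar,
        ∃ Mlim : Ω → Measure (EuclideanSpace ℝ (Fin d)),
          (∀ ω, Mlim ω = (Mlim ω).restrict D) ∧
          ∀ ε : ENNReal, 0 < ε →
            Tendsto
              (fun H : ℝ => P {ω | ε ≤ levyProkhorovEDist
                ((volume.restrict D).withDensity fun x =>
                  ENNReal.ofReal (Real.exp (γ * X H x ω -
                    γ ^ 2 / 2 * ∫ ω', (X H x ω') ^ 2 ∂P)))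
                (Mlim ω)})
              (nhdsWithin 0 (Set.Ioo 0 H₀)) (nhds 0) := by
  have hd' : (1 : ℝ) ≤ d := by exact_mod_cast hd
  refine ⟨Real.sqrt (1.75001 * d), Real.sqrt_lt_sqrt (by positivity) (by linarith),
    fun γ hγ => ?_⟩
  have hγδ : γ ^ 2 ≤ 1.75001 * d := (Real.le_sqrt hγ.1.le (by positivity)).1 hγ.2
  have hDm := hDopen.measurableSet
  obtain ⟨K, hK⟩ := hgbdd
  obtain ⟨R, hR, hDR⟩ : ∃ R : ℝ, 1 ≤ R ∧ ∀ x ∈ D, ∀ y ∈ D, ‖x - y‖ ≤ R := by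
    obtain ⟨R, hR⟩ := Metric.isBounded_iff.1 hDbdd
    exact ⟨max 1 R, le_max_left _ _, fun x hx y hy =>
      (dist_eq_norm x y ▸ hR hx hy).trans (le_max_right _ _)⟩
  have hX := isRegularizedField_restrictField hDm hH₀ hXmeas hgauss hcov hA1
    (K := max K 0) (fun x hx y hy => (hK x hx y hy).trans (le_max_left _ _)) (le_max_right _ _) hA2
  have : Nonempty (Fin d) := ⟨⟨0, hd⟩⟩
  have : IsFiniteMeasure (volume.restrict D) := ⟨by
    rw [Measure.restrict_apply_univ]; exact hDbdd.measure_lt_top⟩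
  have hν : HasFiniteEnergies (volume.restrict D) (d : ℝ) := by
    simpa using hasFiniteEnergies_restrict (volume : Measure (EuclideanSpace ℝ (Fin d))) hDm hDbdd
  have hνD : ∀ᵐ x ∂volume.restrict D, x ∈ D := ae_restrict_mem hDm
  have hne : (nhdsWithin (0 : ℝ) (Ioo 0 H₀)).NeBot := by
    rw [nhdsWithin_Ioo_eq_nhdsGT hH₀.1]; infer_instance
  have hdens := hX.measurable_wickDensity γ
  have hslice : ∀ H ω, Measurable fun x =>
      ENNReal.ofReal (wickDensity P (restrictField D H₀ X) γ H x ω) := fun H ω =>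
    ((hdens H).comp measurable_prodMk_right).ennreal_ofReal
  have hlint : ∀ H ω {f : EuclideanSpace ℝ (Fin d) → ENNReal}, Measurable f →
      ∫⁻ x, f x ∂((volume.restrict D).withDensity fun x =>
        ENNReal.ofReal (wickDensity P (restrictField D H₀ X) γ H x ω))
      = ∫⁻ x, ENNReal.ofReal (wickDensity P (restrictField D H₀ X) γ H x ω) * f x
          ∂volume.restrict D := fun H ω f hf =>
    lintegral_withDensity_eq_lintegral_mul _ (hslice H ω) hf
  have hjoint : ∀ H {f : EuclideanSpace ℝ (Fin d) → ENNReal}, Measurable f →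
      Measurable fun p : EuclideanSpace ℝ (Fin d) × Ω =>
        ENNReal.ofReal (wickDensity P (restrictField D H₀ X) γ H p.1 p.2) * f p.1 :=
    fun H f hf => (hdens H).ennreal_ofReal.mul (hf.comp measurable_fst)
  obtain ⟨Mlim, hM, hlim⟩ := exists_tendsto_levyProkhorovEDist (P := P)
    (l := nhdsWithin (0 : ℝ) (Ioo 0 H₀))
    (M := fun H ω => (volume.restrict D).withDensity fun x =>
      ENNReal.ofReal (wickDensity P (restrictField D H₀ X) γ H x ω))
    hDopen hDbdd (ν := volume.restrict D) (by simp [Measure.restrict_apply hDm.compl])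
    univ_mem
    (fun H ω => withDensity_absolutelyContinuous _ _ (by simp [Measure.restrict_apply hDm.compl]))
    (fun H _ f => by
      have hf : Measurable fun x => (f x : ENNReal) := f.continuous.measurable.coe_nnreal_ennreal
      simp only [hlint H _ hf]
      exact (hjoint H hf).lintegral_prod_left'.aemeasurable)
    (fun H _ f => by
      have hf : Measurable fun x => (f x : ENNReal) := f.continuous.measurable.coe_nnreal_ennreal
      simp only [hlint H _ hf]
      rw [← lintegral_lintegral_swap (f := fun x ω => ENNReal.ofReal
        (wickDensity P (restrictField D H₀ X) γ H x ω) * f x) (hjoint H hf).aemeasurable]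
      refine lintegral_congr fun x => ?_
      have hm : Measurable fun ω =>
          ENNReal.ofReal (wickDensity P (restrictField D H₀ X) γ H x ω) :=
        ((hdens H).comp measurable_prodMk_left).ennreal_ofReal
      rw [lintegral_mul_const _ hm, hX.lintegral_wickDensity, one_mul])
    (fun f hf1 ε hε => by
      have hf : Measurable fun x => (f x : ENNReal) := f.continuous.measurable.coe_nnreal_ennreal
      simp only [hlint _ _ hf]
      exact hX.eventually_lintegral_wickDensity_sub_le hR hDR hν hνD hd' hγ.1 hγδ hf
        (fun x => by exact_mod_cast hf1 x) hε)
  refine ⟨Mlim, hM, fun ε hε => (hlim ε hε).congr' ?_⟩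
  filter_upwards [self_mem_nhdsWithin] with H hH
  have hwd : ∀ ω, ((volume.restrict D).withDensity fun x =>
      ENNReal.ofReal (wickDensity P (restrictField D H₀ X) γ H x ω))
      = (volume.restrict D).withDensity fun x => ENNReal.ofReal (Real.exp (γ * X H x ω -
          γ ^ 2 / 2 * ∫ ω', (X H x ω') ^ 2 ∂P)) := fun ω => withDensity_congr_ae <| by
    filter_upwards [hνD] with x hx
    simp only [wickDensity, crossCov, restrictField_of_mem hH hx, pow_two (X H x _)]
  simp only [hwd]
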